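/- arXiv:2512.14927 — 3 statements merged into one kernel-verified Lean document; each statement's English description precedes it below -/
import Mathlib

section
/- Let q > 2/(d+2) be a real number. Then for every ε > 0 there exists a nonempty bounded open set Ω ⊆ ℝ^d with Lebesgue measure |Ω| = 1 such that λ∞(Ω) · T∞(Ω)^q < ε. In other words, the infimum of λ∞(Ω) T∞(Ω)^q over all bounded open sets of unit measure is 0. -/
open MeasureTheory Metric Set

noncomputable def dirichletEigenvalue (d : ℕ) (Ω : Set (EuclideanSpace ℝ (Fin d))) : ℝ :=
  sInf { t : ℝ | ∃ u : EuclideanSpace ℝ (Fin d) → ℝ, ContDiff ℝ (⊤ : ℕ∞) u ∧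
    HasCompactSupport u ∧ tsupport u ⊆ Ω ∧
    (0 < ∫ x in Ω, (u x) ^ 2) ∧
    t = (∫ x in Ω, ‖fderiv ℝ u x‖ ^ 2) / ∫ x in Ω, (u x) ^ 2 }

noncomputable def dirichletTorsion (d : ℕ) (Ω : Set (EuclideanSpace ℝ (Fin d))) : ℝ :=
  sSup { t : ℝ | ∃ u : EuclideanSpace ℝ (Fin d) → ℝ, ContDiff ℝ (⊤ : ℕ∞) u ∧
    HasCompactSupport u ∧ tsupport u ⊆ Ω ∧
    (0 < ∫ x in Ω, ‖fderiv ℝ u x‖ ^ 2) ∧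
    t = (∫ x in Ω, u x) ^ 2 / ∫ x in Ω, ‖fderiv ℝ u x‖ ^ 2 }


open Filter Topology

theorem aux_sq {E : Type*} [TopologicalSpace E] {f : E → ℝ} (hf : HasCompactSupport f) :
    HasCompactSupport (fun x => f x ^ 2) := by
  simp only [pow_two]
  exact HasCompactSupport.mul_right (f := f) (f' := f) hf

theorem aux_int_fderiv_zero {d : ℕ} (F : EuclideanSpace ℝ (Fin d) → ℝ) (hF : ContDiff ℝ (⊤ : ℕ∞) F)
    (hc : HasCompactSupport F) (e : EuclideanSpace ℝ (Fin d)) : ∫ x, fderiv ℝ F x e = 0 := by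
  have hi : Integrable F := hF.continuous.integrable_of_hasCompactSupport hc
  have hi' : Integrable (fun x => fderiv ℝ F x e) :=
    ((hF.continuous_fderiv (by simp)).clm_apply continuous_const).integrable_of_hasCompactSupport
      (hc.fderiv_apply (𝕜 := ℝ) e)
  have h := integral_mul_fderiv_eq_neg_fderiv_mul_of_integrable (𝕜 := ℝ)
    (μ := (volume : Measure (EuclideanSpace ℝ (Fin d)))) (f := fun _ => (1:ℝ)) (g := F) (v := e)
    (by simp) (by simpa using hi') (by simpa using hi)
    (fun x _ => differentiableAt_const _) (fun x _ => hF.differentiable (by simp) x)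
  simpa using h

theorem aux_torsion {d : ℕ} (i : Fin d) (Ω : Set (EuclideanSpace ℝ (Fin d))) (hΩ : IsOpen Ω)
    (w B : EuclideanSpace ℝ (Fin d) → ℝ)
    (hw : ∀ x ∈ Ω, ∃ c : ℝ, w =ᶠ[𝓝 x] fun y => y i - c)
    (hB : IntegrableOn B Ω) (hwB : ∀ x ∈ Ω, w x ^ 2 ≤ B x) :
    dirichletTorsion d Ω ≤ ∫ x in Ω, B x := by
  have hm := hΩ.measurableSet
  have hB0 : 0 ≤ ∫ x in Ω, B x :=
    setIntegral_nonneg hm fun x hx => (sq_nonneg _).trans (hwB x hx)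
  refine Real.sSup_le ?_ hB0
  rintro t ⟨u, hu, huc, hus, hD, rfl⟩
  set e : EuclideanSpace ℝ (Fin d) := EuclideanSpace.single i 1 with he
  have hne : ‖e‖ = 1 := by simp [he]
  let F := fun x => w x * u x
  have hproj : ∀ x : EuclideanSpace ℝ (Fin d), HasFDerivAt (fun y : EuclideanSpace ℝ (Fin d) => y i)
      (EuclideanSpace.proj i : EuclideanSpace ℝ (Fin d) →L[ℝ] ℝ) x := fun x =>
    (EuclideanSpace.proj i : EuclideanSpace ℝ (Fin d) →L[ℝ] ℝ).hasFDerivAt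
  have hF : ContDiff ℝ (⊤ : ℕ∞) F := by
    rw [contDiff_iff_contDiffAt]
    intro x
    by_cases hx : x ∈ Ω
    · obtain ⟨c, hc⟩ := hw x hx
      have : ContDiffAt ℝ (⊤ : ℕ∞) w x := by
        refine ContDiffAt.congr_of_eventuallyEq ?_ hc
        exact ((EuclideanSpace.proj i : EuclideanSpace ℝ (Fin d) →L[ℝ] ℝ).contDiff.contDiffAt).sub
          contDiffAt_const
      exact this.mul hu.contDiffAt
    · have hx' : x ∉ tsupport u := fun h => hx (hus h)
      have h0 := notMem_tsupport_iff_eventuallyEq.mp hx'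
      have : F =ᶠ[𝓝 x] fun _ => 0 := by
        filter_upwards [h0] with y hy
        simp [F, hy]
      exact contDiffAt_const.congr_of_eventuallyEq this
  have hFc : HasCompactSupport F := huc.mul_left
  have hFd : ∀ x ∈ Ω, fderiv ℝ F x e = u x + w x * fderiv ℝ u x e := by
    intro x hx
    obtain ⟨c, hc⟩ := hw x hx
    have h1 := ((hproj x).sub_const c).congr_of_eventuallyEq hc
    have h2 := (h1.mul (hu.differentiable (by simp) x).hasFDerivAt).fderiv
    have : F = w * u := rfl
    rw [this, h2]
    simp [he]
    ring
  have hI0 : ∫ x in Ω, fderiv ℝ F x e = 0 := by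
    rw [setIntegral_eq_integral_of_forall_compl_eq_zero, aux_int_fderiv_zero F hF hFc e]
    intro x hx
    have hx' : x ∉ tsupport F := fun h => hx (hus (tsupport_mul_subset_right h))
    have : fderiv ℝ F x = 0 := by
      by_contra h
      exact hx' (support_fderiv_subset ℝ h)
    simp [this]
  have iu : IntegrableOn u Ω :=
    (hu.continuous.integrable_of_hasCompactSupport huc).integrableOn
  have iF : IntegrableOn (fun x => fderiv ℝ F x e) Ω :=
    (((hF.continuous_fderiv (by simp)).clm_apply continuous_const).integrable_of_hasCompactSupport
      (hFc.fderiv_apply (𝕜 := ℝ) e)).integrableOn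
  have iD : IntegrableOn (fun x => ‖fderiv ℝ u x‖ ^ 2) Ω := by
    refine (((hu.continuous_fderiv (by simp)).norm.pow 2).integrable_of_hasCompactSupport
      ?_).integrableOn
    exact aux_sq (huc.fderiv ℝ).norm
  set I := ∫ x in Ω, u x with hI
  set D := ∫ x in Ω, ‖fderiv ℝ u x‖ ^ 2 with hDD
  set s := I / D with hs
  have key : 0 ≤ ∫ x in Ω, (B x + 2 * s * (fderiv ℝ F x e) - 2 * s * u x
      + s ^ 2 * ‖fderiv ℝ u x‖ ^ 2) := by
    refine setIntegral_nonneg hm fun x hx => ?_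
    have h1 := hwB x hx
    have h2 : (fderiv ℝ u x e) ^ 2 ≤ ‖fderiv ℝ u x‖ ^ 2 := by
      have := (fderiv ℝ u x).le_opNorm e
      rw [hne, mul_one, Real.norm_eq_abs] at this
      exact sq_le_sq.mpr (by rwa [abs_norm])
    rw [hFd x hx]
    nlinarith [sq_nonneg (w x + s * fderiv ℝ u x e), mul_le_mul_of_nonneg_left h2 (sq_nonneg s)]
  have j1 : IntegrableOn (fun x => 2 * s * (fderiv ℝ F x e)) Ω := iF.const_mul _
  have j2 : IntegrableOn (fun x => 2 * s * u x) Ω := iu.const_mul _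
  have j3 : IntegrableOn (fun x => s ^ 2 * ‖fderiv ℝ u x‖ ^ 2) Ω := iD.const_mul _
  have j4 : IntegrableOn (fun x => B x + 2 * s * (fderiv ℝ F x e)) Ω := hB.add j1
  have j5 : IntegrableOn (fun x => B x + 2 * s * (fderiv ℝ F x e) - 2 * s * u x) Ω := j4.sub j2
  rw [integral_add j5 j3, integral_sub j4 j2, integral_add hB j1, integral_const_mul,
    integral_const_mul, integral_const_mul, hI0, ← hI, ← hDD] at key
  have h3 : s * D = I := by rw [hs]; field_simp
  have h4 : I ^ 2 / D = s * I := by rw [hs]; ring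
  have h5 : s ^ 2 * D = s * I := by rw [pow_two, mul_assoc, h3]
  rw [h4]
  rw [h5] at key
  linarith

theorem aux_bump {d : ℕ} (c : EuclideanSpace ℝ (Fin d)) : ∃ φ : EuclideanSpace ℝ (Fin d) → ℝ,
    ContDiff ℝ (⊤ : ℕ∞) φ ∧ HasCompactSupport φ ∧ Function.support φ = ball c (1/4) := by
  let φ : ContDiffBump c := ⟨1/8, 1/4, by norm_num, by norm_num⟩
  exact ⟨φ, φ.contDiff, φ.hasCompactSupport, φ.support_eq⟩

set_option maxHeartbeats 400000 in
theorem aux_eig (d : ℕ) : ∃ C : ℝ, 0 ≤ C ∧ ∀ r : ℝ, 0 < r →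
    ∀ Ω : Set (EuclideanSpace ℝ (Fin d)), {x | ∀ i, x i ∈ Ioo 0 r} ⊆ Ω →
      dirichletEigenvalue d Ω ≤ C / r ^ 2 := by
  obtain ⟨c, hc⟩ : ∃ c : EuclideanSpace ℝ (Fin d), ∀ i, c i = 1/2 :=
    ⟨WithLp.toLp 2 fun _ => 1/2, fun _ => rfl⟩
  obtain ⟨φ, hφ, hφc, hφs⟩ := aux_bump c
  have hpos : 0 < ∫ x, (φ x) ^ 2 := by
    have hi : Integrable (fun x => φ x ^ 2) := (hφ.continuous.pow 2).integrable_of_hasCompactSupport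
      (aux_sq hφc)
    refine (integral_pos_iff_support_of_nonneg (fun x => sq_nonneg _) hi).mpr ?_
    have : Function.support (fun x => φ x ^ 2) = ball c (1/4) := by
      rw [← hφs]; ext x; simp
    rw [this]
    exact measure_ball_pos _ _ (by norm_num)
  refine ⟨(∫ x, ‖fderiv ℝ φ x‖ ^ 2) / ∫ x, (φ x) ^ 2,
    div_nonneg (integral_nonneg fun _ => sq_nonneg _) hpos.le, ?_⟩
  intro r hr Ω hΩ
  let u : EuclideanSpace ℝ (Fin d) → ℝ := fun x => φ (r⁻¹ • x)
  have hr' : r⁻¹ ≠ 0 := by positivity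
  have hu : ContDiff ℝ (⊤ : ℕ∞) u := hφ.comp (contDiff_const_smul _)
  have huc : HasCompactSupport u := hφc.comp_smul hr'
  have hus0 : ∀ x, u x ≠ 0 → r⁻¹ • x ∈ ball c (1/4) := by
    intro x hx
    rw [← hφs]
    exact hx
  have hus : tsupport u ⊆ Ω := by
    refine Subset.trans ?_ hΩ
    have hcl : IsClosed ((fun x : EuclideanSpace ℝ (Fin d) => r⁻¹ • x) ⁻¹' closedBall c (1/4)) :=
      isClosed_closedBall.preimage (continuous_const_smul _)
    have hsub : tsupport u ⊆ (fun x : EuclideanSpace ℝ (Fin d) => r⁻¹ • x) ⁻¹' closedBall c (1/4) := by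
      refine closure_minimal (fun x hx => ?_) hcl
      rw [Set.mem_preimage, mem_closedBall]
      have h := hus0 x hx
      rw [mem_ball] at h
      exact h.le
    refine hsub.trans fun x hx i => ?_
    have h1 : ‖r⁻¹ • x - c‖ ≤ 1/4 := by 
      rwa [Set.mem_preimage, mem_closedBall, dist_eq_norm] at hx
    have h2 := (PiLp.norm_apply_le (r⁻¹ • x - c) i).trans h1
    simp only [PiLp.sub_apply, PiLp.smul_apply, smul_eq_mul, Real.norm_eq_abs, hc] at h2
    obtain ⟨h3, h4⟩ := abs_le.mp h2
    have h5 : x i = r * (r⁻¹ * x i) := by field_simp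
    constructor <;> rw [h5] <;> nlinarith
  have hfd : ∀ x, fderiv ℝ u x = r⁻¹ • fderiv ℝ φ (r⁻¹ • x) := fun x =>
    fderiv_comp_smul (f := φ) r⁻¹
  have e1 : ∫ x in Ω, (u x) ^ 2 = r ^ d * ∫ x, (φ x) ^ 2 := by
    rw [setIntegral_eq_integral_of_forall_compl_eq_zero]
    · have := Measure.integral_comp_inv_smul_of_nonneg
        (volume : Measure (EuclideanSpace ℝ (Fin d))) (fun x => φ x ^ 2) hr.le
      simpa using this
    · intro x hx
      have : u x = 0 := image_eq_zero_of_notMem_tsupport fun h => hx (hus h)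
      simp [this]
  have e2 : ∫ x in Ω, ‖fderiv ℝ u x‖ ^ 2 = r ^ d * (r⁻¹ ^ 2 * ∫ x, ‖fderiv ℝ φ x‖ ^ 2) := by
    rw [setIntegral_eq_integral_of_forall_compl_eq_zero]
    · have := Measure.integral_comp_inv_smul_of_nonneg
        (volume : Measure (EuclideanSpace ℝ (Fin d))) (fun x => r⁻¹ ^ 2 * ‖fderiv ℝ φ x‖ ^ 2) hr.le
      simp only [integral_const_mul] at this
      simp only [hfd, norm_smul, mul_pow, Real.norm_eq_abs, sq_abs, integral_const_mul]
      simpa using this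
    · intro x hx
      have : fderiv ℝ u x = 0 := by
        by_contra h
        exact hx (hus (support_fderiv_subset ℝ h))
      simp [this]
  refine csInf_le ⟨0, ?_⟩ ⟨u, hu, huc, hus, ?_, ?_⟩
  · rintro t ⟨v, -, -, -, hv, rfl⟩
    exact div_nonneg (integral_nonneg fun _ => sq_nonneg _) hv.le
  · rw [e1]; positivity
  · rw [e1, e2]; field_simp

theorem aux_box {d : ℕ} (A : Fin d → Set ℝ) (hA : ∀ i, IsOpen (A i)) :
    IsOpen {x : EuclideanSpace ℝ (Fin d) | ∀ i, x i ∈ A i} ∧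
    volume {x : EuclideanSpace ℝ (Fin d) | ∀ i, x i ∈ A i} = ∏ i, volume (A i) := by
  have h : {x : EuclideanSpace ℝ (Fin d) | ∀ i, x i ∈ A i} =
      WithLp.ofLp ⁻¹' (Set.univ.pi A) := by ext x; simp
  have ho : IsOpen (Set.univ.pi A) := isOpen_set_pi Set.finite_univ fun i _ => hA i
  rw [h]
  refine ⟨ho.preimage (PiLp.continuous_ofLp 2 _), ?_⟩
  rw [(PiLp.volume_preserving_ofLp (Fin d)).measure_preimage
    ho.measurableSet.nullMeasurableSet, volume_pi_pi]

theorem dirichlet_inf_zero_of_supercritical (d : ℕ) (hd : 1 ≤ d) (q : ℝ)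
    (hq : 2 / ((d : ℝ) + 2) < q) :
    ∀ ε : ℝ, 0 < ε → ∃ Ω : Set (EuclideanSpace ℝ (Fin d)),
      Ω.Nonempty ∧ IsOpen Ω ∧ Bornology.IsBounded Ω ∧ volume Ω = 1 ∧
      dirichletEigenvalue d Ω * dirichletTorsion d Ω ^ q < ε := by
  intro ε hε
  obtain ⟨C, hC, hlam⟩ := aux_eig d
  have hq0 : 0 < q := lt_trans (by positivity) hq
  have hp : 0 < ((d:ℝ) + 2) * q - 2 := by
    rw [div_lt_iff₀ (by positivity)] at hq
    linarith
  set p := ((d:ℝ) + 2) * q - 2 with hpdef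
  -- choose r
  obtain ⟨r, hr0, hr1, hrε⟩ : ∃ r : ℝ, 0 < r ∧ r < 1 ∧ C * 2 ^ q * r ^ p < ε := by
    have ht : Tendsto (fun r : ℝ => C * 2 ^ q * r ^ p) (𝓝[>] 0) (𝓝 0) := by
      have h := ((Real.continuousAt_rpow_const 0 p (Or.inr hp.le)).tendsto.const_mul
        (C * 2 ^ q)).mono_left (nhdsWithin_le_nhds (s := Ioi 0))
      simpa [Real.zero_rpow hp.ne'] using h
    have h1 := ht.eventually (gt_mem_nhds hε)
    have h2 : ∀ᶠ r : ℝ in 𝓝[>] 0, r ∈ Ioo (0:ℝ) 1 := Ioo_mem_nhdsGT one_pos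
    obtain ⟨r, hr, hr'⟩ := (h1.and h2).exists
    exact ⟨r, hr'.1, hr'.2, hr⟩
  set η : ℝ := r ^ (d + 2) with hη
  have hη0 : 0 < η := by positivity
  have hη1 : η ≤ 1 := pow_le_one₀ hr0.le hr1.le
  have hrd1 : r ^ d < 1 := pow_lt_one₀ hr0.le hr1 (by omega)
  have hrd0 : 0 < r ^ d := by positivity
  set i0 : Fin d := ⟨0, hd⟩ with hi0
  let Z : Set ℝ := {t | t / η ∈ Set.range ((↑) : ℤ → ℝ)}
  have hZ : IsClosed Z :=
    Int.isClosedEmbedding_coe_real.isClosed_range.preimage (continuous_id.div_const η)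
  have hZc : Z.Countable := by
    refine (Set.countable_range (fun n : ℤ => (n:ℝ) * η)).mono ?_
    rintro t ⟨n, hn⟩
    refine ⟨n, ?_⟩
    simp only [hn]
    field_simp
  let S : Set ℝ := Ioo (-(1 - r ^ d)) 0 \ Z
  have hS : IsOpen S := isOpen_Ioo.sdiff hZ
  have hSv : volume S = ENNReal.ofReal (1 - r ^ d) := by
    rw [measure_sdiff_null (hZc.measure_zero _), Real.volume_Ioo]
    congr 1; ring
  let A : Fin d → Set ℝ := fun i => if i = i0 then S else Ioo 0 1
  have hA : ∀ i, IsOpen (A i) := by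
    intro i
    by_cases h : i = i0
    · simpa [A, h] using hS
    · simpa [A, h] using isOpen_Ioo
  set Ω1 : Set (EuclideanSpace ℝ (Fin d)) := {x | ∀ i, x i ∈ Ioo 0 r} with hΩ1
  set Ω2 : Set (EuclideanSpace ℝ (Fin d)) := {x | ∀ i, x i ∈ A i} with hΩ2
  obtain ⟨o1, v1⟩ := aux_box (d := d) (fun _ => Ioo 0 r) (fun _ => isOpen_Ioo)
  obtain ⟨o2, v2⟩ := aux_box A hA
  rw [← hΩ1] at o1 v1
  rw [← hΩ2] at o2 v2
  replace v1 : volume Ω1 = ENNReal.ofReal (r ^ d) := by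
    rw [v1]
    simp [Real.volume_Ioo, ENNReal.ofReal_pow hr0.le]
  replace v2 : volume Ω2 = ENNReal.ofReal (1 - r ^ d) := by
    rw [v2, Finset.prod_eq_single i0]
    · simpa [A] using hSv
    · intro i _ hi
      simp [A, hi]
    · simp
  have p1 : ∀ x ∈ Ω1, 0 < x i0 := fun x hx => (hx i0).1
  have p2 : ∀ x ∈ Ω2, x i0 ∈ S := fun x hx => by simpa [A] using hx i0
  have p2' : ∀ x ∈ Ω2, x i0 < 0 := fun x hx => (p2 x hx).1.2
  have hdis : Disjoint Ω1 Ω2 := Set.disjoint_left.mpr fun x h1 h2 =>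
    lt_asymm (p1 x h1) (p2' x h2)
  have hci : Continuous (fun y : EuclideanSpace ℝ (Fin d) => y i0) :=
    (EuclideanSpace.proj i0 : EuclideanSpace ℝ (Fin d) →L[ℝ] ℝ).continuous
  let w : EuclideanSpace ℝ (Fin d) → ℝ := fun x =>
    if 0 < x i0 then x i0 else η * Int.fract (x i0 / η)
  let B : EuclideanSpace ℝ (Fin d) → ℝ := fun x => if 0 < x i0 then r ^ 2 else η ^ 2
  have hw : ∀ x ∈ Ω1 ∪ Ω2, ∃ c : ℝ, w =ᶠ[𝓝 x] fun y => y i0 - c := by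
    rintro x (hx | hx)
    · refine ⟨0, ?_⟩
      filter_upwards [hci.continuousAt.eventually (lt_mem_nhds (p1 x hx))] with y hy
      simp [w, hy]
    · refine ⟨η * ⌊x i0 / η⌋, ?_⟩
      have hne : (⌊x i0 / η⌋ : ℝ) ≠ x i0 / η := fun h => (p2 x hx).2 ⟨_, h⟩
      have hlt : (⌊x i0 / η⌋ : ℝ) < x i0 / η := lt_of_le_of_ne (Int.floor_le _) hne
      have hlt2 : x i0 / η < ⌊x i0 / η⌋ + 1 := Int.lt_floor_add_one _
      have hcd : Continuous (fun y : EuclideanSpace ℝ (Fin d) => y i0 / η) := hci.div_const η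
      filter_upwards [hci.continuousAt.eventually (gt_mem_nhds (p2' x hx)),
        hcd.continuousAt.eventually (lt_mem_nhds hlt),
        hcd.continuousAt.eventually (gt_mem_nhds hlt2)] with y h1 h2 h3
      have hf : ⌊y i0 / η⌋ = ⌊x i0 / η⌋ := Int.floor_eq_iff.mpr ⟨h2.le, h3⟩
      have h4 : ¬ 0 < y i0 := not_lt.mpr h1.le
      simp only [w, h4, if_false, Int.fract, hf]
      field_simp
  have hwB : ∀ x ∈ Ω1 ∪ Ω2, w x ^ 2 ≤ B x := by
    rintro x (hx | hx)
    · have h := p1 x hx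
      simp only [w, B, h, if_true]
      exact pow_le_pow_left₀ h.le (hx i0).2.le 2
    · have h : ¬ 0 < x i0 := not_lt.mpr (p2' x hx).le
      simp only [w, B, h, if_false]
      refine pow_le_pow_left₀ (mul_nonneg hη0.le (Int.fract_nonneg _)) ?_ 2
      nlinarith [Int.fract_lt_one (x i0 / η)]
  have c1 : EqOn B (fun _ => r ^ 2) Ω1 := fun x hx => by simp [B, p1 x hx]
  have c2 : EqOn B (fun _ => η ^ 2) Ω2 := fun x hx => by
    have h : ¬ 0 < x i0 := not_lt.mpr (p2' x hx).le
    simp only [B, h, if_false]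
  have i1 : IntegrableOn B Ω1 :=
    (integrableOn_congr_fun c1 o1.measurableSet).mpr
      (integrableOn_const (by rw [v1]; exact ENNReal.ofReal_ne_top))
  have i2 : IntegrableOn B Ω2 :=
    (integrableOn_congr_fun c2 o2.measurableSet).mpr
      (integrableOn_const (by rw [v2]; exact ENNReal.ofReal_ne_top))
  have hint : ∫ x in Ω1 ∪ Ω2, B x ≤ 2 * r ^ (d + 2) := by
    rw [setIntegral_union hdis o2.measurableSet i1 i2, setIntegral_congr_fun o1.measurableSet c1,
      setIntegral_congr_fun o2.measurableSet c2, setIntegral_const, setIntegral_const,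
      measureReal_def, measureReal_def, v1, v2, ENNReal.toReal_ofReal hrd0.le,
      ENNReal.toReal_ofReal (by linarith), smul_eq_mul, smul_eq_mul, ← pow_add]
    have : (1 - r ^ d) * η ^ 2 ≤ η := by
      have : η ^ 2 ≤ η := by nlinarith
      nlinarith [sq_nonneg η]
    linarith
  have hT := (aux_torsion i0 (Ω1 ∪ Ω2) (o1.union o2) w B hw (i1.union i2) hwB).trans hint
  have hL := hlam r hr0 (Ω1 ∪ Ω2) subset_union_left
  have hvol : volume (Ω1 ∪ Ω2) = 1 := by
    rw [measure_union hdis o2.measurableSet, v1, v2, ← ENNReal.ofReal_add hrd0.le (by linarith)]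
    simp
  refine ⟨Ω1 ∪ Ω2, ?_, o1.union o2, ?_, hvol, ?_⟩
  · rw [nonempty_iff_ne_empty]
    intro h
    rw [h] at hvol
    simp at hvol
  · have hb : Bornology.IsBounded (Set.univ.pi fun _ : Fin d => Icc (-1 : ℝ) 1) :=
      Bornology.IsBounded.pi fun _ => isBounded_Icc _ _
    have hk : IsCompact (Set.univ.pi fun _ : Fin d => Icc (-1 : ℝ) 1) :=
      isCompact_univ_pi fun _ => isCompact_Icc
    refine (hk.image (PiLp.continuous_toLp 2 _)).isBounded.subset ?_
    rintro x hx
    refine ⟨x.ofLp, ?_, rfl⟩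
    intro i _
    rcases hx with hx | hx
    · have := hx i
      exact ⟨by linarith [this.1], by linarith [this.2]⟩
    · have := hx i
      by_cases h : i = i0
      · have h' := (p2 x hx).1
        rw [h]
        exact ⟨by linarith [h'.1], by linarith [h'.2]⟩
      · simp only [A, h, if_false] at this
        exact ⟨by linarith [this.1], by linarith [this.2]⟩
  · have hT0 : 0 ≤ dirichletTorsion d (Ω1 ∪ Ω2) := by
      refine Real.sSup_nonneg ?_
      rintro t ⟨u, -, -, -, h, rfl⟩
      positivity
    have hq1 : dirichletTorsion d (Ω1 ∪ Ω2) ^ q ≤ (2 * r ^ (d + 2)) ^ q :=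
      Real.rpow_le_rpow hT0 hT hq0.le
    calc _ ≤ C / r ^ 2 * (2 * r ^ (d + 2)) ^ q :=
          mul_le_mul hL hq1 (Real.rpow_nonneg hT0 _) (by positivity)
      _ = C * 2 ^ q * r ^ p := by
          rw [Real.mul_rpow (by norm_num) (by positivity), ← Real.rpow_natCast r (d + 2),
            ← Real.rpow_mul hr0.le, hpdef, Real.rpow_sub hr0]
          push_cast
          rw [Real.rpow_two]
          ring
      _ < ε := hrε
end

section
/- Let 0 < q ≤ 2/(d+2) be a real number. Then there exists a constant c > 0, depending only on d and q, such that for every nonempty bounded open set Ω ⊆ ℝ^d with Lebesgue measure |Ω| = 1 one has λ∞(Ω) · T∞(Ω)^q ≥ c. -/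
open MeasureTheory Metric Set

open scoped FourierTransform LineDeriv SchwartzMap in
theorem nash_aux (d : ℕ) (u : EuclideanSpace ℝ (Fin d) → ℝ) (hu : ContDiff ℝ (⊤ : ℕ∞) u)
    (hc : HasCompactSupport u) (R : ℝ) (hR : 0 < R) :
    ∫ x, (u x) ^ 2 ≤ (volume (ball (0 : EuclideanSpace ℝ (Fin d)) 1)).toReal * R ^ d *
      (∫ x, |u x|) ^ 2 + (∫ x, ‖fderiv ℝ u x‖ ^ 2) / R ^ 2 := by
  have hcc : HasCompactSupport (fun x => (u x : ℂ)) :=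
    hc.comp_left (g := fun r : ℝ => (r : ℂ)) (by simp)
  have hsm : ContDiff ℝ (⊤ : ℕ∞) (fun x => (u x : ℂ)) := Complex.ofRealCLM.contDiff.comp hu
  set f : 𝓢(EuclideanSpace ℝ (Fin d), ℂ) := hcc.toSchwartzMap hsm with hf
  have hfx : ∀ x, f x = (u x : ℂ) := fun x => rfl
  let b := EuclideanSpace.basisFun (Fin d) ℝ
  have hsq : ∀ g : 𝓢(EuclideanSpace ℝ (Fin d), ℂ), Integrable (fun x => ‖g x‖ ^ 2) := by
    intro g
    exact (memLp_two_iff_integrable_sq_norm g.continuous.aestronglyMeasurable).1 (g.memLp 2)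
  have h1 : ∫ x, (u x) ^ 2 = ∫ ξ, ‖𝓕 f ξ‖ ^ 2 := by
    rw [SchwartzMap.integral_norm_sq_fourier]
    simp [hfx]
  have hder : ∀ i x, ‖(∂_{b i} f) x‖ = |fderiv ℝ u x (b i)| := by
    intro i x
    rw [SchwartzMap.lineDerivOp_apply_eq_fderiv]
    have : HasFDerivAt (f : _ → ℂ) (Complex.ofRealCLM.comp (fderiv ℝ u x)) x :=
      Complex.ofRealCLM.hasFDerivAt.comp x ((hu.differentiable (by simp)) x).hasFDerivAt
    rw [this.fderiv]
    simp
  have h2 : ∫ x, ‖fderiv ℝ u x‖ ^ 2 = ∑ i, ∫ ξ, ‖𝓕 (∂_{b i} f) ξ‖ ^ 2 := by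
    simp_rw [SchwartzMap.integral_norm_sq_fourier]
    rw [← integral_finsetSum _ (fun i _ => hsq _)]
    congr 1; ext x
    simp_rw [hder]
    obtain ⟨y, hy⟩ := (InnerProductSpace.toDual ℝ (EuclideanSpace ℝ (Fin d))).surjective
      (fderiv ℝ u x)
    rw [← hy, LinearIsometryEquiv.norm_map, ← b.sum_sq_norm_inner_left y]
    simp [InnerProductSpace.toDual_apply_apply]
  have h3 : ∀ ξ, ∑ i, ‖𝓕 (∂_{b i} f) ξ‖ ^ 2 = (2 * Real.pi) ^ 2 * (‖ξ‖ ^ 2 * ‖𝓕 f ξ‖ ^ 2) := by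
    intro ξ
    rw [← b.sum_sq_norm_inner_left ξ, Finset.sum_mul, Finset.mul_sum]
    refine Finset.sum_congr rfl fun i _ => ?_
    have ht : (inner ℝ · (b i) : EuclideanSpace ℝ (Fin d) → ℝ).HasTemperateGrowth := by fun_prop
    rw [SchwartzMap.fourier_lineDerivOp_eq, smul_apply,
      SchwartzMap.smulLeftCLM_apply_apply ht]
    simp only [norm_smul, norm_mul, Complex.norm_I, Complex.norm_real, Complex.norm_ofNat,
      Real.norm_eq_abs, mul_pow, sq_abs]
    ring
  have h4 : ∀ ξ, ‖𝓕 f ξ‖ ≤ ∫ x, |u x| := by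
    intro ξ
    have := SchwartzMap.norm_fourier_apply_le_toLp_one f ξ
    rw [SchwartzMap.norm_toLp_one] at this
    simpa [hfx] using this
  have hvol : volume (ball (0 : EuclideanSpace ℝ (Fin d)) R) ≠ ⊤ := measure_ball_lt_top.ne
  have hind : Integrable ((ball (0 : EuclideanSpace ℝ (Fin d)) R).indicator
      (fun _ => (∫ x, |u x|) ^ 2)) :=
    (integrable_indicator_iff measurableSet_ball).2 (integrableOn_const hvol)
  have hsumI : Integrable (fun ξ => (∑ i, ‖𝓕 (∂_{b i} f) ξ‖ ^ 2) / R ^ 2) :=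
    (integrable_finsetSum _ (fun i _ => hsq _)).div_const _
  have h5 : ∫ ξ, ‖𝓕 f ξ‖ ^ 2 ≤ ∫ ξ, ((ball (0 : EuclideanSpace ℝ (Fin d)) R).indicator
      (fun _ => (∫ x, |u x|) ^ 2) ξ + (∑ i, ‖𝓕 (∂_{b i} f) ξ‖ ^ 2) / R ^ 2) := by
    refine integral_mono (hsq _) (hind.add hsumI) fun ξ => ?_
    by_cases hξ : ξ ∈ ball (0 : EuclideanSpace ℝ (Fin d)) R
    · simp only [indicator_of_mem hξ]
      have := pow_le_pow_left₀ (norm_nonneg _) (h4 ξ) 2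
      have h0 : 0 ≤ (∑ i, ‖𝓕 (∂_{b i} f) ξ‖ ^ 2) / R ^ 2 := by positivity
      linarith
    · simp only [indicator_of_notMem hξ, h3, zero_add]
      rw [le_div_iff₀ (by positivity)]
      have hR' : R ≤ ‖ξ‖ := by simpa using hξ
      have e1 : R ^ 2 ≤ ‖ξ‖ ^ 2 := pow_le_pow_left₀ hR.le hR' 2
      have e2 : (1 : ℝ) ≤ (2 * Real.pi) ^ 2 := by
        have := Real.pi_gt_three
        nlinarith
      have e3 : 0 ≤ ‖ξ‖ ^ 2 * ‖𝓕 f ξ‖ ^ 2 := by positivity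
      have e4 : 0 ≤ ‖𝓕 f ξ‖ ^ 2 := by positivity
      nlinarith
  rw [h1]
  refine h5.trans (le_of_eq ?_)
  rw [integral_add hind hsumI, integral_indicator_const _ measurableSet_ball, integral_div,
    integral_finsetSum _ (fun i _ => hsq _), ← h2]
  congr 1
  rw [Measure.real, Measure.addHaar_ball_of_pos _ _ hR, ENNReal.toReal_mul,
    ENNReal.toReal_ofReal (by positivity)]
  simp only [finrank_euclideanSpace, Fintype.card_fin, smul_eq_mul]
  ring

/-- admissible test functions -/
def TestFn (d : ℕ) (Ω : Set (EuclideanSpace ℝ (Fin d)))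
    (u : EuclideanSpace ℝ (Fin d) → ℝ) : Prop :=
  ContDiff ℝ (⊤ : ℕ∞) u ∧ HasCompactSupport u ∧ tsupport u ⊆ Ω

section aux
variable {d : ℕ} {Ω : Set (EuclideanSpace ℝ (Fin d))} {u : EuclideanSpace ℝ (Fin d) → ℝ}

theorem TestFn.zero_off (h : TestFn d Ω u) {x : EuclideanSpace ℝ (Fin d)} (hx : x ∉ Ω) :
    u x = 0 := image_eq_zero_of_notMem_tsupport fun hh => hx (h.2.2 hh)

theorem TestFn.fderiv_zero_off (h : TestFn d Ω u) {x : EuclideanSpace ℝ (Fin d)} (hx : x ∉ Ω) :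
    fderiv ℝ u x = 0 :=
  image_eq_zero_of_notMem_tsupport fun hh => hx (h.2.2 (tsupport_fderiv_subset ℝ hh))

theorem TestFn.int_sq (h : TestFn d Ω u) : ∫ x in Ω, (u x) ^ 2 = ∫ x, (u x) ^ 2 :=
  setIntegral_eq_integral_of_forall_compl_eq_zero fun x hx => by simp [h.zero_off hx]

theorem TestFn.int_abs (h : TestFn d Ω u) : ∫ x in Ω, |u x| = ∫ x, |u x| :=
  setIntegral_eq_integral_of_forall_compl_eq_zero fun x hx => by simp [h.zero_off hx]

theorem TestFn.int_fderiv (h : TestFn d Ω u) :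
    ∫ x in Ω, ‖fderiv ℝ u x‖ ^ 2 = ∫ x, ‖fderiv ℝ u x‖ ^ 2 :=
  setIntegral_eq_integral_of_forall_compl_eq_zero fun x hx => by simp [h.fderiv_zero_off hx]

theorem TestFn.nash (h : TestFn d Ω u) (R : ℝ) (hR : 0 < R) :
    ∫ x in Ω, (u x) ^ 2 ≤ (volume (ball (0 : EuclideanSpace ℝ (Fin d)) 1)).toReal * R ^ d *
      (∫ x in Ω, |u x|) ^ 2 + (∫ x in Ω, ‖fderiv ℝ u x‖ ^ 2) / R ^ 2 := by
  rw [h.int_sq, h.int_abs, h.int_fderiv]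
  exact nash_aux d u h.1 h.2.1 R hR

theorem TestFn.integrable (h : TestFn d Ω u) : Integrable u :=
  h.1.continuous.integrable_of_hasCompactSupport h.2.1

theorem TestFn.integrable_sq (h : TestFn d Ω u) : Integrable (fun x => (u x) ^ 2) := by
  have h1 : Continuous (fun x => (u x) ^ 2) := h.1.continuous.pow 2
  have h2 : HasCompactSupport (fun x => (u x) ^ 2) :=
    HasCompactSupport.comp_left (g := fun r : ℝ => r ^ 2) h.2.1 (by simp)
  exact h1.integrable_of_hasCompactSupport h2

theorem TestFn.integrable_fderiv (h : TestFn d Ω u) :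
    Integrable (fun x => ‖fderiv ℝ u x‖ ^ 2) := by
  have h0 : Continuous (fderiv ℝ u) := h.1.continuous_fderiv (by simp)
  have h1 : Continuous (fun x => ‖fderiv ℝ u x‖ ^ 2) := h0.norm.pow 2
  have h2 : HasCompactSupport (fun x => ‖fderiv ℝ u x‖ ^ 2) :=
    HasCompactSupport.comp_left
      (g := fun r : EuclideanSpace ℝ (Fin d) →L[ℝ] ℝ => ‖r‖ ^ 2) (h.2.1.fderiv ℝ) (by simp)
  exact h1.integrable_of_hasCompactSupport h2

theorem TestFn.cs (h : TestFn d Ω u) (hv : volume Ω = 1) :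
    (∫ x in Ω, |u x|) ^ 2 ≤ ∫ x in Ω, (u x) ^ 2 := by
  have hp : IsProbabilityMeasure (volume.restrict Ω) := ⟨by simp [hv]⟩
  set m := ∫ x in Ω, |u x| with hm
  have i1 : Integrable (fun x => |u x|) (volume.restrict Ω) := h.integrable.abs.restrict
  have i2 : Integrable (fun x => (u x) ^ 2) (volume.restrict Ω) := h.integrable_sq.restrict
  have h0 : 0 ≤ ∫ x in Ω, ((u x) ^ 2 - 2 * m * |u x| + m ^ 2) := by
    refine integral_nonneg fun x => ?_
    have : (u x) ^ 2 - 2 * m * |u x| + m ^ 2 = (|u x| - m) ^ 2 := by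
      rw [← sq_abs (u x)]; ring
    simp only [Pi.zero_apply]
    rw [this]; positivity
  have i3 : Integrable (fun x => (u x) ^ 2 - 2 * m * |u x|) (volume.restrict Ω) :=
    i2.sub (i1.const_mul _)
  rw [integral_add i3 (integrable_const _),
    integral_sub i2 (i1.const_mul _), integral_const_mul, ← hm] at h0
  simp at h0
  nlinarith

theorem ball_vol_pos (d : ℕ) : 0 < (volume (ball (0 : EuclideanSpace ℝ (Fin d)) 1)).toReal :=
  ENNReal.toReal_pos (measure_ball_pos _ _ one_pos).ne' measure_ball_lt_top.ne

/-- lower bound for the eigenvalue -/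
noncomputable def lam0 (d : ℕ) : ℝ :=
  (1 / (2 * (volume (ball (0 : EuclideanSpace ℝ (Fin d)) 1)).toReal + 1)) ^ 2 / 2

theorem lam0_pos (d : ℕ) : 0 < lam0 d := by
  have := ball_vol_pos d
  unfold lam0
  positivity

theorem TestFn.poincare (hd : 1 ≤ d) (h : TestFn d Ω u) (hv : volume Ω = 1) :
    lam0 d * ∫ x in Ω, (u x) ^ 2 ≤ ∫ x in Ω, ‖fderiv ℝ u x‖ ^ 2 := by
  have hV := ball_vol_pos d
  unfold lam0
  set V := (volume (ball (0 : EuclideanSpace ℝ (Fin d)) 1)).toReal with hVd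
  set R := 1 / (2 * V + 1) with hR
  have hRp : 0 < R := by positivity
  have hR1 : R ≤ 1 := by rw [hR, div_le_one (by positivity)]; linarith
  have hRd : R ^ d ≤ R := by simpa using pow_le_pow_of_le_one hRp.le hR1 hd
  have hVR : V * R ^ d ≤ 1 / 2 := by
    have : V * R ≤ 1 / 2 := by
      rw [hR, mul_one_div, div_le_div_iff₀ (by positivity) (by positivity)]; linarith
    nlinarith
  have hn := h.nash R hRp
  rw [← hVd] at hn
  have hcs := h.cs hv
  have h0 : 0 ≤ (∫ x in Ω, |u x|) ^ 2 := by positivity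
  have : ∫ x in Ω, (u x) ^ 2 ≤ 1 / 2 * (∫ x in Ω, (u x) ^ 2) +
      (∫ x in Ω, ‖fderiv ℝ u x‖ ^ 2) / R ^ 2 := by
    have := mul_le_mul hVR hcs h0 (by norm_num)
    linarith
  have h2 : (∫ x in Ω, (u x) ^ 2) / 2 ≤ (∫ x in Ω, ‖fderiv ℝ u x‖ ^ 2) / R ^ 2 := by linarith
  rw [le_div_iff₀ (by positivity)] at h2
  linarith

/-- smooth approximation of the absolute value -/
theorem TestFn.approx (h : TestFn d Ω u) (hv : volume Ω = 1) {ε : ℝ} (hε : 0 < ε) :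
    ∃ v, TestFn d Ω v ∧ (∫ x in Ω, |u x|) - ε ≤ ∫ x in Ω, v x ∧
      ∫ x in Ω, ‖fderiv ℝ v x‖ ^ 2 ≤ ∫ x in Ω, ‖fderiv ℝ u x‖ ^ 2 := by
  have hp : IsProbabilityMeasure (volume.restrict Ω) := ⟨by simp [hv]⟩
  have hpos : ∀ x, 0 < (u x) ^ 2 + ε ^ 2 := fun x => by positivity
  set v : EuclideanSpace ℝ (Fin d) → ℝ := fun x => √((u x) ^ 2 + ε ^ 2) - ε with hvd
  have hsupp : tsupport v ⊆ tsupport u := by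
    refine closure_mono fun x hx => ?_
    rw [Function.mem_support] at hx ⊢
    intro h0
    apply hx
    simp [hvd, h0, Real.sqrt_sq hε.le]
  have hT : TestFn d Ω v := by
    refine ⟨?_, ?_, hsupp.trans h.2.2⟩
    · exact (((h.1.pow 2).add contDiff_const).sqrt (fun x => (hpos x).ne')).sub contDiff_const
    · exact h.2.1.mono' ((subset_tsupport v).trans hsupp)
  refine ⟨v, hT, ?_, ?_⟩
  · have : ∫ x in Ω, (|u x| - ε) ≤ ∫ x in Ω, v x := by
      refine integral_mono (h.integrable.abs.restrict.sub (integrable_const _))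
        hT.integrable.restrict fun x => ?_
      have : |u x| ≤ √((u x) ^ 2 + ε ^ 2) := Real.abs_le_sqrt (by nlinarith)
      simp only [hvd]
      linarith
    rw [integral_sub h.integrable.abs.restrict (integrable_const _)] at this
    simpa using this
  · refine integral_mono hT.integrable_fderiv.restrict h.integrable_fderiv.restrict fun x => ?_
    have hu := ((h.1.differentiable (by simp)) x).hasFDerivAt
    have hd1 : HasFDerivAt v _ x :=
      (((hu.pow 2).add_const (ε ^ 2)).sqrt (hpos x).ne').sub_const ε
    simp only
    rw [hd1.fderiv]
    refine pow_le_pow_left₀ (norm_nonneg _) ?_ 2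
    rw [norm_smul, norm_smul]
    have hs : 0 < √((u x) ^ 2 + ε ^ 2) := Real.sqrt_pos.2 (hpos x)
    have hle : |u x| ≤ √((u x) ^ 2 + ε ^ 2) := Real.abs_le_sqrt (by nlinarith)
    rw [← mul_assoc]
    refine mul_le_of_le_one_left (norm_nonneg _) ?_
    simp only [norm_div, norm_mul, Real.norm_eq_abs, abs_one, abs_of_pos hs]
    simp
    field_simp
    exact hle

theorem torsion_bdd (hd : 1 ≤ d) (hv : volume Ω = 1) : BddAbove
    { t : ℝ | ∃ u : EuclideanSpace ℝ (Fin d) → ℝ, ContDiff ℝ (⊤ : ℕ∞) u ∧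
    HasCompactSupport u ∧ tsupport u ⊆ Ω ∧
    (0 < ∫ x in Ω, ‖fderiv ℝ u x‖ ^ 2) ∧
    t = (∫ x in Ω, u x) ^ 2 / ∫ x in Ω, ‖fderiv ℝ u x‖ ^ 2 } := by
  refine ⟨1 / lam0 d, ?_⟩
  rintro t ⟨u, h1, h2, h3, h4, rfl⟩
  have h : TestFn d Ω u := ⟨h1, h2, h3⟩
  have hl := lam0_pos d
  rw [div_le_div_iff₀ h4 hl, one_mul]
  have hp := h.poincare hd hv
  have hc := h.cs hv
  have : (∫ x in Ω, u x) ^ 2 ≤ (∫ x in Ω, |u x|) ^ 2 := by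
    rw [← sq_abs]
    exact pow_le_pow_left₀ (abs_nonneg _) (abs_integral_le_integral_abs) 2
  nlinarith

theorem TestFn.torsion_ge (hd : 1 ≤ d) (h : TestFn d Ω u) (hv : volume Ω = 1)
    (hu : 0 < ∫ x in Ω, |u x|) :
    (∫ x in Ω, |u x|) ^ 2 ≤ dirichletTorsion d Ω * ∫ x in Ω, ‖fderiv ℝ u x‖ ^ 2 := by
  have key : ∀ ε, 0 < ε → ε < ∫ x in Ω, |u x| → (∫ x in Ω, |u x|) - ε ≤
      √(dirichletTorsion d Ω * ∫ x in Ω, ‖fderiv ℝ u x‖ ^ 2) := by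
    intro ε hε hε2
    obtain ⟨v, hT, hv1, hv2⟩ := h.approx hv hε
    apply Real.le_sqrt_of_sq_le
    have hvpos : 0 < ∫ x in Ω, v x := by linarith
    have hp := hT.poincare hd hv
    have hc := hT.cs hv
    have hab : ∫ x in Ω, v x ≤ ∫ x in Ω, |v x| :=
      (le_abs_self _).trans abs_integral_le_integral_abs
    have hDv : 0 < ∫ x in Ω, ‖fderiv ℝ v x‖ ^ 2 := by
      have : 0 < (∫ x in Ω, |v x|) ^ 2 := by
        have : 0 < ∫ x in Ω, |v x| := by linarith
        positivity
      have := mul_pos (lam0_pos d) (this.trans_le hc)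
      linarith
    have hle : (∫ x in Ω, v x) ^ 2 / ∫ x in Ω, ‖fderiv ℝ v x‖ ^ 2 ≤ dirichletTorsion d Ω :=
      le_csSup (torsion_bdd hd hv) ⟨v, hT.1, hT.2.1, hT.2.2, hDv, rfl⟩
    have hT0 : 0 ≤ dirichletTorsion d Ω := le_trans (by positivity) hle
    rw [div_le_iff₀ hDv] at hle
    have h1 : ((∫ x in Ω, |u x|) - ε) ^ 2 ≤ (∫ x in Ω, v x) ^ 2 :=
      pow_le_pow_left₀ (by linarith) hv1 2
    exact h1.trans (hle.trans (mul_le_mul_of_nonneg_left hv2 hT0))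
  have h2 : ∫ x in Ω, |u x| ≤ √(dirichletTorsion d Ω * ∫ x in Ω, ‖fderiv ℝ u x‖ ^ 2) := by
    by_contra hcon
    push Not at hcon
    set s := √(dirichletTorsion d Ω * ∫ x in Ω, ‖fderiv ℝ u x‖ ^ 2) with hs
    have hs0 : 0 ≤ s := Real.sqrt_nonneg _
    have := key (((∫ x in Ω, |u x|) - s) / 2) (by linarith) (by linarith)
    linarith
  have := Real.sqrt_pos.1 (hu.trans_le h2)
  rw [← Real.sq_sqrt this.le]
  exact pow_le_pow_left₀ hu.le h2 2

theorem TestFn.main (hd : 1 ≤ d) (h : TestFn d Ω u) (hv : volume Ω = 1)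
    (hu : 0 < ∫ x in Ω, (u x) ^ 2) {t : ℝ}
    (ht : t = (∫ x in Ω, ‖fderiv ℝ u x‖ ^ 2) / ∫ x in Ω, (u x) ^ 2) :
    lam0 d ≤ t ∧ 1 ≤ dirichletTorsion d Ω * (t * (√(2 * t)) ^ d *
      (2 * (volume (ball (0 : EuclideanSpace ℝ (Fin d)) 1)).toReal)) := by
  have hl : lam0 d ≤ t := by
    rw [ht, le_div_iff₀ hu]; exact h.poincare hd hv
  refine ⟨hl, ?_⟩
  have htp : 0 < t := (lam0_pos d).trans_le hl
  have hV := ball_vol_pos d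
  have hD : ∫ x in Ω, ‖fderiv ℝ u x‖ ^ 2 = t * ∫ x in Ω, (u x) ^ 2 := by
    rw [ht]; field_simp
  have hR : 0 < √(2 * t) := Real.sqrt_pos.2 (by positivity)
  have hn := h.nash _ hR
  rw [Real.sq_sqrt (by positivity), hD] at hn
  have e : t * (∫ x in Ω, (u x) ^ 2) / (2 * t) = (∫ x in Ω, (u x) ^ 2) / 2 := by field_simp
  rw [e] at hn
  have hL : 0 < ∫ x in Ω, |u x| := by
    refine lt_of_le_of_ne (integral_nonneg fun x => abs_nonneg _) fun h0 => ?_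
    rw [← h0] at hn
    simp at hn
    linarith
  have hg := h.torsion_ge hd hv hL
  rw [hD] at hg
  set V := (volume (ball (0 : EuclideanSpace ℝ (Fin d)) 1)).toReal
  set I := ∫ x in Ω, (u x) ^ 2
  have hpos : 0 ≤ V * √(2 * t) ^ d := by positivity
  have h3 := mul_le_mul_of_nonneg_left hg hpos
  have : I * 1 ≤ I * (dirichletTorsion d Ω * (t * √(2 * t) ^ d * (2 * V))) := by nlinarith
  exact le_of_mul_le_mul_left this hu

end aux

theorem dirichlet_inf_positive_of_subcritical (d : ℕ) (hd : 1 ≤ d) (q : ℝ)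
    (hq0 : 0 < q) (hq : q ≤ 2 / ((d : ℝ) + 2)) :
    ∃ c : ℝ, 0 < c ∧
      ∀ Ω : Set (EuclideanSpace ℝ (Fin d)),
        Ω.Nonempty → IsOpen Ω → Bornology.IsBounded Ω → volume Ω = 1 →
        c ≤ dirichletEigenvalue d Ω * dirichletTorsion d Ω ^ q := by
  have hV := ball_vol_pos d
  have hl0 := lam0_pos d
  set V := (volume (ball (0 : EuclideanSpace ℝ (Fin d)) 1)).toReal with hVd
  set K : ℝ := 2 ^ ((d : ℝ) / 2) * (2 * V) with hK
  have hKp : 0 < K := by positivity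
  set s : ℝ := 1 + (d : ℝ) / 2 with hs
  have hexp : 0 ≤ 1 - s * q := by
    rw [le_div_iff₀ (by positivity)] at hq
    rw [hs]; linarith
  refine ⟨(K ^ q)⁻¹ * lam0 d ^ (1 - s * q), by positivity, ?_⟩
  intro Ω hne hop _ hv
  -- pointwise estimate
  have key : ∀ u : EuclideanSpace ℝ (Fin d) → ℝ, TestFn d Ω u →
      0 < ∫ x in Ω, (u x) ^ 2 → 0 < dirichletTorsion d Ω ∧ 
      (K ^ q)⁻¹ * lam0 d ^ (1 - s * q) ≤
        ((∫ x in Ω, ‖fderiv ℝ u x‖ ^ 2) / ∫ x in Ω, (u x) ^ 2) * dirichletTorsion d Ω ^ q := by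
    intro u h hu
    obtain ⟨hl, h1⟩ := h.main hd hv hu rfl
    set t := (∫ x in Ω, ‖fderiv ℝ u x‖ ^ 2) / ∫ x in Ω, (u x) ^ 2 with ht
    have htp : 0 < t := hl0.trans_le hl
    rw [← hVd] at h1
    have e : t * √(2 * t) ^ d * (2 * V) = K * t ^ s := by
      rw [Real.sqrt_eq_rpow, ← Real.rpow_natCast, ← Real.rpow_mul (by positivity),
        Real.mul_rpow (by positivity) htp.le, hs, Real.rpow_add htp, Real.rpow_one, hK]
      rw [show (1 / 2 * (d : ℝ)) = d / 2 by ring]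
      ring
    rw [e] at h1
    have hKt : 0 < K * t ^ s := by positivity
    have hT : 0 < dirichletTorsion d Ω := by
      by_contra hcon
      push Not at hcon
      nlinarith
    refine ⟨hT, ?_⟩
    have h2 := Real.one_le_rpow h1 hq0.le
    rw [Real.mul_rpow hT.le hKt.le, Real.mul_rpow hKp.le (by positivity),
      ← Real.rpow_mul htp.le] at h2
    have h3 : lam0 d ^ (1 - s * q) ≤ t ^ (1 - s * q) := Real.rpow_le_rpow hl0.le hl hexp
    have h4 : t ^ (1 - s * q) * t ^ (s * q) = t := by
      rw [← Real.rpow_add htp]; simp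
    have hKq : 0 < K ^ q := by positivity
    have hp : 0 < t ^ (1 - s * q) := by positivity
    rw [inv_mul_le_iff₀ hKq]
    refine h3.trans ?_
    calc t ^ (1 - s * q) ≤ t ^ (1 - s * q) *
          (dirichletTorsion d Ω ^ q * (K ^ q * t ^ (s * q))) := le_mul_of_one_le_right hp.le h2
      _ = K ^ q * ((t ^ (1 - s * q) * t ^ (s * q)) * dirichletTorsion d Ω ^ q) := by ring
      _ = _ := by rw [h4]
  -- a test function exists
  obtain ⟨x0, hx0⟩ := hne
  obtain ⟨f, hf1, hf2, hf3, -, hf5⟩ :=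
    exists_contDiff_tsupport_subset (n := ⊤) (hop.mem_nhds hx0)
  have hf : TestFn d Ω f := ⟨hf3, hf2, hf1⟩
  have hfp : 0 < ∫ x in Ω, (f x) ^ 2 := by
    rw [hf.int_sq]
    refine (hf3.continuous.pow 2).integral_pos_of_hasCompactSupport_nonneg_nonzero ?_ 
      (fun x => sq_nonneg _) (x := x0) (by simp [hf5])
    exact hf2.comp_left (g := fun r : ℝ => r ^ 2) (by simp)
  have hTp := (key f hf hfp).1
  have hTq : 0 < dirichletTorsion d Ω ^ q := by positivity
  rw [← div_le_iff₀ hTq]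
  refine le_csInf ⟨_, f, hf3, hf2, hf1, hfp, rfl⟩ ?_
  rintro t ⟨u, h1, h2, h3, h4, rfl⟩
  rw [div_le_iff₀ hTq]
  exact (key u ⟨h1, h2, h3⟩ h4).2
end

section
/- Reverse Kohler–Jobin inequality: there exists a real number q̄ > 1 such that for every real q ≥ q̄, for every open Euclidean ball B ⊆ ℝ^d of Lebesgue measure 1, and for every nonempty bounded open set Ω ⊆ ℝ^d with Lebesgue measure |Ω| = 1, one has λ∞(Ω) · T∞(Ω)^q ≤ λ∞(B) · T∞(B)^q, i.e. the ball maximizes λ∞ T∞^q among sets of unit measure. -/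
open MeasureTheory Metric Set

namespace RKJ
open scoped ENNReal Pointwise

lemma vol_affine (r c : ℝ) (K : Set ℝ) :
    volume ((fun a => r * a + c) '' K) = ENNReal.ofReal |r| * volume K := by
  have h1 : (fun a => r * a + c) '' K = (fun a => a + c) '' (r • K) := by
    rw [← image_smul, image_image]; rfl
  rw [h1, image_add_right, measure_preimage_add_right, Measure.addHaar_smul]
  simp

lemma bm_compact {K L C : Set ℝ} (hK : IsCompact K) (hL : IsCompact L) (hKn : K.Nonempty)
    (hLn : L.Nonempty) {l : ℝ} (h0 : 0 < l) (h1 : l < 1)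
    (h : ∀ a ∈ K, ∀ b ∈ L, (1 - l) * a + l * b ∈ C) :
    ENNReal.ofReal (1 - l) * volume K + ENNReal.ofReal l * volume L ≤ volume C := by
  have hb := hL.sInf_mem hLn
  have ha := hK.sSup_mem hKn
  set b0 := sInf L
  set a1 := sSup K
  have e1 := vol_affine (1 - l) (l * b0) K
  have e2 := vol_affine l ((1 - l) * a1) L
  rw [abs_of_pos (by linarith)] at e1
  rw [abs_of_pos h0] at e2
  rw [← e1, ← e2, ← measure_union₀]
  · apply measure_mono
    rintro x (⟨a, ha', rfl⟩ | ⟨b, hb', rfl⟩)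
    · exact h a ha' b0 hb
    · have := h a1 ha b hb'
      simp only
      rwa [add_comm]
  · apply IsCompact.measurableSet ?_ |>.nullMeasurableSet
    exact hL.image (by fun_prop)
  · refine measure_mono_null (t := {(1 - l) * a1 + l * b0}) ?_ (by simp)
    rintro x ⟨⟨a, ha', rfl⟩, ⟨b, hb', hx⟩⟩
    have i1 : a ≤ a1 := le_csSup hK.bddAbove ha'
    have i2 : b0 ≤ b := csInf_le hL.bddBelow hb'
    simp only [mem_singleton_iff]
    simp only at hx
    have i3 : (1 - l) * a ≤ (1 - l) * a1 := by
      apply mul_le_mul_of_nonneg_left i1; linarith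
    have i4 := mul_le_mul_of_nonneg_left i2 h0.le
    linarith

lemma bm_one {A B C : Set ℝ} (hA : MeasurableSet A) (hB : MeasurableSet B) (hAn : A.Nonempty)
    (hBn : B.Nonempty) {l : ℝ} (h0 : 0 < l) (h1 : l < 1)
    (h : ∀ a ∈ A, ∀ b ∈ B, (1 - l) * a + l * b ∈ C) :
    ENNReal.ofReal (1 - l) * volume A + ENNReal.ofReal l * volume B ≤ volume C := by
  have key : ∀ K ⊆ A, IsCompact K → ∀ L ⊆ B, IsCompact L →
      ENNReal.ofReal (1 - l) * volume K + ENNReal.ofReal l * volume L ≤ volume C := by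
    intro K hKA hK L hLB hL
    obtain ⟨a, ha⟩ := hAn
    obtain ⟨b, hb⟩ := hBn
    have := bm_compact (K := insert a K) (L := insert b L) (C := C) (hK.insert a) (hL.insert b)
      (insert_nonempty _ _) (insert_nonempty _ _) h0 h1 (by
        intro x hx y hy
        apply h
        · exact insert_subset ha hKA hx
        · exact insert_subset hb hLB hy)
    refine le_trans ?_ this
    gcongr <;> apply subset_insert
  by_cases hC : volume C = ⊤
  · rw [hC]; exact le_top
  have hl : ENNReal.ofReal l ≠ 0 := by simpa using h0
  have hl' : ENNReal.ofReal (1 - l) ≠ 0 := by simpa using h1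
  have s1 : ∀ K ⊆ A, IsCompact K →
      ENNReal.ofReal (1 - l) * volume K + ENNReal.ofReal l * volume B ≤ volume C := by
    intro K hKA hK
    rw [hB.measure_eq_iSup_isCompact]
    simp only [ENNReal.mul_iSup]
    have hK0 : ENNReal.ofReal (1 - l) * volume K ≤ volume C := by
      refine le_trans ?_ (key K hKA hK ∅ (empty_subset _) isCompact_empty)
      simp
    rw [add_comm]
    refine (ENNReal.le_sub_iff_add_le_right ?_ hK0).mp ?_
    · exact ne_top_of_le_ne_top hC hK0
    · refine iSup_le fun L => iSup_le fun hL => iSup_le fun hL' => ?_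
      refine (ENNReal.le_sub_iff_add_le_right (ne_top_of_le_ne_top hC hK0) hK0).mpr ?_
      rw [add_comm]; exact key K hKA hK L hL hL'
  rw [hA.measure_eq_iSup_isCompact]
  simp only [ENNReal.mul_iSup]
  have hB0 : ENNReal.ofReal l * volume B ≤ volume C := by
    refine le_trans ?_ (s1 ∅ (empty_subset _) isCompact_empty)
    simp
  refine (ENNReal.le_sub_iff_add_le_right (ne_top_of_le_ne_top hC hB0) hB0).mp ?_
  refine iSup_le fun L => iSup_le fun hL => iSup_le fun hL' => ?_
  exact (ENNReal.le_sub_iff_add_le_right (ne_top_of_le_ne_top hC hB0) hB0).mpr (s1 L hL hL')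

lemma ennreal_amgm {l : ℝ} (h0 : 0 < l) (h1 : l < 1) (a b : ℝ≥0∞) :
    a ^ (1 - l) * b ^ l ≤ ENNReal.ofReal (1 - l) * a + ENNReal.ofReal l * b := by
  have h2 : 0 < 1 - l := by linarith
  by_cases ha : a = ⊤
  · subst ha
    rw [ENNReal.mul_top (by simpa using h2)]; simp
  by_cases hb : b = ⊤
  · subst hb
    rw [ENNReal.mul_top (by simpa using h0)]; simp
  lift a to NNReal using ha
  lift b to NNReal using hb
  have := NNReal.geom_mean_le_arith_mean2_weighted (Real.toNNReal (1 - l)) (Real.toNNReal l) a b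
    (by rw [← Real.toNNReal_add h2.le h0.le]; simp)
  rw [← ENNReal.coe_rpow_of_nonneg _ h2.le, ← ENNReal.coe_rpow_of_nonneg _ h0.le]
  rw [Real.coe_toNNReal _ h2.le, Real.coe_toNNReal _ h0.le] at this
  unfold ENNReal.ofReal
  exact_mod_cast this

/-- layer cake for functions bounded by 1 -/
lemma layer1 (f : ℝ → ℝ≥0∞) (hf : Measurable f) (hb : ∀ x, f x ≤ 1) :
    ∫⁻ x, f x = ∫⁻ t in Ioo (0:ℝ) 1, volume {a | ENNReal.ofReal t < f a} := by
  have h1 : ∀ x, f x = ENNReal.ofReal (f x).toReal := fun x =>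
    (ENNReal.ofReal_toReal (ne_top_of_le_ne_top (by simp) (hb x))).symm
  have h2 := lintegral_eq_lintegral_meas_lt (volume : Measure ℝ) (f := fun x => (f x).toReal)
    (Filter.Eventually.of_forall fun x => by positivity) (by fun_prop)
  rw [lintegral_congr h1, h2]
  have h3 : ∀ t ∈ Ioi (0:ℝ), {a | t < (f a).toReal} = {a | ENNReal.ofReal t < f a} := by
    intro t ht
    ext a
    simp only [mem_ofPred_eq]
    rw [ENNReal.ofReal_lt_iff_lt_toReal (le_of_lt ht) (ne_top_of_le_ne_top (by simp) (hb a))]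
  rw [setLIntegral_congr_fun (g := fun t => volume {a | ENNReal.ofReal t < f a}) measurableSet_Ioi (fun t ht => by simp only [h3 t ht])]
  have h4 : Ioi (0:ℝ) = Ioo 0 1 ∪ Ici 1 := by
    ext x; simp only [mem_Ioi, mem_union, mem_Ioo, mem_Ici]
    constructor
    · intro h; by_cases h' : x < 1
      · left; exact ⟨h, h'⟩
      · right; linarith
    · rintro (h | h)
      · exact h.1
      · linarith
  rw [h4, lintegral_union measurableSet_Ici]
  · have : ∫⁻ t in Ici (1:ℝ), volume {a | ENNReal.ofReal t < f a} = 0 := by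
      rw [setLIntegral_congr_fun (g := fun _ => 0) measurableSet_Ici]
      · simp
      · intro t ht
        have : {a | ENNReal.ofReal t < f a} = ∅ := by
          ext a; simp only [mem_ofPred_eq, mem_empty_iff_false, iff_false, not_lt]
          refine (hb a).trans ?_
          simpa using ht
        simp [this]
    rw [this, add_zero]
  · rw [Set.disjoint_left]
    intro x hx hx'
    exact absurd hx.2 (not_lt.mpr hx')

lemma pl_norm {f g h : ℝ → ℝ≥0∞} (hf : Measurable f) (hg : Measurable g) (hh : Measurable h)
    {l : ℝ} (h0 : 0 < l) (h1 : l < 1) (hf1 : ⨆ x, f x = 1) (hg1 : ⨆ x, g x = 1)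
    (H : ∀ x y, f x ^ (1 - l) * g y ^ l ≤ h ((1 - l) * x + l * y)) :
    (∫⁻ x, f x) ^ (1 - l) * (∫⁻ x, g x) ^ l ≤ ∫⁻ x, h x := by
  refine (ennreal_amgm h0 h1 _ _).trans ?_
  have fb : ∀ x, f x ≤ 1 := fun x => hf1 ▸ le_iSup f x
  have gb : ∀ x, g x ≤ 1 := fun x => hg1 ▸ le_iSup g x
  have hmin : ∫⁻ x, min (h x) 1 ≤ ∫⁻ x, h x := lintegral_mono fun x => min_le_left _ _
  refine le_trans ?_ hmin
  rw [layer1 f hf fb, layer1 g hg gb, layer1 (fun x => min (h x) 1) (by fun_prop)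
    (fun x => min_le_right _ _)]
  rw [← lintegral_const_mul', ← lintegral_const_mul', ← lintegral_add_left']
  rotate_left
  · refine AEMeasurable.const_mul ?_ _
    have : Antitone fun t : ℝ => volume {a | ENNReal.ofReal t < f a} := by
      intro s t hst
      apply measure_mono
      intro a ha
      exact lt_of_le_of_lt (ENNReal.ofReal_le_ofReal hst) ha
    exact this.measurable.aemeasurable
  · simp
  · simp
  refine setLIntegral_mono' measurableSet_Ioo ?_
  intro t ht
  have ht1 : ENNReal.ofReal t < 1 := by simpa using ht.2
  have fn : {a | ENNReal.ofReal t < f a}.Nonempty := by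
    obtain ⟨a, ha⟩ := lt_iSup_iff.mp (hf1 ▸ ht1)
    exact ⟨a, ha⟩
  have gn : {a | ENNReal.ofReal t < g a}.Nonempty := by
    obtain ⟨a, ha⟩ := lt_iSup_iff.mp (hg1 ▸ ht1)
    exact ⟨a, ha⟩
  refine bm_one (measurableSet_lt measurable_const hf) (measurableSet_lt measurable_const hg)
    fn gn h0 h1 ?_
  intro a ha b hb
  simp only [mem_ofPred_eq] at ha hb ⊢
  refine lt_min ?_ ht1
  refine lt_of_lt_of_le ?_ (H a b)
  calc ENNReal.ofReal t = (ENNReal.ofReal t) ^ (1 - l) * (ENNReal.ofReal t) ^ l := by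
        rw [← ENNReal.rpow_add_of_nonneg _ _ (by linarith) h0.le]; simp
    _ < _ := ENNReal.mul_lt_mul (ENNReal.rpow_lt_rpow ha (by linarith))
        (ENNReal.rpow_lt_rpow hb h0)

lemma pl_bdd {f g h : ℝ → ℝ≥0∞} (hf : Measurable f) (hg : Measurable g) (hh : Measurable h)
    {l : ℝ} (h0 : 0 < l) (h1 : l < 1) (hf1 : ⨆ x, f x ≠ ⊤) (hg1 : ⨆ x, g x ≠ ⊤)
    (H : ∀ x y, f x ^ (1 - l) * g y ^ l ≤ h ((1 - l) * x + l * y)) :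
    (∫⁻ x, f x) ^ (1 - l) * (∫⁻ x, g x) ^ l ≤ ∫⁻ x, h x := by
  have h2 : 0 < 1 - l := by linarith
  set M := ⨆ x, f x with hM
  set N := ⨆ x, g x with hN
  by_cases hM0 : M = 0
  · have : ∀ x, f x = 0 := by
      intro x; have := le_iSup f x; rw [← hM, hM0] at this; simpa using this
    simp [this, h2]
  by_cases hN0 : N = 0
  · have : ∀ x, g x = 0 := by
      intro x; have := le_iSup g x; rw [← hN, hN0] at this; simpa using this
    simp [this, h0]
  have key := pl_norm (f := fun x => M⁻¹ * f x) (g := fun x => N⁻¹ * g x)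
    (h := fun x => ((M⁻¹) ^ (1 - l) * (N⁻¹) ^ l) * h x) (by fun_prop) (by fun_prop) (by fun_prop) h0 h1
    (by rw [← ENNReal.mul_iSup, ← hM, ENNReal.inv_mul_cancel hM0 hf1])
    (by rw [← ENNReal.mul_iSup, ← hN, ENNReal.inv_mul_cancel hN0 hg1])
    (by
      intro x y
      rw [ENNReal.mul_rpow_of_nonneg _ _ h2.le, ENNReal.mul_rpow_of_nonneg _ _ h0.le]
      calc _ = ((M⁻¹) ^ (1 - l) * (N⁻¹) ^ l) * (f x ^ (1 - l) * g y ^ l) := by ring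
        _ ≤ _ := by gcongr; exact H x y)
  rw [lintegral_const_mul _ hf, lintegral_const_mul _ hg, lintegral_const_mul _ hh,
    ENNReal.mul_rpow_of_nonneg _ _ h2.le, ENNReal.mul_rpow_of_nonneg _ _ h0.le] at key
  have key2 : ((M⁻¹) ^ (1 - l) * (N⁻¹) ^ l) * ((∫⁻ x, f x) ^ (1 - l) * (∫⁻ x, g x) ^ l)
      ≤ ((M⁻¹) ^ (1 - l) * (N⁻¹) ^ l) * ∫⁻ x, h x := by
    refine le_trans (le_of_eq ?_) key; ring
  rwa [ENNReal.mul_le_mul_iff_right] at key2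
  · apply mul_ne_zero
    · simp [ENNReal.rpow_eq_zero_iff, hf1, hM0]
    · simp [ENNReal.rpow_eq_zero_iff, hg1, hN0]
  · apply ENNReal.mul_ne_top
    · exact ENNReal.rpow_ne_top_of_nonneg h2.le (by simp [hM0])
    · exact ENNReal.rpow_ne_top_of_nonneg h0.le (by simp [hN0])

lemma pl_one {f g h : ℝ → ℝ≥0∞} (hf : Measurable f) (hg : Measurable g) (hh : Measurable h)
    {l : ℝ} (h0 : 0 < l) (h1 : l < 1)
    (H : ∀ x y, f x ^ (1 - l) * g y ^ l ≤ h ((1 - l) * x + l * y)) :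
    (∫⁻ x, f x) ^ (1 - l) * (∫⁻ x, g x) ^ l ≤ ∫⁻ x, h x := by
  have h2 : 0 < 1 - l := by linarith
  have key : ∀ n : ℕ, (∫⁻ x, min (f x) n) ^ (1 - l) * (∫⁻ x, min (g x) n) ^ l ≤ ∫⁻ x, h x := by
    intro n
    refine pl_bdd (by fun_prop) (by fun_prop) hh h0 h1 ?_ ?_ ?_
    · refine ne_top_of_le_ne_top (ENNReal.natCast_ne_top n) (iSup_le fun x => min_le_right _ _)
    · refine ne_top_of_le_ne_top (ENNReal.natCast_ne_top n) (iSup_le fun x => min_le_right _ _)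
    · intro x y
      refine le_trans ?_ (H x y)
      gcongr <;> exact min_le_left _ _
  have lim : ∀ φ : ℝ → ℝ≥0∞, Measurable φ →
      ∫⁻ x, φ x = ⨆ n : ℕ, ∫⁻ x, min (φ x) n := by
    intro φ hφ
    rw [← lintegral_iSup]
    · apply lintegral_congr
      intro x
      rw [← inf_iSup_eq, ENNReal.iSup_natCast]; simp
    · intro n; fun_prop
    · intro m n hmn x
      simp only
      gcongr
  have mon : ∀ φ : ℝ → ℝ≥0∞, Monotone fun n : ℕ => ∫⁻ x, min (φ x) n := by
    intro φ m n hmn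
    apply lintegral_mono; intro x; simp only; gcongr
  have t1 := (ENNReal.continuous_rpow_const (y := 1 - l)).continuousAt.tendsto.comp
    (tendsto_atTop_iSup (mon f))
  have t2 := (ENNReal.continuous_rpow_const (y := l)).continuousAt.tendsto.comp
    (tendsto_atTop_iSup (mon g))
  rw [← lim f hf] at t1
  rw [← lim g hg] at t2
  by_cases hz : ∫⁻ x, f x = 0
  · simp [hz, h2]
  by_cases hz' : ∫⁻ x, g x = 0
  · simp [hz', h0]
  refine le_of_tendsto' (ENNReal.Tendsto.mul t1 ?_ t2 ?_) key
  · left; simp [ENNReal.rpow_eq_zero_iff, hz, h2, h1.le]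
  · left; simp [ENNReal.rpow_eq_zero_iff, hz', h0, h0.le]

theorem pl_fin (n : ℕ) {f g h : (Fin n → ℝ) → ℝ≥0∞} (hf : Measurable f) (hg : Measurable g)
    (hh : Measurable h) {l : ℝ} (h0 : 0 < l) (h1 : l < 1)
    (H : ∀ x y, f x ^ (1 - l) * g y ^ l ≤ h ((1 - l) • x + l • y)) :
    (∫⁻ x, f x) ^ (1 - l) * (∫⁻ x, g x) ^ l ≤ ∫⁻ x, h x := by
  induction n with
  | zero =>
    rw [volume_pi, Measure.pi_of_empty (fun _ : Fin 0 => (volume : Measure ℝ)) (0 : Fin 0 → ℝ)]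
    simp only [lintegral_dirac]
    convert H 0 0
  | succ n ih =>
    have tr : ∀ φ : (Fin (n + 1) → ℝ) → ℝ≥0∞, Measurable φ →
        ∫⁻ x, φ x = ∫⁻ s : ℝ, ∫⁻ y : Fin n → ℝ, φ (Fin.cons s y) := by
      intro φ hφ
      have mp := (volume_preserving_piFinSuccAbove (fun _ : Fin (n + 1) => ℝ) 0).symm
      rw [← mp.lintegral_comp hφ]
      rw [Measure.volume_eq_prod, lintegral_prod]
      · refine lintegral_congr fun s => lintegral_congr fun y => ?_
        congr 1
        simp [MeasurableEquiv.piFinSuccAbove, Fin.consEquiv]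
      · exact (hφ.comp (MeasurableEquiv.measurable _)).aemeasurable
    have mc : Measurable fun p : ℝ × (Fin n → ℝ) => (Fin.cons p.1 p.2 : Fin (n + 1) → ℝ) := by
      refine measurable_pi_iff.mpr fun i => ?_
      refine Fin.cases ?_ (fun j => ?_) i
      · simp only [Fin.cons_zero]; fun_prop
      · simp only [Fin.cons_succ]; fun_prop
    have mf : ∀ φ : (Fin (n + 1) → ℝ) → ℝ≥0∞, Measurable φ →
        Measurable fun s : ℝ => ∫⁻ y : Fin n → ℝ, φ (Fin.cons s y) := by
      intro φ hφ
      exact (hφ.comp mc).lintegral_prod_right'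
    have ms : ∀ φ : (Fin (n + 1) → ℝ) → ℝ≥0∞, Measurable φ → ∀ s : ℝ,
        Measurable fun y : Fin n → ℝ => φ (Fin.cons s y) := by
      intro φ hφ s
      exact hφ.comp (mc.comp (measurable_prodMk_left))
    rw [tr f hf, tr g hg, tr h hh]
    refine pl_one (mf f hf) (mf g hg) (mf h hh) h0 h1 ?_
    intro s t
    refine ih (ms f hf s) (ms g hg t) (ms h hh _) ?_
    intro x y
    refine (H _ _).trans (le_of_eq ?_)
    congr 1
    ext i
    refine Fin.cases ?_ (fun j => ?_) i <;> simp

end RKJ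
namespace RKJ
open scoped ENNReal Pointwise

lemma bm_euclid {d : ℕ} {A C S : Set (EuclideanSpace ℝ (Fin d))} (hA : MeasurableSet A)
    (hC : MeasurableSet C) (hS : MeasurableSet S) {l : ℝ} (h0 : 0 < l) (h1 : l < 1)
    (h : ∀ a ∈ A, ∀ c ∈ C, (1 - l) • a + l • c ∈ S) (hAC : volume A = volume C) :
    volume A ≤ volume S := by
  have h2 : 0 < 1 - l := by linarith
  have mp := PiLp.volume_preserving_toLp (Fin d)
  have key := pl_fin d (f := (WithLp.toLp 2 ⁻¹' A).indicator 1)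
    (g := (WithLp.toLp 2 ⁻¹' C).indicator 1) (h := (WithLp.toLp 2 ⁻¹' S).indicator 1)
    (measurable_one.indicator (mp.measurable hA)) (measurable_one.indicator (mp.measurable hC))
    (measurable_one.indicator (mp.measurable hS)) h0 h1 (by
      intro x y
      by_cases hx : x ∈ WithLp.toLp 2 ⁻¹' A
      · by_cases hy : y ∈ WithLp.toLp 2 ⁻¹' C
        · have : (1 - l) • x + l • y ∈ WithLp.toLp 2 ⁻¹' S := by
            have := h _ hx _ hy
            simpa using this
          rw [indicator_of_mem hx, indicator_of_mem hy, indicator_of_mem this]; simp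
        · rw [indicator_of_notMem hy]; simp [h0]
      · rw [indicator_of_notMem hx]; simp [h2])
  rw [lintegral_indicator_one (mp.measurable hA), lintegral_indicator_one (mp.measurable hC),
    lintegral_indicator_one (mp.measurable hS), mp.measure_preimage hA.nullMeasurableSet,
    mp.measure_preimage hC.nullMeasurableSet, mp.measure_preimage hS.nullMeasurableSet, ← hAC,
    ← ENNReal.rpow_add_of_nonneg _ _ h2.le h0.le] at key
  simpa using key

lemma iso_step {d : ℕ} (hd : 1 ≤ d) {R : ℝ} (hR : 0 < R)
    (hB : volume (ball (0 : EuclideanSpace ℝ (Fin d)) R) = 1)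
    {A S : Set (EuclideanSpace ℝ (Fin d))} (hA : IsCompact A) (hS : MeasurableSet S)
    {ε : ℝ} (hε : 0 < ε) (hpos : 0 < volume.real A)
    (h : ∀ a ∈ A, ∀ y, ‖y‖ ≤ ε → a + y ∈ S) :
    volume A + ENNReal.ofReal (d / R * ε * (volume.real A) ^ (1 - 1 / d : ℝ)) ≤ volume S := by
  have hd' : (0:ℝ) < d := by exact_mod_cast hd
  have hAfin : volume A ≠ ⊤ := hA.measure_lt_top.ne
  set a := volume.real A with ha
  have haA : volume A = ENNReal.ofReal a := by
    rw [ha, Measure.real, ENNReal.ofReal_toReal hAfin]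
  set ρ := R * a ^ (1 / d : ℝ) with hρ
  have hap : 0 < a ^ (1 / d : ℝ) := Real.rpow_pos_of_pos hpos _
  have hρ0 : 0 < ρ := by positivity
  have hfr : Module.finrank ℝ (EuclideanSpace ℝ (Fin d)) = d := by simp
  have hρd : ρ ^ d = R ^ d * a := by
    rw [hρ, mul_pow, ← Real.rpow_natCast (a ^ (1 / d : ℝ)), ← Real.rpow_mul hpos.le]
    field_simp; simp
  have hω : ENNReal.ofReal (R ^ d) * volume (ball (0 : EuclideanSpace ℝ (Fin d)) 1) = 1 := by
    rw [← hB, Measure.addHaar_ball_of_pos _ _ hR, hfr]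
  have hCv : volume (closedBall (0 : EuclideanSpace ℝ (Fin d)) ρ) = volume A := by
    rw [Measure.addHaar_closedBall _ _ hρ0.le, hfr, hρd, mul_comm, ENNReal.ofReal_mul' hpos.le,
      ← mul_assoc, mul_comm (volume _), hω, one_mul, haA]
  set l := ε / (ε + ρ) with hl
  have hl0 : 0 < l := by positivity
  have hl1 : 1 - l = ρ / (ε + ρ) := by rw [hl]; field_simp; ring
  have hl1' : 0 < 1 - l := by rw [hl1]; positivity
  have key := bm_euclid (A := A) (C := closedBall 0 ρ) (S := (1 - l) • S) hA.measurableSet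
    measurableSet_closedBall (hS.const_smul₀ _) hl0 (by linarith) (by
      intro x hx y hy
      refine ⟨x + (l / (1 - l)) • y, h x hx _ ?_, ?_⟩
      · rw [norm_smul, Real.norm_of_nonneg (by positivity)]
        have hy' : ‖y‖ ≤ ρ := by simpa using hy
        calc l / (1 - l) * ‖y‖ ≤ l / (1 - l) * ρ := by gcongr
          _ = ε := by rw [hl1, hl]; field_simp
      · simp only [smul_add, smul_smul]
        congr 2
        field_simp) hCv.symm
  rw [Measure.addHaar_smul, hfr, abs_of_pos (by positivity)] at key
  have e : ENNReal.ofReal ((1 - l)⁻¹ ^ d) * ENNReal.ofReal ((1 - l) ^ d) = 1 := by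
    rw [← ENNReal.ofReal_mul (by positivity), ← mul_pow, inv_mul_cancel₀ hl1'.ne']; simp
  have key2 : ENNReal.ofReal ((1 - l)⁻¹ ^ d) * volume A ≤ volume S := by
    calc _ ≤ ENNReal.ofReal ((1 - l)⁻¹ ^ d) * (ENNReal.ofReal ((1 - l) ^ d) * volume S) := by
          gcongr
      _ = volume S := by rw [← mul_assoc, e, one_mul]
  refine le_trans ?_ key2
  rw [haA, ← ENNReal.ofReal_add hpos.le (by positivity), ← ENNReal.ofReal_mul (by positivity)]
  apply ENNReal.ofReal_le_ofReal
  have hb := one_add_mul_le_pow (a := ε / ρ) (by have : 0 < ε / ρ := by positivity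
                                                 linarith) d
  have e2 : (1 - l)⁻¹ = 1 + ε / ρ := by rw [hl1]; field_simp; ring
  have e3 : a ^ (1 - 1 / d : ℝ) = a / a ^ (1 / d : ℝ) := by
    rw [Real.rpow_sub hpos]; simp
  rw [e2, e3]
  calc a + d / R * ε * (a / a ^ (1 / d : ℝ)) = (1 + d * (ε / ρ)) * a := by
        rw [hρ]; field_simp
    _ ≤ _ := by gcongr

lemma isop {d : ℕ} (hd : 1 ≤ d) {R : ℝ} (hR : 0 < R)
    (hB : volume (ball (0 : EuclideanSpace ℝ (Fin d)) R) = 1)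
    {v : EuclideanSpace ℝ (Fin d) → ℝ} (hv : ContDiff ℝ 1 v) (hc : HasCompactSupport v)
    {a : ℝ} (ha : 0 < a) (hY : 0 < volume.real {x | a ≤ v x}) :
    d / R * a * (volume.real {x | a ≤ v x}) ^ (1 - 1 / d : ℝ) ≤ ∫ x, ‖fderiv ℝ v x‖ := by
  have hd' : (0:ℝ) < d := by exact_mod_cast hd
  have hd1 : (0:ℝ) ≤ 1 - 1 / d := by
    rw [sub_nonneg, div_le_one hd']; exact_mod_cast hd
  set Y := volume.real {x | a ≤ v x} with hYdef
  have hDc : Continuous (fderiv ℝ v) := hv.continuous_fderiv (by simp)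
  have hDs : HasCompactSupport (fderiv ℝ v) := hc.fderiv ℝ
  have hcv : Continuous v := hv.continuous
  have huc : UniformContinuous (fderiv ℝ v) := hDs.uniformContinuous_of_continuous hDc
  set K := cthickening 1 (tsupport v) with hK
  have hKc : IsCompact K := hc.isCompact.cthickening
  have hcomp : ∀ t, 0 < t → IsCompact {x | t ≤ v x} := by
    intro t ht
    refine hc.isCompact.of_isClosed_subset (isClosed_le continuous_const hcv) ?_
    intro x hx
    apply subset_tsupport
    have : t ≤ v x := hx
    rw [Function.mem_support]; linarith
  have main : ∀ η > 0, d / R * a * Y ^ (1 - 1 / d : ℝ) ≤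
      (∫ x, ‖fderiv ℝ v x‖) + η * volume.real K := by
    intro η hη
    obtain ⟨δ, hδ, hδ'⟩ := Metric.uniformContinuous_iff.mp huc η hη
    set ε := min (δ / 2) 1 with hε
    have hε0 : 0 < ε := by positivity
    have hεδ : ε < δ := lt_of_le_of_lt (min_le_left _ _) (by linarith)
    have hε1 : ε ≤ 1 := min_le_right _ _
    have mv : ∀ x y, ‖y‖ ≤ ε → v (x + y) ≤ v x + ε * ‖fderiv ℝ v x‖ + ε * η := by
      intro x y hy
      have h1 := (convex_closedBall x ε).norm_image_sub_le_of_norm_fderiv_le' (𝕜 := ℝ) (f := v)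
        (C := η) (φ := fderiv ℝ v x) (x := x) (y := x + y)
        (fun z _ => hv.differentiable (by simp) z) (by
          intro z hz
          have hz' : dist z x ≤ ε := hz
          have := hδ' (lt_of_le_of_lt hz' hεδ)
          rw [dist_eq_norm] at this
          exact this.le) (mem_closedBall_self hε0.le) (by simpa using hy)
      rw [add_sub_cancel_left, Real.norm_eq_abs] at h1
      have h2 := (abs_le.mp h1).2
      have h3 : fderiv ℝ v x y ≤ ‖fderiv ℝ v x‖ * ε :=
        (le_abs_self _).trans (((fderiv ℝ v x).le_opNorm y).trans (by gcongr))
      have h4 : η * ‖y‖ ≤ η * ε := by gcongr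
      linarith
    set V : EuclideanSpace ℝ (Fin d) → ℝ := fun x => max (v x) 0 + ε * ‖fderiv ℝ v x‖ +
      K.indicator (fun _ => ε * η) x with hV
    have hind0 : ∀ x, 0 ≤ K.indicator (fun _ => ε * η) x := fun x =>
      indicator_nonneg (fun _ _ => by positivity) x
    have hVnn : ∀ x, 0 ≤ V x := fun x => by
      have := hind0 x; simp only [hV]; positivity
    have hVv : ∀ x, v x ≤ V x := fun x => by
      have := hind0 x; have := le_max_left (v x) 0
      have : 0 ≤ ε * ‖fderiv ℝ v x‖ := by positivity
      simp only [hV]; linarith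
    have hVm : Measurable V := by
      refine Measurable.add (Continuous.measurable (by fun_prop)) ?_
      exact measurable_const.indicator hKc.measurableSet
    have hsub : ∀ t, 0 < t → ∀ z ∈ {x | t ≤ v x}, ∀ y, ‖y‖ ≤ ε → z + y ∈ {x | t ≤ V x} := by
      intro t ht z hz y hy
      have hz' : t ≤ v z := hz
      have hzK : z + y ∈ K := by
        refine mem_cthickening_of_dist_le (z + y) z 1 _ ?_ ?_
        · apply subset_tsupport; rw [Function.mem_support]; linarith
        · simpa [dist_eq_norm] using hy.trans hε1
      have := mv (z + y) (-y) (by simpa using hy)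
      rw [add_neg_cancel_right] at this
      change t ≤ V (z + y)
      simp only [hV]
      rw [indicator_of_mem hzK]
      have := le_max_left (v (z + y)) 0
      linarith
    set c' := d / R * ε * Y ^ (1 - 1 / d : ℝ) with hc'
    have hc'0 : 0 ≤ c' := by positivity
    have hpt : ∀ t ∈ Ioi (0:ℝ), volume {x | t ≤ max (v x) 0} +
        (Ioc 0 a).indicator (fun _ => ENNReal.ofReal c') t ≤ volume {x | t ≤ V x} := by
      intro t ht
      have ht0 : 0 < t := ht
      have e1 : {x | t ≤ max (v x) 0} = {x | t ≤ v x} := by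
        ext x; simp [not_le.mpr ht0]
      rw [e1]
      by_cases hta : t ≤ a
      · rw [indicator_of_mem (by exact ⟨ht0, hta⟩)]
        have hYt : Y ≤ volume.real {x | t ≤ v x} := by
          refine measureReal_mono ?_ (hcomp t ht0).measure_lt_top.ne
          intro x hx
          exact le_trans hta hx
        refine le_trans ?_ (iso_step hd hR hB (hcomp t ht0) (measurableSet_le measurable_const hVm)
          hε0 (lt_of_lt_of_le hY hYt) (hsub t ht0))
        rw [hc']
        gcongr
      · rw [indicator_of_notMem (fun h => hta h.2), add_zero]
        apply measure_mono
        intro x hx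
        exact le_trans hx (hVv x)
    have L1 := lintegral_eq_lintegral_meas_le (volume : Measure (EuclideanSpace ℝ (Fin d)))
      (f := V) (Filter.Eventually.of_forall hVnn) hVm.aemeasurable
    have L2 := lintegral_eq_lintegral_meas_le (volume : Measure (EuclideanSpace ℝ (Fin d)))
      (f := fun x => max (v x) 0) (Filter.Eventually.of_forall fun x => le_max_right _ _)
      (by fun_prop)
    have L3 := setLIntegral_mono' (μ := (volume : Measure ℝ)) measurableSet_Ioi hpt
    rw [lintegral_add_right _ (measurable_const.indicator measurableSet_Ioc), ← L1, ← L2,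
      lintegral_indicator measurableSet_Ioc, Measure.restrict_restrict measurableSet_Ioc,
      inter_eq_left.mpr Ioc_subset_Ioi_self, setLIntegral_const, Real.volume_Ioc, sub_zero] at L3
    have i1 : Integrable (fun x => max (v x) 0) := by
      apply Continuous.integrable_of_hasCompactSupport (by fun_prop)
      exact hc.comp_left (g := fun s => max s 0) (by simp)
    have i2 : Integrable (fun x => ε * ‖fderiv ℝ v x‖) := by
      apply Integrable.const_mul
      exact (hDc.integrable_of_hasCompactSupport hDs).norm
    have i3 : Integrable (K.indicator (fun _ => ε * η)) (volume : Measure (EuclideanSpace ℝ (Fin d))) := by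
      rw [integrable_indicator_iff hKc.measurableSet]
      exact integrableOn_const hKc.measure_lt_top.ne
    have hI0 : 0 ≤ ∫ x, max (v x) 0 := integral_nonneg fun x => le_max_right (v x) 0
    have i12 : Integrable (fun x => max (v x) 0 + ε * ‖fderiv ℝ v x‖) := i1.add i2
    have iV : Integrable V := (i1.add i2).add i3
    rw [← ofReal_integral_eq_lintegral_ofReal i1 (Filter.Eventually.of_forall fun x => le_max_right _ _),
      ← ofReal_integral_eq_lintegral_ofReal iV (Filter.Eventually.of_forall hVnn),
      ← ENNReal.ofReal_mul hc'0, ← ENNReal.ofReal_add hI0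
        (by positivity), ENNReal.ofReal_le_ofReal_iff (integral_nonneg hVnn)] at L3
    have eV : ∫ x, V x = (∫ x, max (v x) 0) + ε * (∫ x, ‖fderiv ℝ v x‖) + ε * η * volume.real K := by
      simp only [hV]
      rw [integral_add i12 i3, integral_add i1 i2, integral_const_mul,
        integral_indicator hKc.measurableSet, setIntegral_const]
      simp only [smul_eq_mul]; ring
    rw [eV] at L3
    have : ε * (d / R * a * Y ^ (1 - 1 / d : ℝ)) ≤
      ε * ((∫ x, ‖fderiv ℝ v x‖) + η * volume.real K) := by
      have : c' * a = ε * (d / R * a * Y ^ (1 - 1 / d : ℝ)) := by rw [hc']; ring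
      linarith
    exact le_of_mul_le_mul_left this hε0
  refine le_of_forall_pos_le_add fun e he => ?_
  have hp : 0 ≤ volume.real K := measureReal_nonneg
  refine (main (e / (volume.real K + 1)) (by positivity)).trans ?_
  gcongr
  rw [div_mul_eq_mul_div, div_le_iff₀ (by positivity)]
  nlinarith

end RKJ
namespace RKJ
open scoped ENNReal Pointwise Nat

noncomputable def pser (a : ℕ → ℝ) (z : ℝ) : ℝ := ∑' k, a k * z ^ k

def FBd (a : ℕ → ℝ) : Prop := ∃ C, ∀ k, |a k| ≤ C / k !

lemma FBd.shift {a : ℕ → ℝ} (h : FBd a) : FBd (fun k => (k + 1) * a (k + 1)) := by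
  obtain ⟨C, hC⟩ := h
  refine ⟨C, fun k => ?_⟩
  have := hC (k + 1)
  rw [Nat.factorial_succ] at this
  push_cast at this
  rw [abs_mul, abs_of_nonneg (by positivity)]
  calc ((k:ℝ) + 1) * |a (k + 1)| ≤ (k + 1) * (C / ((k + 1) * k !)) := by gcongr
    _ = C / k ! := by field_simp

lemma FBd.summable {a : ℕ → ℝ} (h : FBd a) (z : ℝ) : Summable fun k => a k * z ^ k := by
  obtain ⟨C, hC⟩ := h
  refine Summable.of_norm_bounded ((Real.summable_pow_div_factorial |z|).mul_left C) ?_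
  intro k
  rw [norm_mul, norm_pow, Real.norm_eq_abs, Real.norm_eq_abs]
  calc |a k| * |z| ^ k ≤ C / k ! * |z| ^ k := by gcongr; exact hC k
    _ = _ := by ring

lemma FBd.hasDerivAt {a : ℕ → ℝ} (h : FBd a) (z : ℝ) :
    HasDerivAt (pser a) (pser (fun k => (k + 1) * a (k + 1)) z) z := by
  have h' := h
  obtain ⟨C, hC⟩ := h
  set r := |z| + 1
  have hr : 0 < r := by positivity
  have key := hasDerivAt_tsum_of_isPreconnected (𝕜 := ℝ) (g := fun k y => a k * y ^ k)
    (g' := fun k y => a k * (k * y ^ (k - 1))) (u := fun k => C / k ! * (k * r ^ (k - 1)))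
    (t := ball 0 r) (y₀ := 0) (y := z) ?_ isOpen_ball (convex_ball 0 r).isPreconnected ?_ ?_ ?_ ?_ ?_
  · refine key.congr_deriv ?_
    unfold pser
    rw [Summable.tsum_eq_zero_add (f := fun k => a k * (k * z ^ (k - 1)))]
    · simp only [CharP.cast_eq_zero, zero_mul, mul_zero, zero_add, Nat.cast_add, Nat.cast_one,
        Nat.add_sub_cancel]
      apply tsum_congr
      intro k; ring
    · rw [← summable_nat_add_iff 1]
      refine (h'.shift.summable z).congr ?_
      intro k; simp; ring
  · rw [← summable_nat_add_iff 1]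
    refine ((Real.summable_pow_div_factorial r).mul_left C).congr ?_
    intro k
    rw [Nat.factorial_succ]; push_cast
    field_simp
  · intro k y _
    simpa using (hasDerivAt_pow k y).const_mul (a k)
  · intro k y hy
    have hy' : |y| ≤ r := by
      have : |y| < r := by simpa using hy
      exact this.le
    simp only [norm_mul, norm_pow, Real.norm_eq_abs, Nat.abs_cast]
    have := (abs_nonneg _).trans (hC k)
    gcongr
    exact hC k
  · simpa using hr
  · exact h'.summable 0
  · simp [r]

lemma FBd.deriv {a : ℕ → ℝ} (h : FBd a) :
    deriv (pser a) = pser (fun k => (k + 1) * a (k + 1)) := by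
  ext z; exact (h.hasDerivAt z).deriv

lemma FBd.contDiff {a : ℕ → ℝ} (h : FBd a) : ContDiff ℝ (⊤ : ℕ∞) (pser a) := by
  rw [contDiff_infty]
  intro n
  induction n generalizing a with
  | zero => 
    simp only [Nat.cast_zero, contDiff_zero]
    exact continuous_iff_continuousAt.mpr fun z => (h.hasDerivAt z).continuousAt
  | succ n ih =>
    push_cast
    rw [contDiff_succ_iff_deriv]
    refine ⟨fun z => (h.hasDerivAt z).differentiableAt, by simp, ?_⟩
    rw [h.deriv]
    exact ih h.shift

noncomputable def bco (d : ℕ) : ℕ → ℝ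
  | 0 => 1
  | k + 1 => - bco d k / ((k + 1) * (4 * k + 2 * d))

lemma bco_bd {d : ℕ} (hd : 1 ≤ d) : FBd (bco d) := by
  refine ⟨1, fun k => ?_⟩
  have hd' : (1:ℝ) ≤ d := by exact_mod_cast hd
  induction k with
  | zero => simp [bco]
  | succ k ih =>
    rw [bco, abs_div, abs_neg, abs_of_pos (a := ((k:ℝ) + 1) * (4 * k + 2 * d)) (by positivity),
      Nat.factorial_succ]
    push_cast
    calc |bco d k| / (((k:ℝ) + 1) * (4 * k + 2 * d)) ≤ (1 / k !) / (((k:ℝ) + 1) * 1) := by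
          gcongr
          have : (0:ℝ) ≤ k := by positivity
          linarith
      _ = _ := by field_simp

noncomputable def bes (d : ℕ) : ℝ → ℝ := pser (bco d)

lemma bes_zero (d : ℕ) : bes d 0 = 1 := by
  unfold bes pser
  rw [tsum_eq_single 0]
  · simp [bco]
  · intro k hk; simp [hk]

lemma bes_smooth {d : ℕ} (hd : 1 ≤ d) : ContDiff ℝ (⊤ : ℕ∞) (bes d) := (bco_bd hd).contDiff

lemma bes_ode {d : ℕ} (hd : 1 ≤ d) (z : ℝ) :
    4 * z * deriv (deriv (bes d)) z + 2 * d * deriv (bes d) z + bes d z = 0 := by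
  have hd' : (1:ℝ) ≤ d := by exact_mod_cast hd
  have b0 := bco_bd hd
  have b1 := b0.shift
  have b2 := b1.shift
  unfold bes
  rw [b0.deriv, b1.deriv]
  have e : z * pser (fun k => ((k:ℝ) + 1) * (((k + 1 : ℕ):ℝ) + 1) * bco d (k + 1 + 1)) z =
      ∑' k : ℕ, ((k:ℝ) * (k + 1) * bco d (k + 1)) * z ^ k := by
    have hs : Summable fun k : ℕ => ((k:ℝ) * (k + 1) * bco d (k + 1)) * z ^ k := by
      rw [← summable_nat_add_iff 1]
      refine ((b2.summable z).mul_left z).congr ?_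
      intro k; push_cast; ring
    rw [hs.tsum_eq_zero_add]
    unfold pser
    rw [← tsum_mul_left]
    simp only [CharP.cast_eq_zero, zero_mul, zero_add]
    apply tsum_congr
    intro k; push_cast; ring
  have hs : Summable fun k : ℕ => ((k:ℝ) * (k + 1) * bco d (k + 1)) * z ^ k := by
    rw [← summable_nat_add_iff 1]
    refine ((b2.summable z).mul_left z).congr ?_
    intro k; push_cast; ring
  have e' : pser (fun k => ((k:ℝ) + 1) * ((((k + 1 : ℕ):ℝ) + 1) * bco d (k + 1 + 1))) z
    = pser (fun k => ((k:ℝ) + 1) * (((k + 1 : ℕ):ℝ) + 1) * bco d (k + 1 + 1)) z := by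
    congr 1; ext k; ring
  rw [e', mul_assoc 4, e]
  unfold pser
  rw [← tsum_mul_left, ← tsum_mul_left, ← Summable.tsum_add, ← Summable.tsum_add]
  · convert tsum_zero with k
    have hb : bco d (k + 1) = - bco d k / ((k + 1) * (4 * k + 2 * d)) := by rw [bco]
    simp only [hb]
    have : (0:ℝ) < 4 * k + 2 * d := by positivity
    field_simp
    ring
  · exact (hs.mul_left 4).add ((b1.summable z).mul_left (2 * (d:ℝ)))
  · exact b0.summable z
  · exact hs.mul_left 4
  · exact (b1.summable z).mul_left (2 * (d:ℝ))

end RKJ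
namespace RKJ
open scoped ENNReal Pointwise Nat

lemma barta {d : ℕ} (hd : 1 ≤ d) {l r : ℝ} (hl : 0 < l)
    (hJ : ∀ z, 0 ≤ z → z < l * r ^ 2 → 0 < bes d z)
    (x₀ : EuclideanSpace ℝ (Fin d)) {u : EuclideanSpace ℝ (Fin d) → ℝ}
    (hu : ContDiff ℝ (⊤ : ℕ∞) u) (hc : HasCompactSupport u) (hs : tsupport u ⊆ ball x₀ r) :
    l * ∫ x, (u x) ^ 2 ≤ ∫ x, ‖fderiv ℝ u x‖ ^ 2 := by
  have hJs := bes_smooth hd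
  set J := bes d with hJd
  have hJ's : ContDiff ℝ (⊤ : ℕ∞) (deriv J) := (contDiff_infty_iff_deriv.mp hJs).2
  have hJ''s : ContDiff ℝ (⊤ : ℕ∞) (deriv (deriv J)) := (contDiff_infty_iff_deriv.mp hJ's).2
  set Q : ℝ → ℝ := fun s => 2 * l * deriv J (l * s) / J (l * s) with hQ
  set Q' : ℝ → ℝ := fun s => 2 * l ^ 2 * deriv (deriv J) (l * s) / J (l * s)
    - 2 * l ^ 2 * (deriv J (l * s)) ^ 2 / (J (l * s)) ^ 2 with hQ'
  have hpos : ∀ x ∈ tsupport u, 0 < J (l * ‖x - x₀‖ ^ 2) := by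
    intro x hx
    have h1 : ‖x - x₀‖ < r := by simpa [dist_eq_norm] using hs hx
    apply hJ _ (by positivity)
    have := norm_nonneg (x - x₀)
    gcongr
  have hQd : ∀ s, J (l * s) ≠ 0 → HasDerivAt Q (Q' s) s := by
    intro s hs
    have hm : HasDerivAt (fun s => l * s) l s := by simpa using (hasDerivAt_id s).const_mul l
    have h1 : HasDerivAt (fun s => J (l * s)) (deriv J (l * s) * l) s :=
      ((hJs.differentiable (by simp)) (l * s)).hasDerivAt.comp s hm
    have h2 : HasDerivAt (fun s => deriv J (l * s)) (deriv (deriv J) (l * s) * l) s :=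
      ((hJ's.differentiable (by simp)) (l * s)).hasDerivAt.comp s hm
    have h3 := (h2.const_mul (2 * l)).div h1 hs
    refine h3.congr_deriv ?_
    simp only [hQ']
    field_simp
  have hric : ∀ s, J (l * s) ≠ 0 → d * Q s + 2 * s * Q' s + s * Q s ^ 2 = - l := by
    intro s hs
    have ode := bes_ode hd (l * s)
    rw [← hJd] at ode
    have : J (l * s) = - (4 * (l * s) * deriv (deriv J) (l * s) + 2 * d * deriv J (l * s)) := by
      linarith
    simp only [hQ, hQ']
    field_simp
    rw [this]; ring
  -- the vector field
  set w : EuclideanSpace ℝ (Fin d) → ℝ := fun x => u x * Q (‖x - x₀‖ ^ 2) with hw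
  have hnsq : ContDiff ℝ (⊤ : ℕ∞) (fun x : EuclideanSpace ℝ (Fin d) => ‖x - x₀‖ ^ 2) := by
    apply ContDiff.norm_sq ℝ; fun_prop
  have hwz : ∀ x, x ∉ tsupport u → ∀ᶠ y in nhds x, u y = 0 := by
    intro x hx
    have := notMem_tsupport_iff_eventuallyEq.mp hx
    exact this
  have hwsm : ContDiff ℝ 1 w := by
    rw [contDiff_iff_contDiffAt]
    intro x
    by_cases hx : x ∈ tsupport u
    · refine ContDiffAt.mul (hu.contDiffAt.of_le (by simp)) ?_
      refine ContDiffAt.div ?_ ?_ (hpos x hx).ne'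
      · apply ContDiff.contDiffAt
        refine contDiff_const.mul ?_
        exact (hJ's.comp (contDiff_const.mul hnsq)).of_le (by simp)
      · apply ContDiff.contDiffAt
        exact (hJs.comp (contDiff_const.mul hnsq)).of_le (by simp)
    · refine (contDiffAt_const (c := (0:ℝ))).congr_of_eventuallyEq ?_
      filter_upwards [hwz x hx] with y hy
      simp [hw, hy]
  have hwc : HasCompactSupport w := hc.mul_right
  set g : Fin d → EuclideanSpace ℝ (Fin d) → ℝ := fun i x => w x * (x - x₀) i with hg
  have hcoord : ∀ i, ContDiff ℝ 1 (fun x : EuclideanSpace ℝ (Fin d) => (x - x₀) i) := by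
    intro i
    fun_prop
  have hgsm : ∀ i, ContDiff ℝ 1 (g i) := fun i => hwsm.mul (hcoord i)
  have hgc : ∀ i, HasCompactSupport (g i) := fun i => hwc.mul_right
  set e : Fin d → EuclideanSpace ℝ (Fin d) := fun i => EuclideanSpace.single i 1 with he
  have hu1 : ContDiff ℝ 1 u := hu.of_le (by simp)
  have hDu : Continuous (fderiv ℝ u) := hu1.continuous_fderiv (by simp)
  have hDuc : HasCompactSupport (fderiv ℝ u) := hc.fderiv ℝ
  have hDg : ∀ i, Continuous (fderiv ℝ (g i)) := fun i => (hgsm i).continuous_fderiv (by simp)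
  have I1 : ∀ i, Integrable (fun x => fderiv ℝ u x (e i) * g i x) := by
    intro i
    apply Continuous.integrable_of_hasCompactSupport
    · exact (hDu.clm_apply continuous_const).mul (hgsm i).continuous
    · exact (hgc i).mul_left
  have I2 : ∀ i, Integrable (fun x => u x * fderiv ℝ (g i) x (e i)) := by
    intro i
    apply Continuous.integrable_of_hasCompactSupport
    · exact hu.continuous.mul ((hDg i).clm_apply continuous_const)
    · exact hc.mul_right
  have ibp : ∀ i, ∫ x, u x * fderiv ℝ (g i) x (e i) = - ∫ x, fderiv ℝ u x (e i) * g i x := by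
    intro i
    apply integral_mul_fderiv_eq_neg_fderiv_mul_of_integrable (I1 i) (I2 i)
    · apply Continuous.integrable_of_hasCompactSupport
      · exact hu.continuous.mul (hgsm i).continuous
      · exact hc.mul_right
    · intro x _; exact hu1.differentiable (by simp) x
    · intro x _; exact (hgsm i).differentiable (by simp) x
  have I12 : ∀ i, Integrable (fun x => u x * fderiv ℝ (g i) x (e i) + fderiv ℝ u x (e i) * g i x) :=
    fun i => (I2 i).add (I1 i)
  have key0 : ∫ x, ∑ i, (u x * fderiv ℝ (g i) x (e i) + fderiv ℝ u x (e i) * g i x) = 0 := by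
    rw [integral_finsetSum _ (fun i _ => I12 i)]
    apply Finset.sum_eq_zero
    intro i _
    rw [integral_add (I2 i) (I1 i), ibp i]; ring
  have hsum : ∀ (L : EuclideanSpace ℝ (Fin d) →L[ℝ] ℝ) (y : EuclideanSpace ℝ (Fin d)),
      ∑ i, y i * L (e i) = L y := by
    intro L y
    conv_rhs => rw [← (EuclideanSpace.basisFun (Fin d) ℝ).sum_repr y]
    simp [he]
  have hnsum : ∀ y : EuclideanSpace ℝ (Fin d), ∑ i, y i * y i = ‖y‖ ^ 2 := by
    intro y
    rw [EuclideanSpace.norm_sq_eq]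
    simp [sq]
  have hpt : ∀ x, ∑ i, (u x * fderiv ℝ (g i) x (e i) + fderiv ℝ u x (e i) * g i x)
      ≤ ‖fderiv ℝ u x‖ ^ 2 - l * u x ^ 2 := by
    intro x
    by_cases hx : x ∈ tsupport u
    · set y := x - x₀ with hy
      have hp := (hpos x hx).ne'
      have hn : HasFDerivAt (fun x : EuclideanSpace ℝ (Fin d) => ‖x - x₀‖ ^ 2)
          (2 • (innerSL ℝ y)) x := by
        have := ((hasFDerivAt_id (𝕜 := ℝ) x).sub_const x₀).norm_sq
        exact this.congr_fderiv (by ext v; simp [hy])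
      have hgd : ∀ i, fderiv ℝ (g i) x (e i) = fderiv ℝ u x (e i) * Q (‖y‖ ^ 2) * y i
          + u x * (Q' (‖y‖ ^ 2) * (2 * y i)) * y i + u x * Q (‖y‖ ^ 2) := by
        intro i
        have hc1 : HasFDerivAt (fun x : EuclideanSpace ℝ (Fin d) => (x - x₀) i)
            (EuclideanSpace.proj i : EuclideanSpace ℝ (Fin d) →L[ℝ] ℝ) x := by
          have := (EuclideanSpace.proj i : EuclideanSpace ℝ (Fin d) →L[ℝ] ℝ).hasFDerivAt.comp x
            ((hasFDerivAt_id (𝕜 := ℝ) x).sub_const x₀)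
          exact this.congr_fderiv (by ext v; simp)
        have hQ1 := (hQd (‖y‖ ^ 2) hp).comp_hasFDerivAt x hn
        have hu2 := (hu1.differentiable (by simp) x).hasFDerivAt
        have := (hu2.mul hQ1).mul hc1
        have h2 : fderiv ℝ (g i) x = _ := this.fderiv
        rw [h2]
        have hi : inner ℝ y (e i) = y i := by
          simp only [he]; rw [EuclideanSpace.inner_single_right]; simp
        have hii : e i i = 1 := by simp [he]
        simp [hi, hii, ← hy]
        ring
      have hE : ∑ i, (u x * fderiv ℝ (g i) x (e i) + fderiv ℝ u x (e i) * g i x)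
          = 2 * u x * Q (‖y‖ ^ 2) * fderiv ℝ u x y
            + u x ^ 2 * (d * Q (‖y‖ ^ 2) + 2 * ‖y‖ ^ 2 * Q' (‖y‖ ^ 2)) := by
        have : ∀ i, u x * fderiv ℝ (g i) x (e i) + fderiv ℝ u x (e i) * g i x =
            2 * u x * Q (‖y‖ ^ 2) * (y i * fderiv ℝ u x (e i)) +
            2 * u x ^ 2 * Q' (‖y‖ ^ 2) * (y i * y i) + u x ^ 2 * Q (‖y‖ ^ 2) := by
          intro i
          rw [hgd i]
          simp only [hg, hw, ← hy]
          ring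
        simp only [this]
        rw [Finset.sum_add_distrib, Finset.sum_add_distrib, ← Finset.mul_sum, ← Finset.mul_sum,
          hsum, hnsum]
        simp
        ring
      rw [hE]
      have hr := hric (‖y‖ ^ 2) hp
      have hle : |fderiv ℝ u x y| ≤ ‖fderiv ℝ u x‖ * ‖y‖ := (fderiv ℝ u x).le_opNorm y
      set D := fderiv ℝ u x y
      set N := ‖fderiv ℝ u x‖
      set q := Q (‖y‖ ^ 2)
      have h1 : u x * q * D ≤ |u x * q| * (N * ‖y‖) := by
        refine (le_abs_self _).trans ?_
        rw [abs_mul]; gcongr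
      have h2 := sq_nonneg (N - |u x * q| * ‖y‖)
      have h3 : |u x * q| ^ 2 = (u x * q) ^ 2 := sq_abs _
      have h4 : d * q + 2 * ‖y‖ ^ 2 * Q' (‖y‖ ^ 2) = - l - ‖y‖ ^ 2 * q ^ 2 := by linarith
      rw [h4]
      nlinarith
    · have h0 : u x = 0 := image_eq_zero_of_notMem_tsupport hx
      have : ∀ i, g i x = 0 := fun i => by simp [hg, hw, h0]
      simp [h0, this]
  have J1 : Integrable (fun x => ‖fderiv ℝ u x‖ ^ 2) := by
    apply Continuous.integrable_of_hasCompactSupport (by fun_prop)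
    exact hDuc.comp_left (g := fun L => ‖L‖ ^ 2) (by simp)
  have J2 : Integrable (fun x => l * u x ^ 2) := by
    apply Continuous.integrable_of_hasCompactSupport
    · have := hu.continuous; fun_prop
    · exact hc.comp_left (g := fun s => l * s ^ 2) (by simp)
  have e2 : ∫ x, (‖fderiv ℝ u x‖ ^ 2 - l * u x ^ 2) = (∫ x, ‖fderiv ℝ u x‖ ^ 2) - l * ∫ x, u x ^ 2 := by
    rw [integral_sub J1 J2, integral_const_mul]
  have e4 : (0:ℝ) ≤ ∫ x, (‖fderiv ℝ u x‖ ^ 2 - l * u x ^ 2) := by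
    rw [← key0]
    exact integral_mono (integrable_finsetSum _ (fun i _ => I12 i)) (J1.sub J2) hpt
  rw [e2] at e4
  linarith

end RKJ
namespace RKJ
open scoped ENNReal Pointwise Nat

def TF {d : ℕ} (Ω : Set (EuclideanSpace ℝ (Fin d))) (u : EuclideanSpace ℝ (Fin d) → ℝ) : Prop :=
  ContDiff ℝ (⊤ : ℕ∞) u ∧ HasCompactSupport u ∧ tsupport u ⊆ Ω

section
variable {d : ℕ} {Ω : Set (EuclideanSpace ℝ (Fin d))} {u : EuclideanSpace ℝ (Fin d) → ℝ}

lemma TF.zero_off (h : TF Ω u) {x} (hx : x ∉ Ω) : u x = 0 :=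
  image_eq_zero_of_notMem_tsupport (fun h' => hx (h.2.2 h'))

lemma TF.dzero_off (h : TF Ω u) {x} (hx : x ∉ Ω) : fderiv ℝ u x = 0 := by
  have : x ∉ tsupport (fderiv ℝ u) := fun h' => hx (h.2.2 (tsupport_fderiv_subset ℝ h'))
  exact image_eq_zero_of_notMem_tsupport this

lemma TF.cD (h : TF Ω u) : Continuous (fderiv ℝ u) := h.1.continuous_fderiv (by simp)

lemma TF.iD (h : TF Ω u) : Integrable (fun x => ‖fderiv ℝ u x‖ ^ 2) := by
  have := h.cD
  apply Continuous.integrable_of_hasCompactSupport (by fun_prop)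
  exact (h.2.1.fderiv ℝ).comp_left (g := fun L => ‖L‖ ^ 2) (by simp)

lemma TF.icomp (h : TF Ω u) {g : ℝ → ℝ} (hg : Continuous g) (h0 : g 0 = 0) :
    Integrable (fun x => g (u x)) :=
  (hg.comp h.1.continuous).integrable_of_hasCompactSupport (h.2.1.comp_left h0)

lemma TF.i1 (h : TF Ω u) : Integrable u := h.icomp continuous_id rfl
lemma TF.i2 (h : TF Ω u) : Integrable (fun x => u x ^ 2) :=
  h.icomp (g := fun s => s ^ 2) (by fun_prop) (by simp)

lemma TF.sD (h : TF Ω u) : ∫ x in Ω, ‖fderiv ℝ u x‖ ^ 2 = ∫ x, ‖fderiv ℝ u x‖ ^ 2 :=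
  setIntegral_eq_integral_of_forall_compl_eq_zero (fun x hx => by simp [h.dzero_off hx])
lemma TF.s1 (h : TF Ω u) : ∫ x in Ω, u x = ∫ x, u x :=
  setIntegral_eq_integral_of_forall_compl_eq_zero (fun x hx => by simp [h.zero_off hx])
lemma TF.s2 (h : TF Ω u) : ∫ x in Ω, u x ^ 2 = ∫ x, u x ^ 2 :=
  setIntegral_eq_integral_of_forall_compl_eq_zero (fun x hx => by simp [h.zero_off hx])

lemma TF.add (h : TF Ω u) {v} (h' : TF Ω v) : TF Ω (fun x => u x + v x) :=
  ⟨h.1.add h'.1, h.2.1.add h'.2.1, (tsupport_add u v).trans (union_subset h.2.2 h'.2.2)⟩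

lemma TF.comp (h : TF Ω u) {g : ℝ → ℝ} (hg : ContDiff ℝ (⊤ : ℕ∞) g) (h0 : g 0 = 0) :
    TF Ω (fun x => g (u x)) :=
  ⟨hg.comp h.1, h.2.1.comp_left h0, (tsupport_comp_subset h0 u).trans h.2.2⟩

lemma TF.smul (h : TF Ω u) (c : ℝ) : TF Ω (fun x => c * u x) :=
  h.comp (g := fun s => c * s) (by fun_prop) (by simp)

lemma TF.mono (h : TF Ω u) {Ω'} (hh : Ω ⊆ Ω') : TF Ω' u := ⟨h.1, h.2.1, h.2.2.trans hh⟩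

lemma exists_TF (hne : Ω.Nonempty) (ho : IsOpen Ω) :
    ∃ u, TF Ω u ∧ 0 < ∫ x, u x ∧ 0 < ∫ x, u x ^ 2 := by
  obtain ⟨x, hx⟩ := hne
  obtain ⟨ε, hε, hb⟩ := Metric.isOpen_iff.mp ho x hx
  let b : ContDiffBump x := ⟨ε / 4, ε / 2, by positivity, by linarith⟩
  have hb : TF Ω b := by
    refine ⟨b.contDiff, b.hasCompactSupport, ?_⟩
    rw [b.tsupport_eq]
    exact (closedBall_subset_ball (by simp [b]; linarith)).trans hb
  refine ⟨b, hb, b.integral_pos, ?_⟩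
  rw [integral_pos_iff_support_of_nonneg (fun x => sq_nonneg _) hb.i2]
  have : Function.support (fun x => b x ^ 2) = Function.support b := by
    ext; simp
  rw [this, b.support_eq]
  exact measure_ball_pos _ _ b.rOut_pos

lemma lam_le (h : TF Ω u) : dirichletEigenvalue d Ω * ∫ x, u x ^ 2 ≤ ∫ x, ‖fderiv ℝ u x‖ ^ 2 := by
  have h0 : 0 ≤ ∫ x, u x ^ 2 := integral_nonneg (fun x => sq_nonneg _)
  rcases h0.eq_or_lt with h0 | h0
  · rw [← h0]; simp; exact integral_nonneg (fun x => sq_nonneg _)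
  · rw [← le_div_iff₀ h0]
    apply csInf_le
    · refine ⟨0, ?_⟩
      rintro _ ⟨v, -, -, -, hv, rfl⟩
      exact div_nonneg (integral_nonneg (fun x => sq_nonneg _)) hv.le
    · exact ⟨u, h.1, h.2.1, h.2.2, by rwa [h.s2], by rw [h.s2, h.sD]⟩

lemma le_lam (hne : Ω.Nonempty) (ho : IsOpen Ω) {l : ℝ}
    (hl : ∀ u, TF Ω u → l * ∫ x, u x ^ 2 ≤ ∫ x, ‖fderiv ℝ u x‖ ^ 2) :
    l ≤ dirichletEigenvalue d Ω := by
  apply le_csInf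
  · obtain ⟨u, h, -, h2⟩ := exists_TF hne ho
    exact ⟨_, u, h.1, h.2.1, h.2.2, by rwa [h.s2], rfl⟩
  · rintro _ ⟨v, h1, h2, h3, hv, rfl⟩
    have h : TF Ω v := ⟨h1, h2, h3⟩
    rw [le_div_iff₀ hv, h.s2, h.sD]
    exact hl v h

lemma cs1 (hv : volume Ω = 1) (h : TF Ω u) : (∫ x, u x) ^ 2 ≤ ∫ x, u x ^ 2 := by
  rw [← h.s1, ← h.s2]
  have : IsProbabilityMeasure (volume.restrict Ω) := ⟨by simp [hv]⟩
  set m := ∫ x in Ω, u x with hm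
  have i1 : Integrable u (volume.restrict Ω) := h.i1.restrict
  have i2 : Integrable (fun x => u x ^ 2) (volume.restrict Ω) := h.i2.restrict
  have h0 : 0 ≤ ∫ x in Ω, (u x - m) ^ 2 := integral_nonneg (fun x => sq_nonneg _)
  have e : ∀ x, (u x - m) ^ 2 = u x ^ 2 - 2 * m * u x + m ^ 2 := fun x => by ring
  simp only [e] at h0
  have i3 : Integrable (fun x => 2 * m * u x) (volume.restrict Ω) := i1.const_mul _
  have i4 : Integrable (fun x => u x ^ 2 - 2 * m * u x) (volume.restrict Ω) := i2.sub i3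
  rw [integral_add i4 (integrable_const _), integral_sub i2 i3, integral_const_mul, ← hm] at h0
  simp at h0
  linarith

end

lemma exists_zero {d : ℕ} (hd : 1 ≤ d) : ∃ z0 : ℝ, 0 < z0 ∧ bes d z0 = 0 ∧
    ∀ z, 0 ≤ z → z < z0 → 0 < bes d z := by
  have hcont : Continuous (bes d) := (bes_smooth hd).continuous
  have h1 : ∃ z, 0 ≤ z ∧ bes d z ≤ 0 := by
    by_contra! hcon
    obtain ⟨u, h, -, h2⟩ := exists_TF (d := d) (Ω := ball 0 1) ⟨0, by simp⟩ isOpen_ball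
    set D := ∫ x, ‖fderiv ℝ u x‖ ^ 2 with hD
    have hD0 : 0 ≤ D := integral_nonneg (fun x => sq_nonneg _)
    have := barta hd (l := (D + 1) / ∫ x, u x ^ 2) (r := 1) (by positivity)
      (fun z hz _ => hcon z hz) 0 h.1 h.2.1 h.2.2
    rw [div_mul_cancel₀ _ h2.ne'] at this
    linarith
  obtain ⟨z1, hz1, hz1'⟩ := h1
  have h3 : ∀ z, 0 ≤ z → bes d z ≤ 0 → ∃ y, 0 ≤ y ∧ y ≤ z ∧ bes d y = 0 := by
    intro z hz hz'
    have := intermediate_value_Icc' hz hcont.continuousOn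
    obtain ⟨y, hy, hy'⟩ := this ⟨hz', by rw [bes_zero]; exact zero_le_one⟩
    exact ⟨y, hy.1, hy.2, hy'⟩
  set S : Set ℝ := Ici 0 ∩ (bes d) ⁻¹' {0} with hS
  have hSc : IsClosed S := isClosed_Ici.inter (isClosed_singleton.preimage hcont)
  obtain ⟨y, hy0, hy1, hy2⟩ := h3 z1 hz1 hz1'
  have hSn : S.Nonempty := ⟨y, hy0, hy2⟩
  have hSb : BddBelow S := ⟨0, fun x hx => hx.1⟩
  have hm := hSc.csInf_mem hSn hSb
  refine ⟨sInf S, ?_, hm.2, ?_⟩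
  · rcases (show 0 ≤ sInf S from hm.1).eq_or_lt with h | h
    · have := hm.2
      rw [← h] at this
      simp [bes_zero] at this
    · exact h
  · intro z hz hzs
    by_contra! hn
    obtain ⟨y, hy0, hy1, hy2⟩ := h3 z hz hn
    have := csInf_le hSb (show y ∈ S from ⟨hy0, hy2⟩)
    linarith

section
variable {d : ℕ} {Ω : Set (EuclideanSpace ℝ (Fin d))} {u : EuclideanSpace ℝ (Fin d) → ℝ}

lemma poinc (hd : 1 ≤ d) (hb : Bornology.IsBounded Ω) :
    ∃ p : ℝ, 0 < p ∧ ∀ u, TF Ω u → p * ∫ x, u x ^ 2 ≤ ∫ x, ‖fderiv ℝ u x‖ ^ 2 := by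
  obtain ⟨z0, h0, -, hz⟩ := exists_zero hd
  obtain ⟨r, hr⟩ := hb.subset_ball 0
  set r' := max r 1
  have hr0 : 0 < r' := lt_max_of_lt_right one_pos
  refine ⟨z0 / r' ^ 2, by positivity, fun u h => ?_⟩
  refine barta hd (r := r') (by positivity) ?_ 0 h.1 h.2.1 
    (h.2.2.trans (hr.trans (ball_subset_ball (le_max_left _ _))))
  intro z hz1 hz2
  rw [div_mul_cancel₀ _ (by positivity)] at hz2
  exact hz z hz1 hz2

lemma lam_pos (hd : 1 ≤ d) (hb : Bornology.IsBounded Ω) (hne : Ω.Nonempty) (ho : IsOpen Ω) :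
    0 < dirichletEigenvalue d Ω := by
  obtain ⟨p, hp, h⟩ := poinc hd hb
  exact hp.trans_le (le_lam hne ho h)

lemma tor_le (hd : 1 ≤ d) (hb : Bornology.IsBounded Ω) (hv : volume Ω = 1) (h : TF Ω u) :
    (∫ x, u x) ^ 2 ≤ dirichletTorsion d Ω * ∫ x, ‖fderiv ℝ u x‖ ^ 2 := by
  obtain ⟨p, hp, hpo⟩ := poinc hd hb
  have h0 : 0 ≤ ∫ x, ‖fderiv ℝ u x‖ ^ 2 := integral_nonneg (fun x => sq_nonneg _)
  rcases h0.eq_or_lt with h0 | h0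
  · have h1 := hpo u h
    have h2 := cs1 hv h
    rw [← h0] at h1 ⊢
    nlinarith
  · rw [← div_le_iff₀ h0]
    apply le_csSup
    · refine ⟨1 / p, ?_⟩
      rintro _ ⟨v, h1, h2, h3, hvv, rfl⟩
      have h : TF Ω v := ⟨h1, h2, h3⟩
      rw [div_le_div_iff₀ hvv hp, h.s1, h.sD]
      have h1 := hpo v h
      have h2 := cs1 hv h
      nlinarith
    · exact ⟨u, h.1, h.2.1, h.2.2, by rwa [h.sD], by rw [h.s1, h.sD]⟩

lemma tor_pos (hd : 1 ≤ d) (hb : Bornology.IsBounded Ω) (hv : volume Ω = 1)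
    (hne : Ω.Nonempty) (ho : IsOpen Ω) : 0 < dirichletTorsion d Ω := by
  obtain ⟨u, h, h1, -⟩ := exists_TF hne ho
  have := tor_le hd hb hv h
  have h0 : 0 ≤ ∫ x, ‖fderiv ℝ u x‖ ^ 2 := integral_nonneg (fun x => sq_nonneg _)
  by_contra! hn
  nlinarith [pow_pos h1 2]

/-- near optimizers, before normalisation -/
lemma tor_sup (hd : 1 ≤ d) (hb : Bornology.IsBounded Ω) (hv : volume Ω = 1)
    (hne : Ω.Nonempty) (ho : IsOpen Ω) {ε : ℝ} (hε : 0 < ε) :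
    ∃ u, TF Ω u ∧ 0 < ∫ x, ‖fderiv ℝ u x‖ ^ 2 ∧ 
      (dirichletTorsion d Ω - ε) * ∫ x, ‖fderiv ℝ u x‖ ^ 2 < (∫ x, u x) ^ 2 := by
  have hT := tor_pos hd hb hv hne ho
  obtain ⟨p, hp, hpo⟩ := poinc hd hb
  have hlt : dirichletTorsion d Ω - ε < dirichletTorsion d Ω := by linarith
  obtain ⟨_, ⟨v, h1, h2, h3, hvv, rfl⟩, hlt⟩ := exists_lt_of_lt_csSup (by
    obtain ⟨u, h, h1, h2⟩ := exists_TF hne ho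
    exact ⟨_, u, h.1, h.2.1, h.2.2, by rw [h.sD]; nlinarith [hpo u h], rfl⟩) hlt
  have h : TF Ω v := ⟨h1, h2, h3⟩
  rw [h.sD] at hvv
  rw [h.s1, h.sD, lt_div_iff₀ hvv] at hlt
  exact ⟨v, h, hvv, hlt⟩

lemma lam_tor (hd : 1 ≤ d) (hb : Bornology.IsBounded Ω) (hv : volume Ω = 1)
    (hne : Ω.Nonempty) (ho : IsOpen Ω) :
    dirichletEigenvalue d Ω * dirichletTorsion d Ω ≤ 1 := by
  have hl := lam_pos hd hb hne ho
  rw [← le_div_iff₀' hl]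
  refine le_of_forall_pos_lt_add (fun ε hε => ?_)
  obtain ⟨u, h, h1, h2⟩ := tor_sup hd hb hv hne ho hε
  have h3 := lam_le h
  have h4 := cs1 hv h
  have h5 : (∫ x, u x) ^ 2 ≤ 1 / dirichletEigenvalue d Ω * ∫ x, ‖fderiv ℝ u x‖ ^ 2 := by
    rw [div_mul_eq_mul_div, le_div_iff₀ hl]
    nlinarith
  have := lt_of_mul_lt_mul_right (h2.trans_le h5) h1.le
  linarith

/-- normalised near optimizers -/
lemma near_opt (hd : 1 ≤ d) (hb : Bornology.IsBounded Ω) (hv : volume Ω = 1)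
    (hne : Ω.Nonempty) (ho : IsOpen Ω) {ε : ℝ} (hε : 0 < ε) :
    ∃ u, TF Ω u ∧ ∫ x, ‖fderiv ℝ u x‖ ^ 2 = ∫ x, u x ∧
      dirichletTorsion d Ω - ε < ∫ x, u x ∧ ∫ x, u x ≤ dirichletTorsion d Ω ∧ 0 < ∫ x, u x := by
  have hT := tor_pos hd hb hv hne ho
  set T := dirichletTorsion d Ω
  have hε' : 0 < min ε T := lt_min hε hT
  obtain ⟨u, h, h1, h2⟩ := tor_sup hd hb hv hne ho hε'
  have h3 := tor_le hd hb hv h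
  set D := ∫ x, ‖fderiv ℝ u x‖ ^ 2
  set I := ∫ x, u x
  have hI : 0 < I ^ 2 := by
    have : 0 ≤ T - min ε T := by linarith [min_le_right ε T]
    nlinarith [mul_nonneg this h1.le]
  have hs := h.smul (I / D)
  have e1 : ∫ x, I / D * u x = I ^ 2 / D := by
    rw [integral_const_mul]; ring
  have e2 : ∫ x, ‖fderiv ℝ (fun x => I / D * u x) x‖ ^ 2 = I ^ 2 / D := by
    have : ∀ x, ‖fderiv ℝ (fun x => I / D * u x) x‖ ^ 2 = (I / D) ^ 2 * ‖fderiv ℝ u x‖ ^ 2 := by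
      intro x
      rw [fderiv_const_mul (h.1.differentiable (by simp) x), norm_smul, mul_pow, Real.norm_eq_abs,
        sq_abs]
    simp only [this]
    rw [integral_const_mul]
    change (I / D) ^ 2 * D = _
    field_simp
  refine ⟨_, hs, by rw [e1, e2], ?_, ?_, ?_⟩
  · rw [e1, lt_div_iff₀ h1]
    refine lt_of_le_of_lt ?_ h2
    have := min_le_left ε T
    gcongr
  · rw [e1, div_le_iff₀ h1]; exact h3
  · rw [e1]; positivity

end
end RKJ
namespace RKJ
open scoped ENNReal Pointwise Nat

lemma exists_G (t : ℝ) {h η : ℝ} (hh : 0 < h) (hη : 0 < η) (hη1 : η < 1) :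
    ∃ G : ℝ → ℝ, ContDiff ℝ (⊤ : ℕ∞) G ∧ (∀ s ≤ t, G s = 0) ∧
      (∀ s, t + h ≤ s → (1 - η) * h ≤ G s) ∧ (∀ s, 0 ≤ G s ∧ G s ≤ h) ∧
      (∀ s, 0 ≤ deriv G s ∧ deriv G s ≤ 1) ∧ (∀ s, s ≤ t → deriv G s = 0) ∧
      (∀ s, t + h ≤ s → deriv G s = 0) ∧
      (∀ s, s ≤ t + (1 - η / 2) * h → s - t - η * h / 2 ≤ G s) := by
  let b : ContDiffBump (t + h / 2) := ⟨(1 - η) * h / 2, h / 2,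
    by have : 0 < 1 - η := by linarith
       positivity, by nlinarith⟩
  have hb0 : ∀ s, s ≤ t → b s = 0 := fun s hs => by
    apply b.zero_of_le_dist
    rw [Real.dist_eq, abs_of_nonpos (by linarith)]
    simp only [b]; linarith
  have hb1 : ∀ s, t + h ≤ s → b s = 0 := fun s hs => by
    apply b.zero_of_le_dist
    rw [Real.dist_eq, abs_of_nonneg (by linarith)]
    simp only [b]; linarith
  have hb2 : ∀ s, t + η * h / 2 ≤ s → s ≤ t + (1 - η / 2) * h → b s = 1 := fun s hs hs' => by
    apply b.one_of_mem_closedBall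
    rw [mem_closedBall, Real.dist_eq, abs_le]
    simp only [b]
    constructor <;> nlinarith
  have hbc : Continuous b := b.continuous
  have hi : ∀ a c, IntervalIntegrable b volume a c := fun a c => hbc.intervalIntegrable _ _
  set G : ℝ → ℝ := fun s => ∫ x in t..s, b x with hG
  have hGd : ∀ s, HasDerivAt G (b s) s := fun s => hbc.integral_hasStrictDerivAt t s |>.hasDerivAt
  have hGd' : deriv G = b := funext fun s => (hGd s).deriv
  have hG0 : ∀ s ≤ t, G s = 0 := by
    intro s hs
    rw [hG]
    simp only
    rw [intervalIntegral.integral_congr (g := fun _ => (0:ℝ))]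
    · simp
    · intro x hx
      rw [uIcc_of_ge hs] at hx
      exact hb0 x hx.2
  have hmono : ∀ a c, a ≤ c → G a ≤ G c := by
    intro a c hac
    have : G c = G a + ∫ x in a..c, b x := by
      simp only [hG]
      rw [intervalIntegral.integral_add_adjacent_intervals (hi _ _) (hi _ _)]
    rw [this]
    have := intervalIntegral.integral_nonneg hac (fun x _ => b.nonneg (x := x)) (μ := volume)
    linarith
  have hnn : ∀ s, 0 ≤ G s := by
    intro s
    rcases le_total s t with hs | hs
    · rw [hG0 s hs]
    · have := hmono t s hs; rwa [hG0 t le_rfl] at this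
  have hlow : ∀ s, s ≤ t + (1 - η / 2) * h → s - t - η * h / 2 ≤ G s := by
    intro s hs
    rcases le_total s (t + η * h / 2) with h1 | h1
    · have := hnn s; linarith
    · have : G s = G (t + η * h / 2) + ∫ x in (t + η * h / 2)..s, b x := by
        simp only [hG]
        rw [intervalIntegral.integral_add_adjacent_intervals (hi _ _) (hi _ _)]
      rw [this, intervalIntegral.integral_congr (g := fun _ => (1:ℝ))]
      · have := hnn (t + η * h / 2)
        simp
        linarith
      · intro x hx
        rw [uIcc_of_le h1] at hx
        exact hb2 x hx.1 (hx.2.trans hs)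
  have hup : ∀ s, t + h ≤ s → G s = G (t + h) := by
    intro s hs
    have : G s = G (t + h) + ∫ x in (t + h)..s, b x := by
      simp only [hG]
      rw [intervalIntegral.integral_add_adjacent_intervals (hi _ _) (hi _ _)]
    rw [this, intervalIntegral.integral_congr (g := fun _ => (0:ℝ))]
    · simp
    · intro x hx
      rw [uIcc_of_le hs] at hx
      exact hb1 x hx.1
  have htop : G (t + h) ≤ h := by
    have : G (t + h) ≤ ∫ x in t..(t + h), (1:ℝ) :=
      intervalIntegral.integral_mono_on (by linarith) (hi _ _) (by simp) (fun x _ => b.le_one)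
    simpa using this
  refine ⟨G, ?_, hG0, ?_, fun s => ⟨hnn s, ?_⟩, ?_, ?_, ?_, hlow⟩
  · rw [contDiff_infty_iff_deriv]
    exact ⟨fun s => (hGd s).differentiableAt, by rw [hGd']; exact b.contDiff⟩
  · intro s hs
    have h1 := hlow (t + (1 - η / 2) * h) le_rfl
    have h2 := hmono (t + (1 - η / 2) * h) s (by nlinarith)
    nlinarith
  · rcases le_total s (t + h) with h1 | h1
    · exact (hmono _ _ h1).trans htop
    · rw [hup s h1]; exact htop
  · intro s; rw [hGd']; exact ⟨b.nonneg, b.le_one⟩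
  · intro s; rw [hGd']; exact hb0 s
  · intro s; rw [hGd']; exact hb1 s

section
variable {d : ℕ} {Ω : Set (EuclideanSpace ℝ (Fin d))} {u : EuclideanSpace ℝ (Fin d) → ℝ}

lemma TF.fderiv_comp (h : TF Ω u) {g : ℝ → ℝ} (hg : ContDiff ℝ (⊤ : ℕ∞) g) (x) :
    fderiv ℝ (fun x => g (u x)) x = deriv g (u x) • fderiv ℝ u x := by
  have h1 := (hg.differentiable (by simp) (u x)).hasDerivAt
  have h2 := (h.1.differentiable (by simp) x).hasFDerivAt
  exact (h1.comp_hasFDerivAt x h2).fderiv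

/-- integrability of `g (u) |Du|^2` -/
lemma TF.iDg (h : TF Ω u) {g : ℝ → ℝ} (hg : Continuous g) :
    Integrable (fun x => g (u x) * ‖fderiv ℝ u x‖ ^ 2) := by
  have := h.cD
  have := h.1.continuous
  apply Continuous.integrable_of_hasCompactSupport (by fun_prop)
  have h3 : HasCompactSupport (fun x => ‖fderiv ℝ u x‖ ^ 2) :=
    (h.2.1.fderiv ℝ).comp_left (g := fun L => ‖L‖ ^ 2) (by simp)
  exact h3.mul_left

lemma weak (hd : 1 ≤ d) (hb : Bornology.IsBounded Ω) (hv : volume Ω = 1) (h : TF Ω u)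
    {ε K : ℝ} (hD : ∫ x, ‖fderiv ℝ u x‖ ^ 2 = ∫ x, u x)
    (h1 : dirichletTorsion d Ω - ε < ∫ x, u x) (h2 : ∫ x, u x ≤ dirichletTorsion d Ω)
    (h3 : 0 < ∫ x, u x) {G : ℝ → ℝ} (hG : ContDiff ℝ (⊤ : ℕ∞) G) (hG0 : G 0 = 0)
    (hK : ∀ s, |deriv G s| ≤ K) :
    |(∫ x, deriv G (u x) * ‖fderiv ℝ u x‖ ^ 2) - ∫ x, G (u x)| ≤
      K * (√(ε * dirichletTorsion d Ω) + ε) := by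
  set T := dirichletTorsion d Ω with hT
  set τ := ∫ x, u x with hτ
  have hK0 : 0 ≤ K := (abs_nonneg _).trans (hK 0)
  have hT0 : 0 < T := h3.trans_le h2
  have hε : 0 < ε := by linarith
  have hG's : Continuous (deriv G) := hG.continuous_deriv (by simp)
  set a := ∫ x, deriv G (u x) * ‖fderiv ℝ u x‖ ^ 2 with ha
  set g := ∫ x, G (u x) with hg
  set b := ∫ x, (deriv G (u x)) ^ 2 * ‖fderiv ℝ u x‖ ^ 2 with hbb
  have ia := h.iDg hG's
  have ib := h.iDg (g := fun s => (deriv G s) ^ 2) (by fun_prop)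
  have hbK : b ≤ K ^ 2 * τ := by
    rw [← hD, ← integral_const_mul]
    apply integral_mono ib (h.iD.const_mul _)
    intro x
    have : deriv G (u x) ^ 2 ≤ K ^ 2 := by
      rw [← sq_abs]; exact pow_le_pow_left₀ (abs_nonneg _) (hK _) 2
    simp only; gcongr
  have hgv := h.comp hG hG0
  have hg2 : g ^ 2 ≤ T * b := by
    have := tor_le hd hb hv hgv
    convert this using 3
    ext x
    rw [h.fderiv_comp hG, norm_smul, mul_pow, Real.norm_eq_abs, sq_abs]
  have key : ∀ s : ℝ, 0 ≤ (T * b - g ^ 2) * (s * s) + (2 * (T * a - τ * g)) * s + τ * (T - τ) := by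
    intro s
    have hs : ContDiff ℝ (⊤ : ℕ∞) (fun y => y + s * G y) := by fun_prop
    have hv' := h.comp hs (by simp [hG0])
    have hder : ∀ y, deriv (fun y => y + s * G y) y = 1 + s * deriv G y := by
      intro y
      have := (hG.differentiable (by simp) y).hasDerivAt
      exact ((hasDerivAt_id y).add (this.const_mul s)).deriv
    have := tor_le hd hb hv hv'
    have e1 : ∫ x, (u x + s * G (u x)) = τ + s * g := by
      rw [integral_add h.i1 (hgv.i1.const_mul s), integral_const_mul]
    have e2 : ∫ x, ‖fderiv ℝ (fun x => u x + s * G (u x)) x‖ ^ 2 = τ + 2 * s * a + s ^ 2 * b := by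
      have : ∀ x, ‖fderiv ℝ (fun x => u x + s * G (u x)) x‖ ^ 2 = (‖fderiv ℝ u x‖ ^ 2 +
          2 * s * (deriv G (u x) * ‖fderiv ℝ u x‖ ^ 2)) +
          s ^ 2 * ((deriv G (u x)) ^ 2 * ‖fderiv ℝ u x‖ ^ 2) := by
        intro x
        rw [h.fderiv_comp hs, norm_smul, mul_pow, Real.norm_eq_abs, sq_abs, hder]
        ring
      simp only [this]
      have i1 : Integrable (fun x => ‖fderiv ℝ u x‖ ^ 2 +
          2 * s * (deriv G (u x) * ‖fderiv ℝ u x‖ ^ 2)) := h.iD.add (ia.const_mul _)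
      rw [integral_add i1 (ib.const_mul _), integral_add h.iD (ia.const_mul _),
        integral_const_mul, integral_const_mul, hD]
    rw [e1, e2] at this
    nlinarith
  have hdis := discrim_le_zero key
  rw [discrim] at hdis
  have hsq : (T * a - τ * g) ^ 2 ≤ (T * K * √(ε * T)) ^ 2 := by
    have e : (T * K * √(ε * T)) ^ 2 = T ^ 2 * K ^ 2 * (ε * T) := by
      rw [mul_pow, mul_pow, Real.sq_sqrt (by positivity)]
    rw [e]
    have f1 : τ * (T - τ) ≤ T * ε := by nlinarith
    have f2 : T * b - g ^ 2 ≤ T * (K ^ 2 * T) := by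
      have : b ≤ K ^ 2 * T := hbK.trans (by gcongr)
      nlinarith [sq_nonneg g]
    have f3 : (T * b - g ^ 2) * (τ * (T - τ)) ≤ T * (K ^ 2 * T) * (T * ε) :=
      mul_le_mul f2 f1 (mul_nonneg h3.le (by linarith)) (by positivity)
    nlinarith
  have habs := abs_le_of_sq_le_sq hsq (by positivity)
  have hgabs : |g| ≤ T * K := by
    apply abs_le_of_sq_le_sq _ (by positivity)
    have : b ≤ K ^ 2 * T := hbK.trans (by gcongr)
    nlinarith
  have e : T * (a - g) = (T * a - τ * g) - (T - τ) * g := by ring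
  have h5 : T * |a - g| ≤ T * (K * (√(ε * T) + ε)) := by
    rw [← abs_of_pos hT0, ← abs_mul, e, abs_of_pos hT0]
    refine (abs_sub _ _).trans ?_
    rw [abs_mul (T - τ), abs_of_nonneg (show 0 ≤ T - τ by linarith)]
    have : (T - τ) * |g| ≤ ε * (T * K) := mul_le_mul (by linarith) hgabs (abs_nonneg _) hε.le
    linarith
  exact le_of_mul_le_mul_left h5 hT0
end
end RKJ
namespace RKJ
open scoped ENNReal Pointwise Nat

noncomputable def dist' {d : ℕ} (u : EuclideanSpace ℝ (Fin d) → ℝ) (t : ℝ) : ℝ :=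
  volume.real {x | t < u x}

section
variable {d : ℕ} {Ω : Set (EuclideanSpace ℝ (Fin d))} {u : EuclideanSpace ℝ (Fin d) → ℝ}

lemma TF.lev_sub (h : TF Ω u) {t : ℝ} (ht : 0 ≤ t) : {x | t < u x} ⊆ Ω := by
  intro x hx
  by_contra hn
  have := h.zero_off hn
  have hx' : t < u x := hx
  linarith

lemma TF.lev_fin (h : TF Ω u) (hv : volume Ω = 1) {t : ℝ} (ht : 0 ≤ t) :
    volume {x | t < u x} ≠ ∞ :=
  ((measure_mono (h.lev_sub ht)).trans_lt (by rw [hv]; exact ENNReal.one_lt_top)).ne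

lemma TF.lev_meas (h : TF Ω u) (t : ℝ) : MeasurableSet {x | t < u x} :=
  (isOpen_lt continuous_const h.1.continuous).measurableSet

lemma TF.dist_le_one (h : TF Ω u) (hv : volume Ω = 1) {t : ℝ} (ht : 0 ≤ t) : dist' u t ≤ 1 := by
  have := measureReal_mono (μ := volume) (h.lev_sub ht) (by rw [hv]; simp)
  simpa [Measure.real, hv, dist'] using this

lemma TF.dist_anti (h : TF Ω u) (hv : volume Ω = 1) {t s : ℝ} (ht : 0 ≤ t) (hs : t ≤ s) :
    dist' u s ≤ dist' u t :=
  measureReal_mono (fun x hx => hs.trans_lt hx) (h.lev_fin hv ht)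

lemma talenti_step (hd : 1 ≤ d) {R : ℝ} (hR : 0 < R)
    (hB : volume (ball (0 : EuclideanSpace ℝ (Fin d)) R) = 1) (h : TF Ω u) (hv : volume Ω = 1)
    {δ : ℝ} (hδ : ∀ G : ℝ → ℝ, ContDiff ℝ (⊤ : ℕ∞) G → G 0 = 0 → (∀ s, |deriv G s| ≤ 1) →
      |(∫ x, deriv G (u x) * ‖fderiv ℝ u x‖ ^ 2) - ∫ x, G (u x)| ≤ δ)
    {t k : ℝ} (ht : 0 ≤ t) (hk : 0 < k) :
    (d / R) ^ 2 * k ^ 2 * dist' u (t + k) ^ 2 ≤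
      (dist' u t - dist' u (t + k)) * (k * dist' u t + δ) * dist' u (t + k) ^ (2 / d : ℝ) := by
  have hd0 : (0:ℝ) < d := by exact_mod_cast hd
  have hy0 : 0 ≤ dist' u (t + k) := measureReal_nonneg
  rcases hy0.eq_or_lt with hy0 | hy0
  · rw [← hy0, Real.zero_rpow (by positivity)]; simp
  set y := dist' u (t + k) with hy
  set x := dist' u t with hx
  have main : ∀ η : ℝ, 0 < η → η < 1 →
      (d / R) ^ 2 * ((1 - η) * k) ^ 2 * y ^ 2 ≤ (x - y) * (k * x + δ) * y ^ (2 / d : ℝ) := by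
    intro η hη hη1
    obtain ⟨G, hG, hG0, hG1, hG2, hG3, hG4, hG5, -⟩ := exists_G t hk hη hη1
    have hGz : G 0 = 0 := hG0 0 ht
    have ha : 0 < (1 - η) * k := mul_pos (by linarith) hk
    have hG's : Continuous (deriv G) := hG.continuous_deriv (by simp)
    have hvv := h.comp hG hGz
    have hsub : {z | t + k < u z} ⊆ {z | (1 - η) * k ≤ G (u z)} := by
      intro z hz
      exact hG1 _ (le_of_lt hz)
    have hfin : volume {z | (1 - η) * k ≤ G (u z)} ≠ ∞ := by
      refine ((measure_mono (?_ : _ ⊆ Ω)).trans_lt (by rw [hv]; exact ENNReal.one_lt_top)).ne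
      intro z hz
      by_contra hn
      have h1 := hvv.zero_off hn
      have h2 : (1 - η) * k ≤ G (u z) := hz
      linarith
    have hyle : y ≤ volume.real {z | (1 - η) * k ≤ G (u z)} := measureReal_mono hsub hfin
    have hiso := isop hd hR hB (hvv.1.of_le (by simp)) hvv.2.1 ha (hy0.trans_le hyle)
    set N := ∫ z, ‖fderiv ℝ (fun x => G (u x)) z‖ with hN
    have hex : (0:ℝ) ≤ 1 - 1 / d := by
      rw [sub_nonneg, div_le_one hd0]; exact_mod_cast hd
    have hiso' : d / R * ((1 - η) * k) * y ^ (1 - 1 / d : ℝ) ≤ N := by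
      refine le_trans ?_ hiso
      have := Real.rpow_le_rpow hy0.le hyle hex
      gcongr
    have hNe : ∀ z, ‖fderiv ℝ (fun x => G (u x)) z‖ = deriv G (u z) * ‖fderiv ℝ u z‖ := by
      intro z
      rw [h.fderiv_comp hG, norm_smul, Real.norm_of_nonneg (hG3 _).1]
    set S : Set (EuclideanSpace ℝ (Fin d)) := {z | t < u z} \ {z | t + k < u z} with hS
    have hSm : MeasurableSet S := (h.lev_meas t).diff (h.lev_meas (t + k))
    have hsub2 : {z | t + k < u z} ⊆ {z | t < u z} := fun z hz => by
      have : t + k < u z := hz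
      show t < u z
      linarith
    have hSv : volume.real S = x - y :=
      measureReal_sdiff hsub2 (h.lev_meas _) (h.lev_fin hv ht)
    have hSfin : volume S ≠ ∞ := ((measure_mono sdiff_subset).trans_lt (h.lev_fin hv ht).lt_top).ne
    have hSz : ∀ z, z ∉ S → deriv G (u z) = 0 := by
      intro z hz
      rcases le_or_gt (u z) t with h1 | h1
      · exact hG4 _ h1
      · rcases le_or_gt (t + k) (u z) with h2 | h2
        · exact hG5 _ h2
        · exact absurd ⟨h1, fun h3 => by have h3' : t + k < u z := h3; linarith⟩ hz
    set P := ∫ z, (deriv G (u z)) ^ 2 * ‖fderiv ℝ u z‖ ^ 2 with hP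
    have iP := h.iDg (g := fun s => (deriv G s) ^ 2) (by fun_prop)
    have iN : Integrable (fun z => deriv G (u z) * ‖fderiv ℝ u z‖) := by
      have := h.cD
      have := h.1.continuous
      apply Continuous.integrable_of_hasCompactSupport (by fun_prop)
      have h3 : HasCompactSupport (fun x => ‖fderiv ℝ u x‖) :=
        (h.2.1.fderiv ℝ).comp_left (g := fun L => ‖L‖) (by simp)
      exact h3.mul_left
    have iS : Integrable (S.indicator (fun _ => (1:ℝ))) :=
      (integrable_indicator_iff hSm).mpr (integrableOn_const hSfin)
    have key : ∀ s : ℝ, 0 ≤ P * (s * s) + (-(2 * N)) * s + (x - y) := by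
      intro s
      have h0 : 0 ≤ ∫ z, (s * (deriv G (u z) * ‖fderiv ℝ u z‖) - S.indicator (fun _ => (1:ℝ)) z) ^ 2 :=
        integral_nonneg (fun z => sq_nonneg _)
      have e : ∀ z, (s * (deriv G (u z) * ‖fderiv ℝ u z‖) - S.indicator (fun _ => (1:ℝ)) z) ^ 2 =
          (s ^ 2 * ((deriv G (u z)) ^ 2 * ‖fderiv ℝ u z‖ ^ 2) -
            2 * s * (deriv G (u z) * ‖fderiv ℝ u z‖)) + S.indicator (fun _ => (1:ℝ)) z := by
        intro z
        by_cases hz : z ∈ S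
        · simp only [indicator_of_mem hz]; ring
        · simp only [indicator_of_notMem hz, hSz z hz]; ring
      simp only [e] at h0
      have i1 : Integrable (fun z => s ^ 2 * ((deriv G (u z)) ^ 2 * ‖fderiv ℝ u z‖ ^ 2) -
            2 * s * (deriv G (u z) * ‖fderiv ℝ u z‖)) := (iP.const_mul _).sub (iN.const_mul _)
      rw [integral_add i1 iS, integral_sub (iP.const_mul _) (iN.const_mul _), integral_const_mul,
        integral_const_mul, integral_indicator hSm] at h0
      simp only [integral_const, MeasurableSet.univ, measureReal_restrict_apply, univ_inter, hSv,
        smul_eq_mul, mul_one] at h0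
      have hN' : N = ∫ z, deriv G (u z) * ‖fderiv ℝ u z‖ := by
        rw [hN]; simp only [hNe]
      rw [← hN', ← hP] at h0
      nlinarith
    have hdis := discrim_le_zero key
    rw [discrim] at hdis
    have hN2 : N ^ 2 ≤ P * (x - y) := by nlinarith
    have hxy : y ≤ x := h.dist_anti hv ht (by linarith)
    have hP1 : P ≤ ∫ z, deriv G (u z) * ‖fderiv ℝ u z‖ ^ 2 := by
      apply integral_mono iP (h.iDg hG's)
      intro z
      have := hG3 (u z)
      have h2 : deriv G (u z) ^ 2 ≤ deriv G (u z) := by nlinarith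
      simp only; gcongr
    have hw := hδ G hG hGz (fun s => by rw [abs_of_nonneg (hG3 s).1]; exact (hG3 s).2)
    have hP2 : ∫ z, deriv G (u z) * ‖fderiv ℝ u z‖ ^ 2 ≤ (∫ z, G (u z)) + δ := by
      linarith [(abs_le.mp hw).2]
    have hP3 : ∫ z, G (u z) ≤ k * x := by
      have i2 : Integrable ({z | t < u z}.indicator (fun _ => k)) :=
        (integrable_indicator_iff (h.lev_meas t)).mpr (integrableOn_const (h.lev_fin hv ht))
      have : ∫ z, G (u z) ≤ ∫ z, {z | t < u z}.indicator (fun _ => k) z := by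
        apply integral_mono hvv.i1 i2
        intro z
        by_cases hz : z ∈ {z | t < u z}
        · simp only [indicator_of_mem hz]; exact (hG2 _).2
        · simp only [indicator_of_notMem hz]
          exact (hG0 _ (not_lt.mp hz)).le
      rw [integral_indicator (h.lev_meas t)] at this
      simp only [integral_const, MeasurableSet.univ, measureReal_restrict_apply, univ_inter,
        smul_eq_mul] at this
      rw [mul_comm]; exact this
    have hfinal : N ^ 2 ≤ (x - y) * (k * x + δ) := by
      refine hN2.trans ?_
      rw [mul_comm]
      apply mul_le_mul_of_nonneg_left _ (by linarith)
      linarith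
    have hsq : (d / R * ((1 - η) * k) * y ^ (1 - 1 / d : ℝ)) ^ 2 ≤ N ^ 2 :=
      pow_le_pow_left₀ (by positivity) hiso' 2
    have hyp : (y ^ (1 - 1 / d : ℝ)) ^ 2 * y ^ (2 / d : ℝ) = y ^ 2 := by
      rw [← Real.rpow_natCast, ← Real.rpow_mul hy0.le, ← Real.rpow_add hy0, ← Real.rpow_natCast]
      congr 1
      push_cast; field_simp; ring
    calc (d / R) ^ 2 * ((1 - η) * k) ^ 2 * y ^ 2
        = (d / R * ((1 - η) * k) * y ^ (1 - 1 / d : ℝ)) ^ 2 * y ^ (2 / d : ℝ) := by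
          rw [← hyp]; ring
      _ ≤ _ := mul_le_mul_of_nonneg_right (hsq.trans hfinal) (by positivity)
  set A := (d / R) ^ 2 * k ^ 2 * y ^ 2 with hA
  have hA0 : 0 ≤ A := by positivity
  refine le_of_forall_pos_le_add (fun ε hε => ?_)
  set η := min (1 / 2) (ε / (2 * A + 1)) with hη
  have hη0 : 0 < η := lt_min (by norm_num) (by positivity)
  have hη1 : η < 1 := (min_le_left _ _).trans_lt (by norm_num)
  have hη2 : η * (2 * A + 1) ≤ ε := by
    rw [← le_div_iff₀ (by positivity)]; exact min_le_right _ _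
  have := main η hη0 hη1
  have e : (d / R) ^ 2 * ((1 - η) * k) ^ 2 * y ^ 2 = (1 - η) ^ 2 * A := by rw [hA]; ring
  rw [e] at this
  nlinarith [mul_nonneg (sq_nonneg η) hA0]
end
end RKJ
namespace RKJ
open scoped ENNReal Pointwise Nat Topology
open Filter

lemma ode_step {x y m0 p c k : ℝ} (hy : 0 < m0) (hmy : m0 ≤ y) (hyx : y ≤ x) (hp : 0 < p)
    (hk : 0 < k)
    (h : c ^ 2 * k * y ^ 2 ≤ (x - y) * x * y ^ p) :
    p * c ^ 2 * k ≤ (x ^ p - y ^ p) * (1 + 2 * c ^ 2 * k / m0 ^ p) := by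
  have hy0 : 0 < y := hy.trans_le hmy
  have hx0 : 0 < x := hy0.trans_le hyx
  set r := y / x with hr
  have hr0 : 0 < r := by positivity
  have hr1 : r ≤ 1 := by rw [hr, div_le_one hx0]; exact hyx
  have hq : x ^ p = y ^ p * r ^ (-p) := by
    rw [hr, Real.rpow_neg (by positivity), Real.div_rpow hy0.le hx0.le]
    have : 0 < y ^ p := by positivity
    have : 0 < x ^ p := by positivity
    field_simp
  have h1 : 1 + p * (1 - r) ≤ r ^ (-p) := by
    rw [Real.rpow_def_of_pos hr0]
    have e1 := Real.add_one_le_exp (Real.log r * -p)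
    have e2 := Real.log_le_sub_one_of_pos hr0
    nlinarith
  have hyp : 0 < y ^ p := by positivity
  have hmp : 0 < m0 ^ p := by positivity
  have hmyp : m0 ^ p ≤ y ^ p := Real.rpow_le_rpow hy.le hmy hp.le
  set D := x ^ p - y ^ p with hD
  have h2 : p * y ^ p * (1 - r) ≤ D := by rw [hD, hq]; nlinarith
  have h3 : c ^ 2 * k * r ^ 2 ≤ y ^ p * (1 - r) := by
    have : c ^ 2 * k * r ^ 2 = c ^ 2 * k * y ^ 2 / x ^ 2 := by rw [hr]; field_simp
    rw [this, div_le_iff₀ (by positivity)]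
    have : y ^ p * (1 - r) * x ^ 2 = (x - y) * x * y ^ p := by rw [hr]; field_simp
    rw [this]; exact h
  have h4 : 1 - r ≤ D / (p * m0 ^ p) := by
    rw [le_div_iff₀ (by positivity)]
    refine le_trans ?_ h2
    have : 0 ≤ 1 - r := by linarith
    nlinarith [mul_le_mul_of_nonneg_left hmyp (mul_nonneg hp.le this)]
  have h5 : p * (c ^ 2 * k) * r ^ 2 ≤ D := by nlinarith
  have h6 : p * (c ^ 2 * k) * (1 - 2 * (D / (p * m0 ^ p))) ≤ D := by
    refine le_trans ?_ h5
    apply mul_le_mul_of_nonneg_left _ (by positivity)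
    nlinarith [sq_nonneg (1 - r)]
  have h7 : p * (c ^ 2 * k) * (2 * (D / (p * m0 ^ p))) = D * (2 * c ^ 2 * k / m0 ^ p) := by
    field_simp
  nlinarith

lemma ode_cmp {m : ℝ → ℝ} {c p : ℝ} (hp : 0 < p) (hm1 : m 0 ≤ 1)
    (ha : ∀ s t, 0 ≤ s → s ≤ t → m t ≤ m s)
    (h : ∀ t k, 0 ≤ t → 0 < k → c ^ 2 * k * m (t + k) ^ 2 ≤ (m t - m (t + k)) * m t * m (t + k) ^ p)
    {t : ℝ} (ht : 0 ≤ t) (hmt : 0 < m t) : m t ^ p ≤ 1 - p * c ^ 2 * t := by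
  rcases ht.eq_or_lt with h0 | ht'
  · subst h0
    simpa using Real.rpow_le_one hmt.le hm1 hp.le
  set m0 := m t with hm0
  have hN : ∀ N : ℕ, p * c ^ 2 * t ≤ (1 - m0 ^ p) * (1 + 2 * c ^ 2 * (t / (N + 1)) / m0 ^ p) := by
    intro N
    set k := t / (N + 1 : ℝ) with hk
    have hk0 : 0 < k := by positivity
    have hkN : k * (N + 1) = t := by rw [hk]; field_simp
    set C := (1 + 2 * c ^ 2 * k / m0 ^ p) with hC
    have hC0 : 0 < C := by positivity
    have hi : ∀ i ∈ Finset.range (N + 1), p * c ^ 2 * k ≤ (m (i * k) ^ p - m ((i + 1 : ℕ) * k) ^ p) * C := by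
      intro i hi
      rw [Finset.mem_range] at hi
      have e : ((i + 1 : ℕ) : ℝ) * k = i * k + k := by push_cast; ring
      have hle : ((i + 1 : ℕ) : ℝ) * k ≤ t := by
        rw [← hkN, mul_comm]
        have : ((i + 1 : ℕ) : ℝ) ≤ N + 1 := by exact_mod_cast hi
        gcongr
      have h0 : 0 ≤ (i : ℝ) * k := by positivity
      apply ode_step hmt (ha _ _ (by positivity) hle) (ha _ _ h0 (by rw [e]; linarith)) hp hk0
      rw [e]
      exact h _ _ h0 hk0
    have hs := Finset.sum_le_sum hi
    rw [Finset.sum_const, ← Finset.sum_mul, Finset.sum_range_sub' (fun i : ℕ => m (i * k) ^ p)] at hs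
    simp only [Finset.card_range, nsmul_eq_mul, Nat.cast_zero, zero_mul] at hs
    push_cast at hs
    rw [show ((N : ℝ) + 1) * k = t by linarith, ← hm0] at hs
    have h01 : m 0 ^ p ≤ 1 := Real.rpow_le_one (hmt.le.trans (ha 0 t le_rfl ht)) hm1 hp.le
    calc p * c ^ 2 * t = (N + 1) * (p * c ^ 2 * k) := by rw [← hkN]; ring
      _ ≤ _ := hs
      _ ≤ _ := by gcongr
  have hlim : Tendsto (fun N : ℕ => (1 - m0 ^ p) * (1 + 2 * c ^ 2 * (t / (N + 1)) / m0 ^ p)) atTop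
      (𝓝 ((1 - m0 ^ p) * (1 + 2 * c ^ 2 * 0 / m0 ^ p))) := by
    have : Tendsto (fun N : ℕ => t / ((N : ℝ) + 1)) atTop (𝓝 0) := by
      have := (tendsto_one_div_add_atTop_nhds_zero_nat (𝕜 := ℝ)).const_mul t
      simpa [div_eq_mul_inv] using this
    exact (((this.const_mul _).div_const _).const_add _).const_mul _
  have := ge_of_tendsto' hlim hN
  simp at this
  linarith

noncomputable def mB (d : ℕ) (R t : ℝ) : ℝ := (max 0 (1 - 2 * d / R ^ 2 * t)) ^ (d / 2 : ℝ)

lemma mB_nonneg (d : ℕ) (R t : ℝ) : 0 ≤ mB d R t := by unfold mB; positivity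

lemma talenti_lim {d : ℕ} (hd : 1 ≤ d) {R : ℝ} (hR : 0 < R) {μ : ℕ → ℝ → ℝ} {δ : ℕ → ℝ}
    (hδ : Tendsto δ atTop (𝓝 0))
    (h0 : ∀ n t, 0 ≤ t → 0 ≤ μ n t) (h1 : ∀ n t, 0 ≤ t → μ n t ≤ 1)
    (ha : ∀ n s t, 0 ≤ s → s ≤ t → μ n t ≤ μ n s)
    (h : ∀ n t k, 0 ≤ t → 0 < k → (d / R) ^ 2 * k ^ 2 * μ n (t + k) ^ 2 ≤
      (μ n t - μ n (t + k)) * (k * μ n t + δ n) * μ n (t + k) ^ (2 / d : ℝ))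
    {t : ℝ} (ht : 0 ≤ t) :
    Tendsto (fun n => max 0 (μ n t - mB d R t)) atTop (𝓝 0) := by
  have hd0 : (0:ℝ) < d := by exact_mod_cast hd
  rw [tendsto_iff_ultrafilter]
  intro 𝒰 h𝒰
  have hlim : ∀ s, ∃ l, 0 ≤ s → (Tendsto (fun n => μ n s) 𝒰 (𝓝 l) ∧ 0 ≤ l ∧ l ≤ 1) := by
    intro s
    by_cases hs : 0 ≤ s
    · have hc : IsCompact (Icc (0:ℝ) 1) := isCompact_Icc
      have := hc.ultrafilter_le_nhds (𝒰.map (fun n => μ n s)) (by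
        rw [le_principal_iff]
        rw [Ultrafilter.coe_map, Filter.mem_map]
        exact Filter.univ_mem' (fun n => ⟨h0 n s hs, h1 n s hs⟩))
      obtain ⟨l, hl, hl'⟩ := this
      exact ⟨l, fun _ => ⟨hl', hl.1, hl.2⟩⟩
    · exact ⟨0, fun h => absurd h hs⟩
  choose m hm using hlim
  have hδ' : Tendsto δ 𝒰 (𝓝 0) := hδ.mono_left h𝒰
  have hp : (0:ℝ) < 2 / d := by positivity
  have hanti : ∀ s t, 0 ≤ s → s ≤ t → m t ≤ m s := fun s t hs hst =>
    le_of_tendsto_of_tendsto' (hm t (hs.trans hst)).1 (hm s hs).1 (fun n => ha n s t hs hst)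
  have hstep : ∀ t k, 0 ≤ t → 0 < k → (d / R) ^ 2 * k * m (t + k) ^ 2 ≤
      (m t - m (t + k)) * m t * m (t + k) ^ (2 / d : ℝ) := by
    intro t k ht hk
    have hx := (hm t ht).1
    have hy := (hm (t + k) (by linarith)).1
    have := le_of_tendsto_of_tendsto' ((hy.pow 2).const_mul ((d / R) ^ 2 * k ^ 2))
      (((hx.sub hy).mul ((hx.const_mul k).add hδ')).mul (hy.rpow_const (Or.inr hp.le)))
      (fun n => h n t k ht hk)
    rw [add_zero] at this
    refine le_of_mul_le_mul_left ?_ hk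
    nlinarith
  have hle : m t ≤ mB d R t := by
    rcases (hm t ht).2.1.eq_or_lt with hz | hz
    · rw [← hz]; exact mB_nonneg _ _ _
    · have := ode_cmp hp (hm 0 le_rfl).2.2 hanti hstep ht hz
      have e : (2 / d : ℝ) * (d / R) ^ 2 * t = 2 * d / R ^ 2 * t := by field_simp
      rw [e] at this
      have e2 : m t = (m t ^ (2 / d : ℝ)) ^ (d / 2 : ℝ) := by
        rw [← Real.rpow_mul hz.le]
        have : (2 / d : ℝ) * (d / 2) = 1 := by field_simp
        rw [this, Real.rpow_one]
      rw [e2]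
      unfold mB
      exact Real.rpow_le_rpow (by positivity) (this.trans (le_max_right _ _)) (by positivity)
  have := ((hm t ht).1.sub_const (mB d R t))
  have := (tendsto_const_nhds (x := (0:ℝ))).max this
  rwa [max_eq_left (by linarith)] at this
end RKJ
namespace RKJ
open scoped ENNReal Pointwise Nat Topology
open Filter

lemma mB_cont {d : ℕ} (R : ℝ) : Continuous (mB d R) := by
  unfold mB
  apply Continuous.rpow_const (by fun_prop)
  intro x; right; positivity

lemma mB_zero {d : ℕ} (hd : 1 ≤ d) {R : ℝ} (hR : 0 < R) {t : ℝ} (ht : R ^ 2 / (2 * d) ≤ t) :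
    mB d R t = 0 := by
  have hd0 : (0:ℝ) < d := by exact_mod_cast hd
  unfold mB
  rw [max_eq_left, Real.zero_rpow (by positivity)]
  rw [div_le_iff₀ (by positivity)] at ht
  rw [sub_nonpos, div_mul_eq_mul_div, le_div_iff₀ (by positivity)]
  linarith

lemma mB_int {d : ℕ} (hd : 1 ≤ d) {R : ℝ} (hR : 0 < R) {g : ℝ → ℝ} (hg : Continuous g) :
    IntegrableOn (fun t => g t * mB d R t) (Ioi 0) := by
  have h1 : IntegrableOn (fun t => g t * mB d R t) (Icc 0 (R ^ 2 / (2 * d))) :=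
    (hg.mul (mB_cont R)).integrableOn_Icc
  apply h1.of_forall_sdiff_eq_zero measurableSet_Ioi
  intro x hx
  rw [mB_zero hd hR, mul_zero]
  by_contra! hn
  exact hx.2 ⟨le_of_lt hx.1, hn.le⟩

section
variable {d : ℕ} {Ω : Set (EuclideanSpace ℝ (Fin d))} {u : EuclideanSpace ℝ (Fin d) → ℝ}

lemma TF.cheb (h : TF Ω u) (hv : volume Ω = 1) {t : ℝ} (ht : 0 ≤ t) :
    dist' u t ≤ (1 + ∫ x, u x ^ 2) * (1 + t ^ 2)⁻¹ := by
  have h1 := h.dist_le_one hv ht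
  have h2 := mul_meas_ge_le_integral_of_nonneg (μ := volume) (f := fun x => u x ^ 2)
    (Eventually.of_forall fun x => sq_nonneg _) h.i2 (t ^ 2)
  have h3 : dist' u t * t ^ 2 ≤ ∫ x, u x ^ 2 := by
    rcases ht.eq_or_lt with h0 | h0
    · rw [← h0]; simp; exact integral_nonneg (fun x => sq_nonneg _)
    refine le_trans ?_ h2
    rw [mul_comm]
    apply mul_le_mul_of_nonneg_left _ (sq_nonneg _)
    apply measureReal_mono
    · intro x hx
      have hx' : t < u x := hx
      show t ^ 2 ≤ u x ^ 2
      gcongr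
    · refine ((measure_mono (?_ : _ ⊆ Ω)).trans_lt (by rw [hv]; exact ENNReal.one_lt_top)).ne
      intro x hx
      by_contra hn
      have h5 : t ^ 2 ≤ u x ^ 2 := hx
      rw [h.zero_off hn] at h5
      have := pow_pos h0 2
      norm_num at h5
      linarith
  rw [← div_eq_mul_inv, le_div_iff₀ (by positivity)]
  linarith

lemma TF.dist_aem (h : TF Ω u) (hv : volume Ω = 1) :
    AEMeasurable (dist' u) (volume.restrict (Ioi 0)) :=
  aemeasurable_restrict_of_antitoneOn measurableSet_Ioi
    (fun _ hs _ _ hst => h.dist_anti hv (le_of_lt hs) hst)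

lemma TF.dist_int (h : TF Ω u) (hv : volume Ω = 1) {g : ℝ → ℝ} (hg : Continuous g) {C : ℝ}
    (hC : ∀ t, |g t| ≤ C) : IntegrableOn (fun t => g t * dist' u t) (Ioi 0) := by
  have h0 : Integrable (fun t : ℝ => C * ((1 + ∫ x, u x ^ 2) * (1 + t ^ 2)⁻¹)) :=
    (integrable_inv_one_add_sq.const_mul _).const_mul _
  refine Integrable.mono' h0.integrableOn (hg.aemeasurable.mul (h.dist_aem hv)).aestronglyMeasurable ?_
  filter_upwards [ae_restrict_mem measurableSet_Ioi] with t ht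
  have h1 := h.cheb hv (le_of_lt ht)
  have h2 : 0 ≤ dist' u t := measureReal_nonneg
  rw [norm_mul, Real.norm_eq_abs, Real.norm_of_nonneg h2]
  exact mul_le_mul (hC t) h1 h2 ((abs_nonneg _).trans (hC t))

lemma TF.layer (h : TF Ω u) (hv : volume Ω = 1) {F F' : ℝ → ℝ} (hF : ∀ s, HasDerivAt F (F' s) s)
    (hF' : Continuous F') (hF0 : F 0 = 0) (hnn : ∀ s, 0 ≤ F' s) :
    ∫ x, F (max 0 (u x)) = ∫ t in Ioi 0, F' t * dist' u t := by
  have hFi : ∀ s, ∫ t in (0:ℝ)..s, F' t = F s := by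
    intro s
    rw [intervalIntegral.integral_eq_sub_of_hasDerivAt (fun x _ => hF x)
      (hF'.intervalIntegrable _ _), hF0, sub_zero]
  have hFc : Continuous F := continuous_iff_continuousAt.mpr fun s => (hF s).continuousAt
  have hmono : Monotone F := monotone_of_deriv_nonneg (fun s => (hF s).differentiableAt)
    (fun s => by rw [(hF s).deriv]; exact hnn s)
  have hpos : ∀ x, 0 ≤ F (max 0 (u x)) := fun x => by
    have := hmono (le_max_left 0 (u x)); rwa [hF0] at this
  have hcu := h.1.continuous
  have lc := lintegral_comp_eq_lintegral_meas_lt_mul (μ := volume) (f := fun x => max 0 (u x)) (g := F')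
    (Eventually.of_forall fun x => le_max_left _ _) (by fun_prop)
    (fun t _ => hF'.intervalIntegrable _ _) (Eventually.of_forall hnn)
  simp only [hFi] at lc
  rw [integral_eq_lintegral_of_nonneg_ae (Eventually.of_forall hpos)
    (by apply Continuous.aestronglyMeasurable; fun_prop), lc,
    integral_eq_lintegral_of_nonneg_ae (f := fun t => F' t * dist' u t)
      (Eventually.of_forall fun t => mul_nonneg (hnn t) measureReal_nonneg)
      (hF'.aemeasurable.mul (h.dist_aem hv)).aestronglyMeasurable]
  congr 1
  apply setLIntegral_congr_fun measurableSet_Ioi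
  intro t ht
  have ht' : 0 < t := ht
  simp only
  have e : {a | t < max 0 (u a)} = {a | t < u a} := by
    ext a; simp [ht'.le, not_lt]
  rw [e, ENNReal.ofReal_mul (hnn t), mul_comm]
  congr 1
  rw [dist', Measure.real, ENNReal.ofReal_toReal (h.lev_fin hv ht'.le)]

lemma lemK (hd : 1 ≤ d) {R : ℝ} (hR : 0 < R) (h : TF Ω u) (hv : volume Ω = 1) {F F' : ℝ → ℝ}
    (hF : ∀ s, HasDerivAt F (F' s) s)
    (hF' : Continuous F') (hF0 : F 0 = 0) {C : ℝ} (hC : ∀ s, |F' s| ≤ C) :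
    ∫ x, F (u x) ≤ (∫ t in Ioi 0, F' t * mB d R t) + C * ((∫ t in Ioi 0, mB d R t) - ∫ x, u x)
      + 2 * C * ∫ t in Ioi 0, max 0 (dist' u t - mB d R t) := by
  have hC0 : 0 ≤ C := (abs_nonneg _).trans (hC 0)
  set Φ : ℝ → ℝ := fun s => C * s + F s with hΦ
  set Φ' : ℝ → ℝ := fun s => C + F' s with hΦ'
  have hΦd : ∀ s, HasDerivAt Φ (Φ' s) s := fun s => by
    have := ((hasDerivAt_id s).const_mul C).add (hF s)
    rwa [mul_one] at this
  have hΦc : Continuous Φ' := by fun_prop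
  have hΦn : ∀ s, 0 ≤ Φ' s := fun s => by have := (abs_le.mp (hC s)).1; simp only [hΦ']; linarith
  have hΦb : ∀ s, Φ' s ≤ 2 * C := fun s => by have := (abs_le.mp (hC s)).2; simp only [hΦ']; linarith
  have hΦ0 : Φ 0 = 0 := by simp [hΦ, hF0]
  have hL := h.layer hv hΦd hΦc hΦ0 hΦn
  have hFc : Continuous F := continuous_iff_continuousAt.mpr fun s => (hF s).continuousAt
  have hΦcc : Continuous Φ := by fun_prop
  have iΦ : Integrable (fun x => Φ (max 0 (u x))) :=
    h.icomp (g := fun s => Φ (max 0 s)) (by fun_prop) (by simp [hΦ0])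
  have iCu : Integrable (fun x => C * u x) := h.i1.const_mul C
  have iF := h.icomp hFc hF0
  have hpt : ∀ s, F s ≤ Φ (max 0 s) - C * s := by
    intro s
    rcases le_total 0 s with hs | hs
    · rw [max_eq_right hs]; simp [hΦ]
    · rw [max_eq_left hs, hΦ0]
      have := Convex.norm_image_sub_le_of_norm_deriv_le (f := F) (C := C) (s := univ) (x := s) (y := 0)
        (fun x _ => (hF x).differentiableAt)
        (fun x _ => by rw [(hF x).deriv]; exact hC x) convex_univ (mem_univ _) (mem_univ _)
      rw [hF0, Real.norm_eq_abs, Real.norm_eq_abs, zero_sub, zero_sub, abs_neg, abs_neg,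
        abs_of_nonpos hs] at this
      have := (abs_le.mp this).2
      linarith
  have h1 : ∫ x, F (u x) ≤ (∫ x, Φ (max 0 (u x))) - C * ∫ x, u x := by
    rw [← integral_const_mul, ← integral_sub iΦ iCu]
    exact integral_mono iF (iΦ.sub iCu) (fun x => hpt (u x))
  have i3 := h.dist_int hv hΦc (C := 2 * C) (fun t => by rw [abs_of_nonneg (hΦn t)]; exact hΦb t)
  have i4 : IntegrableOn (dist' u) (Ioi 0) := by
    simpa using h.dist_int hv (g := fun _ => 1) continuous_const (C := 1) (by simp)
  have i5 := mB_int hd hR hΦc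
  have i6 : IntegrableOn (mB d R) (Ioi 0) := by
    simpa using mB_int hd hR (g := fun _ => 1) continuous_const
  have i7 : IntegrableOn (fun t => max 0 (dist' u t - mB d R t)) (Ioi 0) := by
    have := (i4.sub i6).pos_part
    simpa [IntegrableOn, max_comm] using this
  have i8 : IntegrableOn (fun t => 2 * C * max 0 (dist' u t - mB d R t)) (Ioi 0) := i7.const_mul _
  have h2 : ∫ t in Ioi 0, Φ' t * dist' u t ≤ (∫ t in Ioi 0, Φ' t * mB d R t) +
      2 * C * ∫ t in Ioi 0, max 0 (dist' u t - mB d R t) := by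
    rw [← integral_const_mul, ← integral_add i5 i8]
    apply integral_mono i3 (i5.add i8)
    intro t
    have a1 : Φ' t * (dist' u t - mB d R t) ≤ Φ' t * max 0 (dist' u t - mB d R t) :=
      mul_le_mul_of_nonneg_left (le_max_right _ _) (hΦn t)
    have a2 : Φ' t * max 0 (dist' u t - mB d R t) ≤ 2 * C * max 0 (dist' u t - mB d R t) :=
      mul_le_mul_of_nonneg_right (hΦb t) (le_max_left _ _)
    simp only [Pi.add_apply]
    nlinarith
  have h3 : ∫ t in Ioi 0, Φ' t * mB d R t = C * (∫ t in Ioi 0, mB d R t) +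
      ∫ t in Ioi 0, F' t * mB d R t := by
    have i9 : IntegrableOn (fun t => C * mB d R t) (Ioi 0) := i6.const_mul C
    rw [← integral_const_mul, ← integral_add i9 (mB_int hd hR hF')]
    congr 1
    ext t; simp only [hΦ']; ring
  rw [hL] at h1
  linarith
end

lemma err_lim {d : ℕ} (hd : 1 ≤ d) {R : ℝ} (hR : 0 < R) {Ω : Set (EuclideanSpace ℝ (Fin d))}
    (hv : volume Ω = 1)
    {u : ℕ → EuclideanSpace ℝ (Fin d) → ℝ} (h : ∀ n, TF Ω (u n)) {C : ℝ}
    (hC : ∀ n, ∫ x, u n x ^ 2 ≤ C)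
    (hl : ∀ t, 0 ≤ t → Tendsto (fun n => max 0 (dist' (u n) t - mB d R t)) atTop (𝓝 0)) :
    Tendsto (fun n => ∫ t in Ioi 0, max 0 (dist' (u n) t - mB d R t)) atTop (𝓝 0) := by
  have hb : Integrable (fun t : ℝ => (1 + C) * (1 + t ^ 2)⁻¹) := integrable_inv_one_add_sq.const_mul _
  have := tendsto_integral_of_dominated_convergence (μ := volume.restrict (Ioi (0:ℝ)))
    (F := fun n t => max 0 (dist' (u n) t - mB d R t)) (f := fun _ => 0)
    (fun t : ℝ => (1 + C) * (1 + t ^ 2)⁻¹) ?_ hb.integrableOn ?_ ?_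
  · simpa using this
  · intro n
    exact (aemeasurable_const.max
      (((h n).dist_aem hv).sub (mB_cont R).aemeasurable)).aestronglyMeasurable
  · intro n
    filter_upwards [ae_restrict_mem measurableSet_Ioi] with t ht
    have h1 := (h n).cheb hv (le_of_lt ht)
    have h2 : (1 + ∫ x, u n x ^ 2) * (1 + t ^ 2)⁻¹ ≤ (1 + C) * (1 + t ^ 2)⁻¹ := by
      have := hC n
      gcongr
    have h3 : 0 ≤ dist' (u n) t := measureReal_nonneg
    rw [Real.norm_of_nonneg (le_max_left _ _)]
    apply max_le (by linarith)
    have := mB_nonneg d R t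
    linarith
  · filter_upwards [ae_restrict_mem measurableSet_Ioi] with t ht
    exact hl t (le_of_lt ht)
end RKJ
namespace RKJ
open scoped ENNReal Pointwise Nat Topology
open Filter

lemma seq_exists {d : ℕ} (hd : 1 ≤ d) {R : ℝ} (hR : 0 < R)
    (hB : volume (ball (0 : EuclideanSpace ℝ (Fin d)) R) = 1) {Ω : Set (EuclideanSpace ℝ (Fin d))}
    (hne : Ω.Nonempty) (ho : IsOpen Ω) (hb : Bornology.IsBounded Ω) (hv : volume Ω = 1) :
    ∃ (u : ℕ → EuclideanSpace ℝ (Fin d) → ℝ) (δ : ℕ → ℝ), (∀ n, TF Ω (u n)) ∧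
      Tendsto δ atTop (𝓝 0) ∧
      Tendsto (fun n => ∫ x, u n x) atTop (𝓝 (dirichletTorsion d Ω)) ∧
      (∀ n (K : ℝ) (G : ℝ → ℝ), ContDiff ℝ (⊤ : ℕ∞) G → G 0 = 0 → (∀ s, |deriv G s| ≤ K) →
      |(∫ x, deriv G (u n x) * ‖fderiv ℝ (u n) x‖ ^ 2) - ∫ x, G (u n x)| ≤ K * δ n) ∧
      Tendsto (fun n => ∫ t in Ioi 0, max 0 (dist' (u n) t - mB d R t)) atTop (𝓝 0) := by
  set T := dirichletTorsion d Ω with hT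
  set ε : ℕ → ℝ := fun n => 1 / ((n : ℝ) + 1) with hε
  have hε0 : ∀ n, 0 < ε n := fun n => by simp only [hε]; positivity
  have hεl : Tendsto ε atTop (𝓝 0) := tendsto_one_div_add_atTop_nhds_zero_nat
  choose u h1 h2 h3 h4 h5 using fun n => near_opt hd hb hv hne ho (hε0 n)
  set δ : ℕ → ℝ := fun n => √(ε n * T) + ε n with hδ
  have hδl : Tendsto δ atTop (𝓝 0) := by
    have := ((hεl.mul_const T).sqrt).add hεl
    simpa using this
  have hw : ∀ n (K : ℝ) (G : ℝ → ℝ), ContDiff ℝ (⊤ : ℕ∞) G → G 0 = 0 → (∀ s, |deriv G s| ≤ K) →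
      |(∫ x, deriv G (u n x) * ‖fderiv ℝ (u n) x‖ ^ 2) - ∫ x, G (u n x)| ≤ K * δ n :=
    fun n K G hG hG0 hK => weak hd hb hv (h1 n) (h2 n) (h3 n) (h4 n) (h5 n) hG hG0 hK
  obtain ⟨p, hp, hpo⟩ := poinc hd hb
  refine ⟨u, δ, h1, hδl, ?_, hw, ?_⟩
  · have hl : Tendsto (fun n => T - ε n) atTop (𝓝 T) := by
      simpa using hεl.const_sub T
    exact tendsto_of_tendsto_of_tendsto_of_le_of_le hl tendsto_const_nhds (fun n => (h3 n).le)
      (fun n => h4 n)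
  · apply err_lim hd hR hv h1 (C := T / p)
    · intro n
      rw [le_div_iff₀' hp]
      exact (hpo _ (h1 n)).trans ((h2 n).le.trans (h4 n))
    · intro t ht
      refine talenti_lim hd hR (μ := fun n => dist' (u n)) hδl ?_ ?_ ?_ ?_ ht
      · exact fun n t _ => measureReal_nonneg
      · exact fun n t ht => (h1 n).dist_le_one hv ht
      · exact fun n s t hs hst => (h1 n).dist_anti hv hs hst
      · intro n t k ht hk
        refine talenti_step hd hR hB (h1 n) hv (fun G hG hG0 hK => ?_) ht hk
        simpa using hw n 1 G hG hG0 hK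

lemma tor_le_T0 {d : ℕ} (hd : 1 ≤ d) {R : ℝ} (hR : 0 < R)
    (hB : volume (ball (0 : EuclideanSpace ℝ (Fin d)) R) = 1) {Ω : Set (EuclideanSpace ℝ (Fin d))}
    (hne : Ω.Nonempty) (ho : IsOpen Ω) (hb : Bornology.IsBounded Ω) (hv : volume Ω = 1) :
    dirichletTorsion d Ω ≤ ∫ t in Ioi 0, mB d R t := by
  obtain ⟨u, δ, h1, h2, h3, h4, h5⟩ := seq_exists hd hR hB hne ho hb hv
  have hK : ∀ n, 0 ≤ ((∫ t in Ioi 0, mB d R t) - ∫ x, u n x) +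
      2 * ∫ t in Ioi 0, max 0 (dist' (u n) t - mB d R t) := by
    intro n
    have := lemK hd hR (h1 n) hv (F := fun _ => 0) (F' := fun _ => 0) (C := 1)
      (fun s => hasDerivAt_const _ _) continuous_const rfl (by simp)
    simpa using this
  have := ge_of_tendsto' ((tendsto_const_nhds.sub h3).add (h5.const_mul 2)) hK
  linarith

lemma main_cmp {d : ℕ} (hd : 1 ≤ d) {R : ℝ} (hR : 0 < R)
    (hB : volume (ball (0 : EuclideanSpace ℝ (Fin d)) R) = 1) {Ω : Set (EuclideanSpace ℝ (Fin d))}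
    (hne : Ω.Nonempty) (ho : IsOpen Ω) (hb : Bornology.IsBounded Ω) (hv : volume Ω = 1)
    {l : ℝ} (hl : l ≤ dirichletEigenvalue d Ω) {f : ℝ → ℝ} (hf : ContDiff ℝ (⊤ : ℕ∞) f)
    (hf0 : f 0 = 0) {K C1 C2 : ℝ} (hK : ∀ s, (deriv f s) ^ 2 ≤ K)
    (hC1 : ∀ s, |(deriv f s) ^ 2 - 2 * l * f s * deriv f s| ≤ C1)
    (hC2 : ∀ s, |2 * f s * deriv f s| ≤ C2) :
    (dirichletEigenvalue d Ω - l) * ((∫ t in Ioi 0, (2 * f t * deriv f t) * mB d R t) -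
      C2 * ((∫ t in Ioi 0, mB d R t) - dirichletTorsion d Ω)) ≤
      (∫ t in Ioi 0, ((deriv f t) ^ 2 - 2 * l * f t * deriv f t) * mB d R t) +
      C1 * ((∫ t in Ioi 0, mB d R t) - dirichletTorsion d Ω) := by
  obtain ⟨u, δ, h1, h2, h3, h4, h5⟩ := seq_exists hd hR hB hne ho hb hv
  set L := dirichletEigenvalue d Ω
  set T := dirichletTorsion d Ω
  set T0 := ∫ t in Ioi 0, mB d R t
  set A := ∫ t in Ioi 0, (2 * f t * deriv f t) * mB d R t with hA
  set H := ∫ t in Ioi 0, ((deriv f t) ^ 2 - 2 * l * f t * deriv f t) * mB d R t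
  have hf's : ContDiff ℝ (⊤ : ℕ∞) (deriv f) := (contDiff_infty_iff_deriv.mp hf).2
  have hfc := hf.continuous
  have hf'c := hf's.continuous
  have hfd : ∀ s, HasDerivAt f (deriv f s) s := fun s => (hf.differentiable (by simp) s).hasDerivAt
  set g : ℝ → ℝ := fun s => ∫ x in (0:ℝ)..s, (deriv f x) ^ 2 with hg
  have hgd : ∀ s, HasDerivAt g ((deriv f s) ^ 2) s := fun s =>
    ((hf'c.pow 2).integral_hasStrictDerivAt 0 s).hasDerivAt
  have hgd' : deriv g = fun s => (deriv f s) ^ 2 := funext fun s => (hgd s).deriv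
  have hgs : ContDiff ℝ (⊤ : ℕ∞) g := by
    rw [contDiff_infty_iff_deriv]
    exact ⟨fun s => (hgd s).differentiableAt, by rw [hgd']; exact hf's.pow 2⟩
  have hg0 : g 0 = 0 := by simp [hg]
  have hn : ∀ n, (L - l) * (A - C2 * (T0 - ∫ x, u n x) -
      2 * C2 * ∫ t in Ioi 0, max 0 (dist' (u n) t - mB d R t)) ≤
      H + C1 * (T0 - ∫ x, u n x) +
      2 * C1 * (∫ t in Ioi 0, max 0 (dist' (u n) t - mB d R t)) + K * δ n := by
    intro n
    set e := ∫ t in Ioi 0, max 0 (dist' (u n) t - mB d R t)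
    have a1 := lam_le ((h1 n).comp hf hf0)
    have e1 : ∀ x, ‖fderiv ℝ (fun x => f (u n x)) x‖ ^ 2 = deriv g (u n x) * ‖fderiv ℝ (u n) x‖ ^ 2 := by
      intro x
      rw [(h1 n).fderiv_comp hf, norm_smul, mul_pow, Real.norm_eq_abs, sq_abs, hgd']
    simp only [e1] at a1
    have a2 := (abs_le.mp (h4 n K g hgs hg0 (fun s => by
      rw [hgd']; simp only; rw [abs_of_nonneg (sq_nonneg _)]; exact hK s))).2
    have a3 := lemK hd hR (h1 n) hv (F := fun s => g s - l * f s ^ 2)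
      (F' := fun s => (deriv f s) ^ 2 - 2 * l * f s * deriv f s) (fun s => by
        have := (hgd s).sub (((hfd s).pow 2).const_mul l)
        refine this.congr_deriv ?_
        push_cast; ring) (by fun_prop) (by simp [hg0, hf0]) hC1
    have a4 := lemK hd hR (h1 n) hv (F := fun s => - f s ^ 2)
      (F' := fun s => - (2 * f s * deriv f s)) (fun s => by
        have := ((hfd s).pow 2).neg
        refine this.congr_deriv ?_
        push_cast; ring) (by fun_prop) (by simp [hf0]) (fun s => by rw [abs_neg]; exact hC2 s)
    have e2 : ∫ t in Ioi 0, -(2 * f t * deriv f t) * mB d R t = - A := by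
      rw [hA, ← integral_neg]; simp only [neg_mul]
    have e3 : ∫ x, -(f (u n x)) ^ 2 = - ∫ x, f (u n x) ^ 2 := integral_neg _
    have i1 := (h1 n).icomp hgs.continuous hg0
    have i2 : Integrable (fun x => l * f (u n x) ^ 2) := ((h1 n).comp hf hf0).i2.const_mul l
    rw [integral_sub i1 i2, integral_const_mul] at a3
    rw [e2, e3] at a4
    have a5 : (L - l) * (A - C2 * (T0 - ∫ x, u n x) - 2 * C2 * e) ≤
        (L - l) * ∫ x, f (u n x) ^ 2 := by
      apply mul_le_mul_of_nonneg_left _ (by linarith)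
      linarith
    linarith
  have l1 := (((h3.const_sub T0).const_mul C2).const_sub A).sub (h5.const_mul (2 * C2))
  have l2 := ((((h3.const_sub T0).const_mul C1).const_add H).add (h5.const_mul (2 * C1))).add
    (h2.const_mul K)
  have := le_of_tendsto_of_tendsto' (l1.const_mul (L - l)) l2 hn
  simpa using this
end RKJ
namespace RKJ
open scoped ENNReal Pointwise Nat Topology
open Filter

lemma mB_red {d : ℕ} (hd : 1 ≤ d) {R : ℝ} (hR : 0 < R) (g : ℝ → ℝ) :
    ∫ t in Ioi 0, g t * mB d R t = ∫ t in (0:ℝ)..(R ^ 2 / (2 * d)), g t * mB d R t := by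
  rw [intervalIntegral.integral_of_le (by positivity)]
  apply setIntegral_eq_of_subset_of_forall_sdiff_eq_zero measurableSet_Ioi
    (fun x hx => hx.1)
  intro x hx
  rw [mB_zero hd hR, mul_zero]
  by_contra! hn
  exact hx.2 ⟨hx.1, hn.le⟩

lemma bes_deriv_neg {d : ℕ} (hd : 1 ≤ d) {z0 : ℝ} 
    (hJ : ∀ z, 0 ≤ z → z < z0 → 0 < bes d z) {z : ℝ} (hz : 0 < z) (hz' : z ≤ z0) :
    deriv (bes d) z < 0 := by
  have hd0 : (0:ℝ) < d := by exact_mod_cast hd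
  have hJs := bes_smooth hd
  have hJ's : ContDiff ℝ (⊤ : ℕ∞) (deriv (bes d)) := (contDiff_infty_iff_deriv.mp hJs).2
  have hanti : StrictAntiOn (fun z : ℝ => z ^ (d / 2 : ℝ) * deriv (bes d) z) (Icc 0 z0) := by
    apply strictAntiOn_of_deriv_neg (convex_Icc _ _)
    · apply Continuous.continuousOn
      have := hJ's.continuous
      exact (Real.continuous_rpow_const (by positivity)).mul this
    · intro y hy
      rw [interior_Icc] at hy
      have h1 : HasDerivAt (fun z : ℝ => z ^ (d / 2 : ℝ)) ((d / 2 : ℝ) * y ^ (d / 2 - 1 : ℝ)) y :=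
        Real.hasDerivAt_rpow_const (Or.inl hy.1.ne')
      have h2 := (hJ's.differentiable (by simp) y).hasDerivAt
      have h3 := (h1.mul h2).deriv
      have h4 : (fun z : ℝ => z ^ (d / 2 : ℝ)) * deriv (bes d) = fun z : ℝ => z ^ (d / 2 : ℝ) * deriv (bes d) z := rfl
      rw [h4] at h3
      rw [h3]
      have h5 : y ^ (d / 2 : ℝ) = y ^ (d / 2 - 1 : ℝ) * y := by
        rw [Real.rpow_sub_one hy.1.ne']; field_simp [hy.1.ne']
      have h6 := bes_ode hd y
      have h7 := hJ y hy.1.le hy.2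
      have h8 : 0 < y ^ (d / 2 - 1 : ℝ) := Real.rpow_pos_of_pos hy.1 _
      rw [h5]
      have : (d / 2 : ℝ) * y ^ (d / 2 - 1 : ℝ) * deriv (bes d) y +
          y ^ (d / 2 - 1 : ℝ) * y * deriv (deriv (bes d)) y = y ^ (d / 2 - 1 : ℝ) * (- bes d y / 4) := by
        have : bes d y = -(4 * y * deriv (deriv (bes d)) y + 2 * d * deriv (bes d) y) := by linarith
        rw [this]; ring
      rw [this]
      apply mul_neg_of_pos_of_neg h8; linarith
  have := hanti (show (0:ℝ) ∈ Icc 0 z0 from ⟨le_rfl, hz.le.trans hz'⟩) (show z ∈ Icc 0 z0 from ⟨hz.le, hz'⟩) hz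
  simp only at this
  rw [Real.zero_rpow (by positivity), zero_mul] at this
  have h8 : 0 < z ^ (d / 2 : ℝ) := Real.rpow_pos_of_pos hz _
  by_contra! hn
  nlinarith [mul_nonneg h8.le hn]

lemma mB_deriv {d : ℕ} (hd : 1 ≤ d) {R : ℝ} (hR : 0 < R) {t : ℝ} (ht : t < R ^ 2 / (2 * d)) :
    HasDerivAt (mB d R) (- (d ^ 2 / (R ^ 2 - 2 * d * t)) * mB d R t) t := by
  have hd0 : (0:ℝ) < d := by exact_mod_cast hd
  have hpos : ∀ s : ℝ, s < R ^ 2 / (2 * d) → 0 < 1 - 2 * d / R ^ 2 * s := by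
    intro s hs
    rw [lt_div_iff₀ (by positivity)] at hs
    rw [sub_pos, div_mul_eq_mul_div, div_lt_one (by positivity)]
    linarith
  have h1 : HasDerivAt (fun s : ℝ => 1 - 2 * d / R ^ 2 * s) (-(2 * d / R ^ 2)) t := by
    simpa using ((hasDerivAt_id t).const_mul (2 * d / R ^ 2)).const_sub 1
  have h2 := h1.rpow_const (p := (d / 2 : ℝ)) (Or.inl (hpos t ht).ne')
  have h3 : mB d R =ᶠ[𝓝 t] fun s : ℝ => (1 - 2 * d / R ^ 2 * s) ^ (d / 2 : ℝ) := by
    filter_upwards [Iio_mem_nhds ht] with s hs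
    rw [mB, max_eq_right (hpos s hs).le]
  refine (h2.congr_of_eventuallyEq h3).congr_deriv ?_
  rw [h3.eq_of_nhds, Real.rpow_sub_one (hpos t ht).ne']
  have h4 := hpos t ht
  have h5 : 0 < R ^ 2 - 2 * d * t := by
    rw [lt_div_iff₀ (by positivity)] at ht; linarith
  have h6 : 1 - 2 * d / R ^ 2 * t = (R ^ 2 - 2 * d * t) / R ^ 2 := by field_simp
  generalize hX : (1 - 2 * d / R ^ 2 * t) ^ (d / 2 : ℝ) = X
  rw [h6]
  field_simp

lemma exists_f {d : ℕ} (hd : 1 ≤ d) {R : ℝ} (hR : 0 < R) {z0 : ℝ} (hz0 : 0 < z0)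
    (hz : bes d z0 = 0) (hJ : ∀ z, 0 ≤ z → z < z0 → 0 < bes d z) :
    ∃ f : ℝ → ℝ, ContDiff ℝ (⊤ : ℕ∞) f ∧ f 0 = 0 ∧ (∃ K, ∀ s, (deriv f s) ^ 2 ≤ K) ∧
      (∃ C1, ∀ s, |(deriv f s) ^ 2 - 2 * (z0 / R ^ 2) * f s * deriv f s| ≤ C1) ∧
      (∃ C2, ∀ s, |2 * f s * deriv f s| ≤ C2) ∧
      0 < (∫ t in Ioi 0, (2 * f t * deriv f t) * mB d R t) ∧
      (∫ t in Ioi 0, ((deriv f t) ^ 2 - 2 * (z0 / R ^ 2) * f t * deriv f t) * mB d R t) = 0 := by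
  have hd0 : (0:ℝ) < d := by exact_mod_cast hd
  have hJs := bes_smooth hd
  have hJ's : ContDiff ℝ (⊤ : ℕ∞) (deriv (bes d)) := (contDiff_infty_iff_deriv.mp hJs).2
  set l := z0 / R ^ 2 with hl
  have hl0 : 0 < l := by positivity
  set M := R ^ 2 / (2 * d) with hM
  have hM0 : 0 < M := by positivity
  set q := 2 * d * l with hq
  have hq0 : 0 < q := by positivity
  have hqM : q * M = z0 := by rw [hq, hM, hl]; field_simp
  set f1 : ℝ → ℝ := fun t => bes d (z0 - q * t) with hf1
  set f1' : ℝ → ℝ := fun t => - q * deriv (bes d) (z0 - q * t) with hf1'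
  set f1'' : ℝ → ℝ := fun t => q ^ 2 * deriv (deriv (bes d)) (z0 - q * t) with hf1''
  have hin : ∀ t, HasDerivAt (fun t => z0 - q * t) (- q) t := fun t => by
    simpa using ((hasDerivAt_id t).const_mul q).const_sub z0
  have d1 : ∀ t, HasDerivAt f1 (f1' t) t := fun t => by
    have := ((hJs.differentiable (by simp) (z0 - q * t)).hasDerivAt).comp t (hin t)
    refine this.congr_deriv ?_
    simp only [hf1']; ring
  have d2 : ∀ t, HasDerivAt f1' (f1'' t) t := fun t => by
    have := (((hJ's.differentiable (by simp) (z0 - q * t)).hasDerivAt).comp t (hin t)).const_mul (-q)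
    refine this.congr_deriv ?_
    simp only [hf1'']; ring
  have hf1s : ContDiff ℝ (⊤ : ℕ∞) f1 := hJs.comp (by fun_prop)
  have c1 : Continuous f1 := hf1s.continuous
  have c1' : Continuous f1' := continuous_iff_continuousAt.mpr fun s => (d2 s).continuousAt
  let b : ContDiffBump (0:ℝ) := ⟨M + 1, M + 2, by linarith, by linarith⟩
  set f : ℝ → ℝ := fun t => f1 t * b t with hf
  have hfs : ContDiff ℝ (⊤ : ℕ∞) f := hf1s.mul b.contDiff
  have hfcs : HasCompactSupport f := b.hasCompactSupport.mul_left
  have hfe : ∀ t, 0 ≤ t → t ≤ M → f t = f1 t ∧ deriv f t = f1' t := by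
    intro t h1 h2
    have : f =ᶠ[𝓝 t] f1 := by
      filter_upwards [Ioo_mem_nhds (show t - 1 < t by linarith) (show t < t + 1 by linarith)] with s hs
      simp only [hf]
      rw [b.one_of_mem_closedBall, mul_one]
      rw [mem_closedBall, Real.dist_eq, sub_zero, abs_le]
      simp only [b]
      constructor <;> linarith [hs.1, hs.2]
    exact ⟨this.eq_of_nhds, by rw [this.deriv_eq, (d1 t).deriv]⟩
  have hcf := hfs.continuous
  have hf's : Continuous (deriv f) := hfs.continuous_deriv (by simp)
  have hf'cs : HasCompactSupport (deriv f) := hfcs.deriv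
  refine ⟨f, hfs, ?_, ?_, ?_, ?_, ?_, ?_⟩
  · rw [(hfe 0 le_rfl hM0.le).1]; simp [hf1, hz]
  · have : HasCompactSupport (fun s => (deriv f s) ^ 2) :=
      hf'cs.comp_left (g := fun x => x ^ 2) (by simp)
    obtain ⟨K, hK⟩ := this.exists_bound_of_continuous (by fun_prop)
    exact ⟨K, fun s => (le_abs_self _).trans (hK s)⟩
  · have : HasCompactSupport (fun s => (deriv f s - 2 * l * f s) * deriv f s) := hf'cs.mul_left
    obtain ⟨K, hK⟩ := this.exists_bound_of_continuous (by fun_prop)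
    refine ⟨K, fun s => ?_⟩
    have := hK s
    rw [Real.norm_eq_abs] at this
    convert this using 2; ring
  · have : HasCompactSupport (fun s => (2 * f s) * deriv f s) := hf'cs.mul_left
    obtain ⟨K, hK⟩ := this.exists_bound_of_continuous (by fun_prop)
    exact ⟨K, hK⟩
  · rw [mB_red hd hR]
    apply intervalIntegral.intervalIntegral_pos_of_pos_on
    · apply Continuous.intervalIntegrable
      have := mB_cont (d := d) R
      fun_prop
    · intro t ht
      obtain ⟨e1, e2⟩ := hfe t ht.1.le ht.2.le
      have hlt : q * t < z0 := by rw [← hqM]; exact mul_lt_mul_of_pos_left ht.2 hq0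
      have hgt : 0 < q * t := mul_pos hq0 ht.1
      have p1 : 0 < f1 t := hJ _ (by linarith) (by linarith)
      have p2 : 0 < f1' t := by
        have := bes_deriv_neg hd hJ (z := z0 - q * t) (by linarith) (by linarith)
        simp only [hf1']; nlinarith
      rw [e1, e2]
      have p3 : 0 < mB d R t := by
        unfold mB
        apply Real.rpow_pos_of_pos
        apply lt_max_of_lt_right
        have := ht.2
        rw [lt_div_iff₀ (by positivity)] at this
        rw [sub_pos, div_mul_eq_mul_div, div_lt_one (by positivity)]
        linarith
      positivity
    · exact hM0
  · rw [mB_red hd hR]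
    have hcm := mB_cont (d := d) R
    rw [intervalIntegral.integral_congr (g := fun t => (f1' t ^ 2 - 2 * l * f1 t * f1' t) * mB d R t)]
    · rw [intervalIntegral.integral_eq_sub_of_hasDerivAt_of_le hM0.le
        (f := fun t => (f1 t * f1' t - l * f1 t ^ 2) * mB d R t)]
      · have : mB d R M = 0 := mB_zero hd hR le_rfl
        simp [this, hf1, hz]
      · apply Continuous.continuousOn; fun_prop
      · intro t ht
        have hm := mB_deriv hd hR ht.2
        have h5 : 0 < R ^ 2 - 2 * d * t := by
          have := ht.2
          rw [hM, lt_div_iff₀ (by positivity)] at this; linarith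
        refine ((((d1 t).mul (d2 t)).sub (((d1 t).pow 2).const_mul l)).mul hm).congr_deriv ?_
        simp only [Pi.sub_apply, Pi.mul_apply, Pi.pow_apply]
        have ode := bes_ode hd (z0 - q * t)
        have ez : z0 - q * t = l * (R ^ 2 - 2 * d * t) := by
          rw [hq, hl]; field_simp
        have key : f1'' t * (R ^ 2 - 2 * d * t) = d ^ 2 * (f1' t - l * f1 t) := by
          simp only [hf1, hf1', hf1'']
          have : bes d (z0 - q * t) = -(4 * (z0 - q * t) * deriv (deriv (bes d)) (z0 - q * t) + 2 * d * deriv (bes d) (z0 - q * t)) := by linarith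
          rw [this]
          generalize deriv (deriv (bes d)) (z0 - q * t) = a
          generalize deriv (bes d) (z0 - q * t) = c
          rw [ez, hq]; ring
        have key2 : f1'' t = d ^ 2 * (f1' t - l * f1 t) / (R ^ 2 - 2 * d * t) := by
          rw [eq_div_iff h5.ne']; exact key
        rw [key2]
        field_simp
        push_cast
        ring
      · apply Continuous.intervalIntegrable; fun_prop
    · intro t ht
      rw [uIcc_of_le hM0.le] at ht
      obtain ⟨e1, e2⟩ := hfe t ht.1 ht.2
      simp only [e1, e2]
end RKJ
namespace RKJ
open scoped ENNReal Pointwise Nat Topology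
open Filter

lemma vball {d : ℕ} {R : ℝ} (hR : 0 < R) {x₀ : EuclideanSpace ℝ (Fin d)}
    (hB : volume (ball x₀ R) = 1) (y : EuclideanSpace ℝ (Fin d)) {r : ℝ} (hr : 0 ≤ r) (hd : 1 ≤ d) :
    volume.real (ball y r) = (r / R) ^ d := by
  have : Nonempty (Fin d) := ⟨⟨0, hd⟩⟩
  have h1 := Measure.addHaar_ball volume x₀ hR.le
  have h2 := Measure.addHaar_ball volume y hr
  rw [hB] at h1
  rw [finrank_euclideanSpace_fin] at h1 h2
  have h1' := congrArg ENNReal.toReal h1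
  rw [ENNReal.toReal_mul, ENNReal.toReal_ofReal (by positivity)] at h1'
  rw [Measure.real, h2, ENNReal.toReal_mul, ENNReal.toReal_ofReal (by positivity), div_pow]
  simp at h1'
  field_simp
  linear_combination - r ^ d * h1'

lemma ibp_lin {d : ℕ} {Ω : Set (EuclideanSpace ℝ (Fin d))} {v : EuclideanSpace ℝ (Fin d) → ℝ}
    (h : TF Ω v) (x₀ : EuclideanSpace ℝ (Fin d)) :
    d * ∫ x, v x = - ∫ x, fderiv ℝ v x (x - x₀) := by
  set e : Fin d → EuclideanSpace ℝ (Fin d) := fun i => EuclideanSpace.single i 1 with he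
  have hsum : ∀ (L : EuclideanSpace ℝ (Fin d) →L[ℝ] ℝ) (y : EuclideanSpace ℝ (Fin d)),
      ∑ i, L (e i) * y i = L y := by
    intro L y
    conv_rhs => rw [← (EuclideanSpace.basisFun (Fin d) ℝ).sum_repr y]
    simp [he, mul_comm]
  have hc1 : ∀ i x, HasFDerivAt (fun x : EuclideanSpace ℝ (Fin d) => (x - x₀) i)
      (EuclideanSpace.proj i : EuclideanSpace ℝ (Fin d) →L[ℝ] ℝ) x := by
    intro i x
    have := (EuclideanSpace.proj i : EuclideanSpace ℝ (Fin d) →L[ℝ] ℝ).hasFDerivAt.comp x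
      ((hasFDerivAt_id (𝕜 := ℝ) x).sub_const x₀)
    exact this.congr_fderiv (by ext v; simp)
  have hD := h.cD
  have hvc := h.1.continuous
  have hDc : HasCompactSupport (fderiv ℝ v) := h.2.1.fderiv ℝ
  have hcc : ∀ i, Continuous (fun x : EuclideanSpace ℝ (Fin d) => (x - x₀) i) := fun i => by fun_prop
  have I1 : ∀ i, Integrable (fun x => fderiv ℝ v x (e i) * (x - x₀) i) := by
    intro i
    apply Continuous.integrable_of_hasCompactSupport
    · exact (hD.clm_apply continuous_const).mul (hcc i)
    · have h3 : HasCompactSupport (fun x => fderiv ℝ v x (e i)) :=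
        HasCompactSupport.intro hDc (fun x hx => by
          rw [image_eq_zero_of_notMem_tsupport hx]; simp)
      exact h3.mul_right
  have ibp : ∀ i, ∫ x, v x = - ∫ x, fderiv ℝ v x (e i) * (x - x₀) i := by
    intro i
    have hone : ∀ x, fderiv ℝ (fun x : EuclideanSpace ℝ (Fin d) => (x - x₀) i) x (e i) = 1 := by
      intro x; rw [(hc1 i x).fderiv]; simp [he]
    have := integral_mul_fderiv_eq_neg_fderiv_mul_of_integrable (μ := volume) (f := v)
      (g := fun x : EuclideanSpace ℝ (Fin d) => (x - x₀) i) (v := e i) (I1 i)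
      (by simp only [hone, mul_one]; exact h.i1) (by
        apply Continuous.integrable_of_hasCompactSupport
        · exact hvc.mul (hcc i)
        · exact h.2.1.mul_right) (fun x _ => h.1.differentiable (by simp) x)
      (fun x _ => (hc1 i x).differentiableAt)
    simp only [hone, mul_one] at this
    exact this
  have : ∑ i : Fin d, ∫ x, v x = ∑ i : Fin d, - ∫ x, fderiv ℝ v x (e i) * (x - x₀) i :=
    Finset.sum_congr rfl (fun i _ => ibp i)
  rw [Finset.sum_neg_distrib, ← integral_finsetSum _ (fun i _ => I1 i)] at this
  simp only [hsum] at this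
  simpa using this

lemma tor_ball {d : ℕ} (hd : 1 ≤ d) {R : ℝ} (hR : 0 < R) (x₀ : EuclideanSpace ℝ (Fin d))
    (hB : volume (ball x₀ R) = 1) :
    ∫ t in Ioi 0, mB d R t ≤ dirichletTorsion d (ball x₀ R) := by
  have hd0 : (0:ℝ) < d := by exact_mod_cast hd
  set M := R ^ 2 / (2 * d) with hM
  have hM0 : 0 < M := by positivity
  set w : EuclideanSpace ℝ (Fin d) → ℝ := fun x => (R ^ 2 - ‖x - x₀‖ ^ 2) / (2 * d) with hw
  have hws : ContDiff ℝ (⊤ : ℕ∞) w := by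
    have : ContDiff ℝ (⊤ : ℕ∞) (fun x : EuclideanSpace ℝ (Fin d) => ‖x - x₀‖ ^ 2) := by
      apply ContDiff.norm_sq ℝ; fun_prop
    exact (contDiff_const.sub this).div_const _
  have hwc := hws.continuous
  have hwM : ∀ x, w x ≤ M := fun x => by
    simp only [hw, hM]; gcongr; linarith [sq_nonneg ‖x - x₀‖]
  have hwball : ∀ x, 0 < w x ↔ x ∈ ball x₀ R := by
    intro x
    rw [mem_ball, dist_eq_norm]
    simp only [hw]
    rw [div_pos_iff_of_pos_right (by positivity), sub_pos, sq_lt_sq₀ (norm_nonneg _) hR.le]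
  have hwd : ∀ x, HasFDerivAt w ((- (1 / d : ℝ)) • (innerSL ℝ (x - x₀))) x := by
    intro x
    have h0 : HasFDerivAt (fun x : EuclideanSpace ℝ (Fin d) => ‖x - x₀‖ ^ 2)
        (2 • (innerSL ℝ (x - x₀))) x := by
      have := ((hasFDerivAt_id (𝕜 := ℝ) x).sub_const x₀).norm_sq
      exact this.congr_fderiv (by ext v; simp)
    have h1 := (h0.const_sub (R ^ 2)).const_mul (1 / (2 * d : ℝ))
    have h2 : w = fun x => 1 / (2 * d : ℝ) * (R ^ 2 - ‖x - x₀‖ ^ 2) := by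
      ext x; simp only [hw]; ring
    rw [h2]
    refine h1.congr_fderiv ?_
    ext v
    simp only [ContinuousLinearMap.smul_apply, ContinuousLinearMap.neg_apply, smul_eq_mul, nsmul_eq_mul]
    push_cast
    field_simp
  have hbfin : IsFiniteMeasure (volume.restrict (ball x₀ R)) := ⟨by simp [hB]⟩
  -- integral of w
  have hcs : HasCompactSupport (fun x => max 0 (w x)) := by
    apply HasCompactSupport.of_support_subset_isCompact (isCompact_closedBall x₀ R)
    intro x hx
    have : 0 < w x := by
      by_contra! hn
      exact hx (max_eq_left hn)
    exact ball_subset_closedBall ((hwball x).mp this)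
  have iw : Integrable (fun x => max 0 (w x)) :=
    Continuous.integrable_of_hasCompactSupport (by fun_prop) hcs
  have hT0 : ∫ x, max 0 (w x) = ∫ t in Ioi 0, mB d R t := by
    rw [iw.integral_eq_integral_meas_lt (Eventually.of_forall fun x => le_max_left _ _)]
    apply setIntegral_congr_fun measurableSet_Ioi
    intro t ht
    have ht' : 0 < t := ht
    have e : {a | t < max 0 (w a)} = ball x₀ √(R ^ 2 - 2 * d * t) := by
      ext a
      rw [mem_ball, dist_eq_norm, Real.lt_sqrt (norm_nonneg _)]
      show t < max 0 (w a) ↔ _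
      rw [lt_max_iff]
      simp only [hw]
      rw [lt_div_iff₀ (by positivity)]
      constructor
      · rintro (h | h) <;> linarith
      · intro h; right; linarith
    simp only
    rw [e, vball hR hB _ (Real.sqrt_nonneg _) hd]
    unfold mB
    have e2 : √(R ^ 2 - 2 * d * t) / R = √(max 0 (1 - 2 * d / R ^ 2 * t)) := by
      have e3 : 1 - 2 * d / R ^ 2 * t = (R ^ 2 - 2 * d * t) / R ^ 2 := by field_simp
      rw [e3]
      rcases le_total 0 (R ^ 2 - 2 * d * t) with h | h
      · rw [max_eq_right (by positivity), Real.sqrt_div h, Real.sqrt_sq hR.le]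
      · rw [max_eq_left (div_nonpos_of_nonpos_of_nonneg h (by positivity)), Real.sqrt_eq_zero_of_nonpos h]
        simp
    rw [e2, Real.sqrt_eq_rpow, ← Real.rpow_natCast, ← Real.rpow_mul (le_max_left _ _)]
    congr 1; ring
  refine le_of_forall_pos_lt_add (fun ε hε => ?_)
  obtain ⟨G, hG, hG0, -, hG2, hG3, -, -, hG6⟩ := exists_G (ε / 4) (h := 2 * M)
    (η := min (1 / 2) (ε / (4 * M))) (by positivity) (lt_min (by norm_num) (by positivity))
    ((min_le_left _ _).trans_lt (by norm_num))
  set η := min (1 / 2) (ε / (4 * M)) with hη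
  have hη1 : η ≤ 1 / 2 := min_le_left _ _
  have hη2 : η * (4 * M) ≤ ε := by rw [← le_div_iff₀ (by positivity)]; exact min_le_right _ _
  have hlow : ∀ s, s ≤ M → s - ε / 2 ≤ G s := by
    intro s hs
    have := hG6 s (by nlinarith)
    nlinarith
  set v : EuclideanSpace ℝ (Fin d) → ℝ := fun x => G (w x) with hv
  have hvs : ContDiff ℝ (⊤ : ℕ∞) v := hG.comp hws
  have hsub : tsupport v ⊆ {x | ε / 4 ≤ w x} := by
    apply closure_minimal
    · intro x hx
      show ε / 4 ≤ w x
      by_contra! hn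
      exact hx (hG0 _ hn.le)
    · exact isClosed_le continuous_const hwc
  have hsub2 : tsupport v ⊆ ball x₀ R := fun x hx => (hwball x).mp (by
    have : ε / 4 ≤ w x := hsub hx
    linarith)
  have hTF : TF (ball x₀ R) v := by
    refine ⟨hvs, ?_, hsub2⟩
    exact (isCompact_closedBall x₀ R).of_isClosed_subset (isClosed_tsupport _)
      (hsub2.trans ball_subset_closedBall)
  have hvd : ∀ x, fderiv ℝ v x = (- (deriv G (w x) / d)) • innerSL ℝ (x - x₀) := by
    intro x
    have h1 := (hG.differentiable (by simp) (w x)).hasDerivAt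
    have := (h1.comp_hasFDerivAt x (hwd x)).fderiv
    have h2 : fderiv ℝ v x = _ := this
    rw [h2, smul_smul]
    congr 1; ring
  have hib := ibp_lin hTF x₀
  have hint : ∫ x, v x = ∫ x, deriv G (w x) * (‖x - x₀‖ ^ 2 / d ^ 2) := by
    have : ∀ x, fderiv ℝ v x (x - x₀) = - d * (deriv G (w x) * (‖x - x₀‖ ^ 2 / d ^ 2)) := by
      intro x
      rw [hvd]
      simp only [ContinuousLinearMap.smul_apply, innerSL_apply_apply, smul_eq_mul, real_inner_self_eq_norm_sq]
      field_simp
    simp only [this] at hib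
    rw [integral_const_mul] at hib
    have : (d:ℝ) * ∫ x, v x = d * ∫ x, deriv G (w x) * (‖x - x₀‖ ^ 2 / d ^ 2) := by linarith
    exact mul_left_cancel₀ hd0.ne' this
  have hDle : ∫ x, ‖fderiv ℝ v x‖ ^ 2 ≤ ∫ x, v x := by
    rw [hint]
    apply integral_mono hTF.iD
    · have hDc : HasCompactSupport (fderiv ℝ v) := hTF.2.1.fderiv ℝ
      have hcG : Continuous (deriv G) := hG.continuous_deriv (by simp)
      have : (fun x => deriv G (w x) * (‖x - x₀‖ ^ 2 / d ^ 2)) = 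
          fun x => - (1 / d) * fderiv ℝ v x (x - x₀) := by
        ext x
        rw [hvd]
        simp only [ContinuousLinearMap.smul_apply, innerSL_apply_apply, smul_eq_mul, real_inner_self_eq_norm_sq]
        field_simp
      rw [this]
      apply Continuous.integrable_of_hasCompactSupport
      · have := hTF.cD
        fun_prop
      · apply HasCompactSupport.mul_left
        apply HasCompactSupport.intro hDc
        intro x hx
        rw [image_eq_zero_of_notMem_tsupport hx]; simp
    · intro x
      simp only
      rw [hvd, norm_smul, innerSL_apply_norm, Real.norm_eq_abs, mul_pow, sq_abs, neg_sq, div_pow]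
      have h3 := hG3 (w x)
      have h4 : deriv G (w x) ^ 2 ≤ deriv G (w x) := by nlinarith
      calc _ = deriv G (w x) ^ 2 * (‖x - x₀‖ ^ 2 / d ^ 2) := by ring
        _ ≤ _ := by gcongr
  have hvT : (∫ t in Ioi 0, mB d R t) - ε / 2 ≤ ∫ x, v x := by
    rw [← hT0, ← hTF.s1]
    have e1 : ∫ x, max 0 (w x) = ∫ x in ball x₀ R, max 0 (w x) := by
      symm
      apply setIntegral_eq_integral_of_forall_compl_eq_zero
      intro x hx
      rw [← hwball] at hx
      exact max_eq_left (not_lt.mp hx)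
    have e2 : ∫ x in ball x₀ R, (max 0 (w x) - ε / 2) = (∫ x in ball x₀ R, max 0 (w x)) - ε / 2 := by
      rw [integral_sub iw.restrict (integrable_const _)]
      simp [Measure.real, hB]
    rw [e1, ← e2]
    apply setIntegral_mono_on (iw.restrict.sub (integrable_const _)) hTF.i1.restrict measurableSet_ball
    intro x hx
    show max 0 (w x) - ε / 2 ≤ v x
    rw [max_eq_right ((hwball x).mpr hx).le]
    exact hlow _ (hwM x)
  have hTp := tor_pos hd isBounded_ball hB ⟨x₀, by simpa using hR⟩ isOpen_ball
  have htl := tor_le hd isBounded_ball hB hTF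
  set T := dirichletTorsion d (ball x₀ R)
  have : ∫ x, v x ≤ T := by
    by_contra! hn
    have h1 : T * ∫ x, ‖fderiv ℝ v x‖ ^ 2 ≤ T * ∫ x, v x := by gcongr
    nlinarith
  linarith
end RKJ
namespace RKJ

lemma rpow_exp {x q : ℝ} (hx : 0 < x) (hq : 0 ≤ q) : x ^ q ≤ Real.exp (-(q * (1 - x))) := by
  rw [Real.rpow_def_of_pos hx]
  apply Real.exp_le_exp.mpr
  have := Real.log_le_sub_one_of_pos hx
  nlinarith

/-- the purely numerical conclusion -/
lemma numeric {ls T0 A C1 C2 : ℝ} (hls : 0 < ls) (hT0 : 0 < T0) (hA : 0 < A) (hC1 : 0 ≤ C1)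
    (hC2 : 0 ≤ C2) : ∃ qbar : ℝ, 1 < qbar ∧ ∀ q, qbar ≤ q → ∀ l T : ℝ, 0 < T → T ≤ T0 → l * T ≤ 1 →
      (l - ls) * (A - C2 * (T0 - T)) ≤ C1 * (T0 - T) → l * T ^ q ≤ ls * T0 ^ q := by
  set K' := 2 * C1 * T0 / (A * ls) with hK'
  have hK0 : 0 ≤ K' := by positivity
  set ε := A / (2 * (C2 + 1) * T0) with hε
  have hε0 : 0 < ε := by positivity
  have hp : 0 < 1 / (ε * (ls * T0)) := by positivity
  refine ⟨2 + K' + 1 / (ε * (ls * T0)), by linarith, ?_⟩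
  intro q hq l T hT hTT hlT hmain
  have hx0 : 0 < T / T0 := by positivity
  have hx1 : T / T0 ≤ 1 := (div_le_one hT0).mpr hTT
  have hTx : T = T / T0 * T0 := by field_simp
  have hTq : T ^ q = (T / T0) ^ q * T0 ^ q := by
    rw [← Real.mul_rpow hx0.le hT0.le, ← hTx]
  have hT0q : 0 < T0 ^ q := Real.rpow_pos_of_pos hT0 q
  have hTqp : 0 < T ^ q := Real.rpow_pos_of_pos hT q
  rcases le_total l ls with hl | hl
  · have : T ^ q ≤ T0 ^ q := Real.rpow_le_rpow hT.le hTT (by linarith)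
    calc l * T ^ q ≤ ls * T ^ q := by gcongr
      _ ≤ _ := by gcongr
  set x := T / T0 with hx
  rcases le_total (C2 * (T0 - T)) (A / 2) with hc | hc
  · have h1 : (l - ls) * (A / 2) ≤ C1 * (T0 - T) := by
      refine le_trans ?_ hmain
      apply mul_le_mul_of_nonneg_left _ (by linarith)
      linarith
    have h2 : l ≤ ls * (1 + K' * (1 - x)) := by
      have e : ls * (1 + K' * (1 - x)) = ls + C1 * (T0 - T) / (A / 2) := by
        rw [hK', hx]; field_simp
      rw [e]
      have := (le_div_iff₀ (by positivity : 0 < A / 2)).mpr h1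
      linarith
    have h3 : 1 + K' * (1 - x) ≤ Real.exp (K' * (1 - x)) := by
      have := Real.add_one_le_exp (K' * (1 - x)); linarith
    have h4 := rpow_exp hx0 (by linarith : 0 ≤ q)
    have h5 : (1 + K' * (1 - x)) * x ^ q ≤ 1 := by
      calc _ ≤ Real.exp (K' * (1 - x)) * Real.exp (-(q * (1 - x))) := by
            apply mul_le_mul h3 h4 (Real.rpow_nonneg hx0.le q) (Real.exp_pos _).le
        _ = Real.exp (-((q - K') * (1 - x))) := by rw [← Real.exp_add]; congr 1; ring
        _ ≤ 1 := by
            apply Real.exp_le_one_iff.mpr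
            have : 0 ≤ (q - K') * (1 - x) := mul_nonneg (by linarith) (by linarith)
            linarith
    calc l * T ^ q ≤ (ls * (1 + K' * (1 - x))) * T ^ q := by gcongr
      _ = ls * ((1 + K' * (1 - x)) * x ^ q) * T0 ^ q := by rw [hTq]; ring
      _ ≤ ls * 1 * T0 ^ q := by gcongr
      _ = _ := by ring
  · have h1 : ε ≤ 1 - x := by
      rw [hε, div_le_iff₀ (by positivity)]
      have e : (1 - x) * (2 * (C2 + 1) * T0) = 2 * (C2 + 1) * (T0 - T) := by
        rw [hx]; field_simp
      rw [e]; nlinarith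
    have h2 := rpow_exp hx0 (by linarith : 0 ≤ q - 1)
    have h3 : x ^ (q - 1) ≤ ls * T0 := by
      have hq1 : 1 / (ε * (ls * T0)) ≤ q - 1 := by linarith
      rw [div_le_iff₀ (by positivity)] at hq1
      have h6 : (q - 1) * ε ≤ (q - 1) * (1 - x) := by
        apply mul_le_mul_of_nonneg_left h1; linarith
      have h7 := Real.add_one_le_exp ((q - 1) * (1 - x))
      refine h2.trans ?_
      rw [Real.exp_neg]
      have hpos : 0 < (q - 1) * ε := mul_pos (by linarith) hε0
      calc (Real.exp ((q - 1) * (1 - x)))⁻¹ ≤ ((q - 1) * ε)⁻¹ := by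
            apply inv_anti₀ hpos; linarith
        _ ≤ ls * T0 := by
            rw [inv_le_iff_one_le_mul₀ hpos]; linarith
    have e1 : ∀ y : ℝ, 0 < y → y ^ q = y * y ^ (q - 1) := by
      intro y hy
      rw [Real.rpow_sub_one hy.ne']; field_simp
    have e2 : T ^ (q - 1) = x ^ (q - 1) * T0 ^ (q - 1) := by
      rw [← Real.mul_rpow hx0.le hT0.le, ← hTx]
    have p1 : 0 < T0 ^ (q - 1) := Real.rpow_pos_of_pos hT0 _
    have p2 : 0 < T ^ (q - 1) := Real.rpow_pos_of_pos hT _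
    calc l * T ^ q = (l * T) * T ^ (q - 1) := by rw [e1 T hT]; ring
      _ ≤ 1 * T ^ (q - 1) := by gcongr
      _ = x ^ (q - 1) * T0 ^ (q - 1) := by rw [one_mul, e2]
      _ ≤ ls * T0 * T0 ^ (q - 1) := by gcongr
      _ = _ := by rw [e1 T0 hT0]; ring

end RKJ

theorem reverse_kohler_jobin_inequality (d : ℕ) (hd : 1 ≤ d) :
    ∃ qbar : ℝ, 1 < qbar ∧
      ∀ q : ℝ, qbar ≤ q →
        ∀ (x₀ : EuclideanSpace ℝ (Fin d)) (R : ℝ), 0 < R →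
          volume (ball x₀ R) = 1 →
          ∀ Ω : Set (EuclideanSpace ℝ (Fin d)),
            Ω.Nonempty → IsOpen Ω → Bornology.IsBounded Ω → volume Ω = 1 →
            dirichletEigenvalue d Ω * dirichletTorsion d Ω ^ q ≤
              dirichletEigenvalue d (ball x₀ R) * dirichletTorsion d (ball x₀ R) ^ q := by
  have hcen : ∀ (x : EuclideanSpace ℝ (Fin d)) (r : ℝ), volume (ball x r) =
      volume (ball (0 : EuclideanSpace ℝ (Fin d)) r) := fun x r => Measure.addHaar_ball_center _ x r
  by_cases hex : ∃ R : ℝ, 0 < R ∧ volume (ball (0 : EuclideanSpace ℝ (Fin d)) R) = 1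
  swap
  · refine ⟨2, by norm_num, fun q _ x₀ R hR hB => ?_⟩
    exact absurd ⟨R, hR, by rw [← hcen x₀ R]; exact hB⟩ hex
  obtain ⟨R, hR, hB⟩ := hex
  obtain ⟨z0, hz0, hz, hJ⟩ := RKJ.exists_zero hd
  obtain ⟨f, hf, hf0, ⟨K, hK⟩, ⟨C1, hC1⟩, ⟨C2, hC2⟩, hA, hZ⟩ := RKJ.exists_f hd hR hz0 hz hJ
  have hC10 : 0 ≤ C1 := (abs_nonneg _).trans (hC1 0)
  have hC20 : 0 ≤ C2 := (abs_nonneg _).trans (hC2 0)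
  have hls : 0 < z0 / R ^ 2 := by positivity
  have hT0 : 0 < ∫ t in Ioi 0, RKJ.mB d R t :=
    (RKJ.tor_pos hd isBounded_ball hB ⟨0, by simpa using hR⟩ isOpen_ball).trans_le
      (RKJ.tor_le_T0 hd hR hB ⟨0, by simpa using hR⟩ isOpen_ball isBounded_ball hB)
  obtain ⟨qbar, hq1, hqb⟩ := RKJ.numeric hls hT0 hA hC10 hC20
  refine ⟨qbar, hq1, ?_⟩
  intro q hq x₀ R' hR' hB' Ω hne ho hb hv
  have hRR : R' = R := by
    have h1 := RKJ.vball hR hB x₀ hR'.le hd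
    rw [Measure.real, hB'] at h1
    have h2 : R' / R = 1 := (pow_eq_one_iff_of_nonneg (by positivity) (by omega)).mp h1.symm
    field_simp at h2
    exact h2
  subst hRR
  have hlB : z0 / R' ^ 2 ≤ dirichletEigenvalue d (ball x₀ R') := by
    apply RKJ.le_lam ⟨x₀, by simpa using hR⟩ isOpen_ball
    intro u hu
    refine RKJ.barta hd hls (r := R') ?_ x₀ hu.1 hu.2.1 hu.2.2
    intro z h0 h1
    apply hJ z h0
    have : z0 / R' ^ 2 * R' ^ 2 = z0 := by field_simp
    linarith
  have hTB := RKJ.tor_ball hd hR x₀ hB'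
  have hq0 : 0 ≤ q := by linarith
  refine le_trans ?_ (mul_le_mul hlB (Real.rpow_le_rpow hT0.le hTB hq0)
    (Real.rpow_nonneg hT0.le q) (hls.le.trans hlB))
  have hTp := RKJ.tor_pos hd hb hv hne ho
  have hTle := RKJ.tor_le_T0 hd hR hB hne ho hb hv
  rcases le_total (dirichletEigenvalue d Ω) (z0 / R' ^ 2) with hl | hl
  · exact mul_le_mul hl (Real.rpow_le_rpow hTp.le hTle hq0) (Real.rpow_nonneg hTp.le q) hls.le
  · have := RKJ.main_cmp hd hR hB hne ho hb hv hl hf hf0 hK hC1 hC2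
    rw [hZ, zero_add] at this
    exact hqb q hq _ _ hTp hTle (RKJ.lam_tor hd hb hv hne ho) this
end
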